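/- Let (A, G) be a generalized pair with G connected reductive, A of countable dimension, and let V be an irreducible A-module. Let P ∈ Ass_{Z(g)}(V) be an associated prime. Then the localization satisfies V_P / P·V_P ≠ 0. -/

import Mathlib

set_option synthInstance.maxHeartbeats 1000000
set_option maxHeartbeats 2000000

open UniversalEnvelopingAlgebra

universe u

section TranscendenceDegree

variable {k : Type*} [Field k] {D E : Type u} [CommRing D] [CommRing E] [Algebra k D] [Algebra k E]

open Cardinal in
theorem trdeg_lt_of_surjective_of_not_injective [IsDomain D] [IsDomain E]
    [Algebra.FiniteType k D] (f : D →ₐ[k] E) (hf : Function.Surjective f)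
    (hf' : ¬ Function.Injective f) :
    Algebra.trdeg k E < Algebra.trdeg k D := by
  by_contra! hle
  obtain ⟨s, hs⟩ := exists_isTranscendenceBasis k E
  choose g hg using hf
  have hfg : f ∘ (fun i : s => g i) = ((↑) : s → E) := by funext i; simp [hg]
  have hind : AlgebraicIndependent k (fun i : s => g i) := by
    refine AlgebraicIndependent.of_comp f ?_
    rw [hfg]; exact hs.1
  have hb : IsTranscendenceBasis k (fun i : s => g i) := by
    refine hind.isTranscendenceBasis_of_trdeg_le (trdeg_lt_aleph0_of_finiteType) ?_
    rw [hs.cardinalMk_eq_trdeg]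
    exact hle
  obtain ⟨c, hc0, hc⟩ : ∃ c, c ≠ 0 ∧ f c = 0 := by
    rw [injective_iff_map_eq_zero] at hf'
    push Not at hf'
    obtain ⟨c, h1, h2⟩ := hf'
    exact ⟨c, h2, h1⟩
  have halg := hb.isAlgebraic
  obtain ⟨r, hr, d, hd⟩ := (halg.isAlgebraic c).exists_nonzero_dvd
    (mem_nonZeroDivisors_of_ne_zero hc0)
  obtain ⟨p, hp⟩ : ∃ p, MvPolynomial.aeval (fun i : s => g i) p = (r : D) := by
    have := (Algebra.adjoin_range_eq_range_aeval k (fun i : s => g i)).le r.2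
    exact this
  have h0 : MvPolynomial.aeval ((↑) : s → E) p = 0 := by
    rw [← hfg, Function.comp_def, ← MvPolynomial.comp_aeval_apply, hp]
    have : (r : D) = c * d := hd
    rw [this, map_mul, hc, zero_mul]
  have : p = 0 := hs.1.eq_zero_of_aeval_eq_zero _ h0
  apply hr
  ext
  rw [← hp, this]; simp

theorem eq_of_le_of_trdeg_eq [Algebra.FiniteType k D] {I J : Ideal D} [I.IsPrime] [J.IsPrime]
    (h : I ≤ J) (hd : Algebra.trdeg k (D ⧸ I) = Algebra.trdeg k (D ⧸ J)) : I = J := by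
  by_contra hne
  have := trdeg_lt_of_surjective_of_not_injective (Ideal.Quotient.factorₐ k h)
    (Ideal.Quotient.factor_surjective h) (fun hi => hne (le_antisymm h ?_))
  · rw [hd] at this; exact lt_irrefl _ this
  · intro x hx
    rw [← Ideal.Quotient.eq_zero_iff_mem]
    apply hi
    rw [map_zero]
    exact Ideal.Quotient.eq_zero_iff_mem.mpr hx

theorem trdeg_quotient_comap_of_isIntegral (f : D →ₐ[k] E) (Q : Ideal E) [Q.IsPrime]
    (hf : ((Ideal.Quotient.mk Q).comp (f : D →+* E)).IsIntegral) :
    Algebra.trdeg k (D ⧸ Q.comap f) = Algebra.trdeg k (E ⧸ Q) := by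
  let φ : D ⧸ Q.comap f →ₐ[k] E ⧸ Q := Ideal.quotientMapₐ Q f le_rfl
  let := φ.toRingHom.toAlgebra
  have : IsScalarTower k (D ⧸ Q.comap f) (E ⧸ Q) := IsScalarTower.of_algHom φ
  have : FaithfulSMul (D ⧸ Q.comap f) (E ⧸ Q) := by
    rw [faithfulSMul_iff_algebraMap_injective]
    exact Ideal.quotientMap_injective
  have : Algebra.IsIntegral (D ⧸ Q.comap f) (E ⧸ Q) := by
    constructor
    intro x
    obtain ⟨x, rfl⟩ := Ideal.Quotient.mk_surjective x
    have := hf (Ideal.Quotient.mk Q x)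
    exact RingHom.IsIntegralElem.of_comp (f := Ideal.Quotient.mk (Q.comap f)) this
  have : (Q.comap f).IsPrime := Ideal.IsPrime.comap f
  have : FaithfulSMul k (D ⧸ Q.comap f) := by
    rw [faithfulSMul_iff_algebraMap_injective]
    exact (algebraMap k (D ⧸ Q.comap f)).injective
  rw [← trdeg_add_eq k (D ⧸ Q.comap f) (A := E ⧸ Q), trdeg_eq_zero (R := D ⧸ Q.comap f) (A := E ⧸ Q),
    add_zero]

theorem isIntegral_mk_comp_of_ker_le {R S T : Type*} [CommRing R] [CommRing S] [CommRing T]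
    (f : R →+* S) (g : S →+* T)
    (h : (g.comp f).IsIntegral) (Q : Ideal S) (hQ : RingHom.ker g ≤ Q) :
    ((Ideal.Quotient.mk Q).comp f).IsIntegral := by
  intro x
  obtain ⟨x, rfl⟩ := Ideal.Quotient.mk_surjective x
  have h1 : ((Ideal.Quotient.mk (RingHom.ker g)).comp f).IsIntegralElem
      (Ideal.Quotient.mk (RingHom.ker g) x) := by
    refine RingHom.IsIntegralElem.of_map (RingHom.kerLift_injective g) ?_
    exact h (g x)
  exact h1.map (Ideal.Quotient.factor hQ)
end TranscendenceDegree

section LinkedModules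

theorem exists_prime_annihilator_disjoint {W N : Type*} [CommRing W] [IsNoetherianRing W]
    [AddCommGroup N] [Module W N] (y : N) (M : Submonoid W) (hM : ∀ m ∈ M, m • y ≠ 0) :
    ∃ (Q : Ideal W) (y' : N), Q.IsPrime ∧ (∀ w, w ∈ Q ↔ w • y' = 0) ∧
      (∀ w : W, w • y = 0 → w ∈ Q) ∧ ∀ m ∈ M, m ∉ Q := by
  obtain ⟨Q₀, hQ₀, hle, hd⟩ := Ideal.exists_le_prime_disjoint
    ((⊥ : Submodule W N).colon {y}) M (by
      rw [Set.disjoint_left]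
      intro w hw hwM
      exact hM w hwM (by simpa [Submodule.mem_colon_singleton] using hw))
  obtain ⟨Q, hQ, hQle⟩ := Ideal.exists_minimalPrimes_le hle
  obtain ⟨y', hy'⟩ := Submodule.exists_eq_colon_of_mem_minimalPrimes hQ
  refine ⟨Q, y', hQ.1.1, ?_, ?_, ?_⟩
  · intro w; rw [hy', Submodule.mem_colon_singleton, Submodule.mem_bot]
  · intro w hw
    apply hQ.1.2
    rw [Submodule.mem_colon_singleton, Submodule.mem_bot, hw]
  · intro m hm hmQ
    exact Set.disjoint_left.mp hd (hQle hmQ) hm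

variable {Z W : Type*} [CommRing Z] [CommRing W]

theorem exists_mul_pow_mem (l r : Z →+* W) (Q : Ideal W) [Q.IsPrime] (J : Ideal Z)
    (hQr : Q.comap r = J) (j : Z) (hj : l j ∈ Q) (n : ℕ) (p : Polynomial Z)
    (hp : ∃ i ≤ n, p.coeff i ∉ J) :
    ∃ w ∉ Q, w * l j ^ n ∈ Ideal.span {p.eval₂ r (l j)} ⊔ J.map r := by
  have key : ∀ p : Polynomial Z, p.eval₂ r (l j) = p.divX.eval₂ r (l j) * l j + r (p.coeff 0) := by
    intro p
    conv_lhs => rw [← Polynomial.divX_mul_X_add p]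
    simp
  induction n generalizing p with
  | zero =>
    obtain ⟨i, hi, hpi⟩ := hp
    obtain rfl : i = 0 := by omega
    refine ⟨p.eval₂ r (l j), ?_, ?_⟩
    · intro h
      apply hpi
      rw [← hQr, Ideal.mem_comap]
      rw [key] at h
      exact (Ideal.add_mem_iff_right _ (Ideal.mul_mem_left _ _ hj)).mp h
    · rw [pow_zero, mul_one]
      exact Ideal.mem_sup_left (Ideal.mem_span_singleton_self _)
  | succ n ih =>
    by_cases h0 : p.coeff 0 ∈ J
    · obtain ⟨i, hi, hpi⟩ := hp
      have hi0 : i ≠ 0 := by rintro rfl; exact hpi h0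
      obtain ⟨w, hw, hwm⟩ := ih p.divX ⟨i - 1, by omega, by
        rw [Polynomial.coeff_divX]; rwa [Nat.sub_add_cancel (by omega)]⟩
      refine ⟨w, hw, ?_⟩
      rw [pow_succ, ← mul_assoc]
      have h2 : (Ideal.span {p.divX.eval₂ r (l j)} ⊔ J.map r) * Ideal.span {l j} ≤
          Ideal.span {p.eval₂ r (l j)} ⊔ J.map r := by
        rw [Ideal.sup_mul, Ideal.span_singleton_mul_span_singleton]
        apply sup_le
        · rw [Ideal.span_singleton_le_iff_mem]
          have : p.divX.eval₂ r (l j) * l j = p.eval₂ r (l j) - r (p.coeff 0) := by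
            rw [key p]; ring
          rw [this]
          exact Ideal.sub_mem _ (Ideal.mem_sup_left (Ideal.mem_span_singleton_self _))
            (Ideal.mem_sup_right (Ideal.mem_map_of_mem _ h0))
        · exact Ideal.mul_le_left.trans le_sup_right
      exact h2 (Ideal.mul_mem_mul hwm (Ideal.mem_span_singleton_self _))
    · refine ⟨p.eval₂ r (l j), ?_, ?_⟩
      · intro h
        apply h0
        rw [← hQr, Ideal.mem_comap]
        rw [key] at h
        exact (Ideal.add_mem_iff_right _ (Ideal.mul_mem_left _ _ hj)).mp h
      · exact Ideal.mem_sup_left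
          (Ideal.mul_mem_right _ _ (Ideal.mem_span_singleton_self _))

/-- Primes `p x` of `W` (the coordinate ring of a product of two copies of `Spec Z`) that are graphs
of correspondences that are finite on both sides, of bounded multiplicities. -/
structure IsCorrespondenceFamily {X D : Type*} [PartialOrder D] (l r : Z →+* W) (p : X → Ideal W)
    (d : Ideal Z → D) (n B : ℕ) : Prop where
  anti : ∀ J J' : Ideal Z, J.IsPrime → J'.IsPrime → J ≤ J' → d J' ≤ d J
  eq_of_le : ∀ J J' : Ideal Z, J.IsPrime → J'.IsPrime → J ≤ J' → d J = d J' → J = J'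
  dim : ∀ (x : X) (Q : Ideal W), Q.IsPrime → p x ≤ Q → d (Q.comap l) = d (Q.comap r)
  count : ∀ (Q : Ideal W), Q.IsPrime → ∀ S : Finset X, (∀ x ∈ S, p x ≤ Q) → S.card ≤ B
  degree : ∀ (x : X) (z : Z), ∃ f : Polynomial Z, f.Monic ∧ f.natDegree = n ∧
    f.eval₂ r (l z) ∈ p x

variable {X D : Type*} [PartialOrder D] {l r : Z →+* W} {p : X → Ideal W} {d : Ideal Z → D}
  {n B : ℕ}

theorem IsCorrespondenceFamily.exists_smul_eq_zero (h : IsCorrespondenceFamily l r p d n B)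
    [IsNoetherianRing W] {N : Type*} [AddCommGroup N] [Module W N] (J : Ideal Z) [hJ : J.IsPrime]
    (hN : ∀ y : N, y ≠ 0 → ∀ z, r z • y = 0 ↔ z ∈ J) (S : Finset X)
    (hS : ∀ w ∈ ∏ x ∈ S, p x, ∀ y : N, w • y = 0) (j : Z) (hj : j ∈ J) (x : N) :
    ∃ s ∉ J, l (s * j ^ (n * B)) • x = 0 := by
  classical
  by_contra! hcon
  obtain ⟨Q, y', hQ, hQy', hQy, hQd⟩ := exists_prime_annihilator_disjoint
    (l (j ^ (n * B)) • x) (J.primeCompl.map l) (by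
      rintro _ ⟨s, hs, rfl⟩
      rw [smul_smul, ← map_mul]
      exact hcon s hs)
  have hy' : y' ≠ 0 := by
    rintro rfl
    exact hQ.ne_top ((Ideal.eq_top_iff_one _).mpr ((hQy' 1).mpr (smul_zero _)))
  have hQr : Q.comap r = J := by
    ext z; rw [Ideal.mem_comap, hQy', hN y' hy']
  have hQl : Q.comap l ≤ J := by
    intro z hz
    by_contra hzJ
    exact hQd (l z) ⟨z, hzJ, rfl⟩ hz
  have hprod : ∏ x ∈ S, p x ≤ Q := fun w hw => (hQy' w).mpr (hS w hw y')
  obtain ⟨μ₀, -, hμ₀⟩ := hQ.prod_le.mp hprod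
  have hQl' : Q.comap l = J := by
    refine h.eq_of_le _ _ (hQ.comap l) hJ hQl ?_
    rw [h.dim μ₀ Q hQ hμ₀, hQr]
  have hjQ : l j ∈ Q := by rw [← Ideal.mem_comap, hQl']; exact hj
  have claim : ∀ μ : X, ∃ w ∉ Q, w * l j ^ (if p μ ≤ Q then n else 0) ∈ p μ ⊔ J.map r := by
    intro μ
    split_ifs with hμ
    · obtain ⟨f, hf, hfn, hfm⟩ := h.degree μ j
      obtain ⟨w, hw, hwm⟩ := exists_mul_pow_mem l r Q J hQr j hjQ n f
        ⟨n, le_rfl, by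
          rw [← hfn, hf.coeff_natDegree]
          exact fun h1 => hJ.ne_top ((Ideal.eq_top_iff_one _).mpr h1)⟩
      have hle : Ideal.span {f.eval₂ r (l j)} ≤ p μ := by
        rwa [Ideal.span_singleton_le_iff_mem]
      exact ⟨w, hw, (sup_le_sup_right hle (J.map r)) hwm⟩
    · obtain ⟨w, hw, hwQ⟩ := SetLike.not_le_iff_exists.mp hμ
      exact ⟨w, hwQ, Ideal.mem_sup_left (by simpa using hw)⟩
  choose w hw hwm using claim
  have hprodmem : ∀ S' : Finset X, (∏ μ ∈ S', (w μ * l j ^ (if p μ ≤ Q then n else 0))) ∈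
      (∏ μ ∈ S', p μ) ⊔ J.map r := by
    intro S'
    induction S' using Finset.induction_on with
    | empty => simp
    | insert a s ha ih =>
      rw [Finset.prod_insert ha, Finset.prod_insert ha]
      have h2 : (p a ⊔ J.map r) * ((∏ μ ∈ s, p μ) ⊔ J.map r) ≤
          (p a * ∏ μ ∈ s, p μ) ⊔ J.map r := by
        rw [Ideal.sup_mul, Ideal.mul_sup]
        refine sup_le (sup_le le_sup_left ?_) ?_
        · exact Ideal.mul_le_right.trans le_sup_right
        · exact Ideal.mul_le_left.trans le_sup_right
      exact h2 (Ideal.mul_mem_mul (hwm a) ih)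
  have hkill : ∀ u ∈ (∏ μ ∈ S, p μ) ⊔ J.map r, u • x = 0 := by
    intro u hu
    have : (∏ μ ∈ S, p μ) ⊔ J.map r ≤ (⊥ : Submodule W N).colon {x} := by
      apply sup_le
      · intro v hv
        rw [Submodule.mem_colon_singleton, Submodule.mem_bot]
        exact hS v hv x
      · rw [Ideal.map_le_iff_le_comap]
        intro z hz
        rw [Ideal.mem_comap, Submodule.mem_colon_singleton, Submodule.mem_bot]
        by_cases hx : x = 0
        · rw [hx, smul_zero]
        · exact (hN x hx z).mpr hz
    have := this hu
    rwa [Submodule.mem_colon_singleton, Submodule.mem_bot] at this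
  have h1 := hkill _ (hprodmem S)
  rw [Finset.prod_mul_distrib, Finset.prod_pow_eq_pow_sum, ← Finset.sum_filter, Finset.sum_const,
    smul_eq_mul] at h1
  have hcard := h.count Q hQ (S.filter fun μ => p μ ≤ Q) (fun x hx => (Finset.mem_filter.mp hx).2)
  have h2 : (∏ μ ∈ S, w μ) ∈ Q := by
    apply hQy
    obtain ⟨c, hc⟩ := Nat.exists_eq_add_of_le (Nat.mul_le_mul_right n hcard)
    rw [mul_comm n B, hc, smul_smul, map_pow, pow_add, ← mul_assoc, mul_comm, mul_smul, h1,
      smul_zero]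
  obtain ⟨a, -, ha⟩ := hQ.prod_mem_iff.mp h2
  exact hw a ha

/-- `N` relates the annihilator of `x` to that of `x'` through a finite union of the
correspondences `p`. -/
def IsLinked (l r : Z →+* W) (p : X → Ideal W) {V : Type*} [AddCommGroup V] [Module Z V]
    (x x' : V) : Prop :=
  ∃ (m : ℕ) (M : Submodule Z V) (Φ : W →+* Module.End Z (Fin m → M)) (S : Finset X)
    (φ : (Fin m → M) →+ V),
    (∀ w ∈ ∏ x ∈ S, p x, Φ w = 0) ∧ (∀ z y, Φ (r z) y = z • y) ∧
    (∀ z y, φ (Φ (l z) y) = z • φ y) ∧ (∃ y, φ y = x') ∧ ∀ z : Z, z • x = 0 → ∀ y ∈ M, z • y = 0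

variable {V : Type*} [AddCommGroup V] [Module Z V]

theorem IsCorrespondenceFamily.rank_le (h : IsCorrespondenceFamily l r p d n B)
    [IsNoetherianRing W] {x x' : V} (hlink : IsLinked l r p x x') (J J' : Ideal Z) [hJ : J.IsPrime]
    [hJ' : J'.IsPrime] (hx : ∀ z, z ∈ J ↔ z • x = 0) (hx' : ∀ z, z ∈ J' ↔ z • x' = 0) :
    d J' ≤ d J := by
  obtain ⟨m, M, Φ, S, φ, hS, hr, hφ, ⟨y, hy⟩, hxM⟩ := hlink
  let : Module W (Fin m → M) := Module.compHom _ Φ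
  have hsmul : ∀ (w : W) (y : Fin m → M), w • y = Φ w y := fun _ _ => rfl
  obtain ⟨Q, y', hQ, hQy', hQy, hQd⟩ := exists_prime_annihilator_disjoint y (J'.primeCompl.map l) (by
    rintro _ ⟨s, hs, rfl⟩ h0
    refine hs ((hx' s).mpr ?_)
    rw [← hy, ← hφ, ← hsmul, h0, map_zero])
  have hprod : ∏ x ∈ S, p x ≤ Q := fun w hw => (hQy' w).mpr (by rw [hsmul, hS w hw]; rfl)
  obtain ⟨μ₀, -, hμ₀⟩ := hQ.prod_le.mp hprod
  have hl : Q.comap l ≤ J' := by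
    intro z hz
    by_contra hzJ
    exact hQd (l z) ⟨z, hzJ, rfl⟩ hz
  have hr' : J ≤ Q.comap r := by
    intro z hz
    rw [Ideal.mem_comap, hQy', hsmul, hr]
    funext i
    ext
    exact hxM z ((hx z).mp hz) _ (y' i).2
  calc d J' ≤ d (Q.comap l) := h.anti _ _ (hQ.comap l) hJ' hl
    _ = d (Q.comap r) := h.dim μ₀ Q hQ hμ₀
    _ ≤ d J := h.anti _ _ hJ (hQ.comap r) hr'

theorem IsCorrespondenceFamily.not_forall_exists_smul_mem (h : IsCorrespondenceFamily l r p d n B)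
    [IsNoetherianRing W] [IsNoetherianRing Z]
    (hlink : ∀ x x' : V, x ≠ 0 → IsLinked l r p x x') {R : Type*} [CommRing R] (ρ : R →+* Z)
    (P : Ideal R) [hP : P.IsPrime] (v : V) (hv : ∀ a, a ∈ P ↔ ∃ k : ℕ, ρ a ^ k • v = 0) :
    ¬ ∀ x : V, ∃ s ∉ P, ρ s • x ∈ (P.map ρ) • (⊤ : Submodule Z V) := by
  intro hcon
  obtain ⟨J, x₀, hJ, hJx, hJv, hJd⟩ := exists_prime_annihilator_disjoint v (P.primeCompl.map ρ) (by
    rintro _ ⟨s, hs, rfl⟩ h0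
    exact hs ((hv s).mpr ⟨1, by rwa [pow_one]⟩))
  have hPJ : P.map ρ ≤ J := by
    rw [Ideal.map_le_iff_le_comap]
    intro a ha
    obtain ⟨k, hk⟩ := (hv a).mp ha
    exact hJ.mem_of_pow_mem k (hJv _ hk)
  have hsJ : ∀ s ∉ P, ρ s ∉ J := fun s hs => hJd _ ⟨s, hs, rfl⟩
  have hx₀ : x₀ ≠ 0 := by
    rintro rfl
    exact hJ.ne_top ((Ideal.eq_top_iff_one _).mpr ((hJx 1).mpr (smul_zero _)))
  have hann : ∀ x' : V, x' ≠ 0 → (∀ z ∈ J, z • x' = 0) → ∀ z, z • x' = 0 → z ∈ J := by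
    intro x' hx' hJz z hz
    obtain ⟨J', y, hJ', hJy, hJx', -⟩ := exists_prime_annihilator_disjoint (W := Z) x' ⊥ (by
      intro m hm
      rw [Submonoid.mem_bot.mp hm, one_smul]; exact hx')
    have hy : y ≠ 0 := by
      rintro rfl
      exact hJ'.ne_top ((Ideal.eq_top_iff_one _).mpr ((hJy 1).mpr (smul_zero _)))
    have : J = J' := by
      refine h.eq_of_le J J' hJ hJ' (fun z hz => hJx' z (hJz z hz)) (le_antisymm ?_ ?_)
      · exact h.rank_le (hlink y x₀ hy) J' J hJy hJx
      · exact h.rank_le (hlink x₀ y hx₀) J J' hJx hJy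
    rw [this]
    exact hJx' z hz
  let K : Ideal Z :=
    { carrier := {z | ∀ x : V, ∃ s ∉ J, (s * z) • x = 0}
      add_mem' := by
        intro a b ha hb x
        obtain ⟨s, hs, hsx⟩ := ha x
        obtain ⟨t, ht, htx⟩ := hb x
        refine ⟨s * t, hJ.mul_notMem hs ht, ?_⟩
        have : s * t * (a + b) = t * (s * a) + s * (t * b) := by ring
        rw [this, add_smul, mul_smul t, hsx, mul_smul s, htx, smul_zero, smul_zero, add_zero]
      zero_mem' := fun x => ⟨1, fun h1 => hJ.ne_top ((Ideal.eq_top_iff_one _).mpr h1), by simp⟩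
      smul_mem' := by
        intro c a ha x
        obtain ⟨s, hs, hsx⟩ := ha x
        refine ⟨s, hs, ?_⟩
        have : s * (c • a) = c * (s * a) := by rw [smul_eq_mul]; ring
        rw [this, mul_smul, hsx, smul_zero] }
  have hJK : J ≤ K.radical := by
    intro j hj
    refine ⟨n * B, ?_⟩
    intro x'
    obtain ⟨m, M, Φ, S, φ, hS, hr, hφ, ⟨y, hy⟩, hxM⟩ := hlink x₀ x' hx₀
    let : Module W (Fin m → M) := Module.compHom _ Φ
    have hsmul : ∀ (w : W) (y : Fin m → M), w • y = Φ w y := fun _ _ => rfl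
    obtain ⟨s, hs, hsy⟩ := h.exists_smul_eq_zero (N := Fin m → M) J (by
        intro y hy0 z
        rw [hsmul, hr]
        constructor
        · intro hz
          obtain ⟨i, hi⟩ := Function.ne_iff.mp hy0
          refine hann (y i : V) (by simpa using hi) (fun z hz => hxM z ((hJx z).mp hz) _ (y i).2) z ?_
          have := congrFun hz i
          simpa using congrArg Subtype.val this
        · intro hz
          funext i
          ext
          exact hxM z ((hJx z).mp hz) _ (y i).2) S (by
        intro w hw y
        rw [hsmul, hS w hw]; rfl) j hj y
    refine ⟨s, hs, ?_⟩
    rw [← hy, ← hφ, ← hsmul, hsy, map_zero]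
  obtain ⟨e, he⟩ := Ideal.exists_pow_le_of_le_radical_of_fg hJK (IsNoetherian.noetherian J)
  have step : ∀ k : ℕ, ∀ x : V, ∃ s ∉ J, s • x ∈ (J ^ k) • (⊤ : Submodule Z V) := by
    intro k
    induction k with
    | zero =>
      intro x
      exact ⟨1, fun h1 => hJ.ne_top ((Ideal.eq_top_iff_one _).mpr h1), by simp⟩
    | succ k ih =>
      intro x
      obtain ⟨s, hs, hsx⟩ := hcon x
      have hsx' : ρ s • x ∈ J • (⊤ : Submodule Z V) := Submodule.smul_mono_left hPJ hsx
      have : ∀ y ∈ J • (⊤ : Submodule Z V), ∃ t ∉ J, t • y ∈ (J ^ (k + 1)) • (⊤ : Submodule Z V) := by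
        intro y hy
        induction hy using Submodule.smul_induction_on' with
        | smul a ha w hw =>
          obtain ⟨t, ht, htw⟩ := ih w
          refine ⟨t, ht, ?_⟩
          rw [smul_comm, pow_succ', mul_smul]
          exact Submodule.smul_mem_smul ha htw
        | add y hy w hw ihy ihw =>
          obtain ⟨t, ht, hty⟩ := ihy
          obtain ⟨t', ht', hty'⟩ := ihw
          refine ⟨t * t', hJ.mul_notMem ht ht', ?_⟩
          rw [smul_add, mul_smul t t' w, mul_comm, mul_smul]
          exact add_mem (Submodule.smul_mem _ _ hty) (Submodule.smul_mem _ _ hty')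
      obtain ⟨t, ht, hty⟩ := this _ hsx'
      exact ⟨t * ρ s, hJ.mul_notMem ht (hsJ s hs), by rwa [mul_smul]⟩
  obtain ⟨s, hs, hsx⟩ := step e x₀
  have hkill : ∀ y ∈ (J ^ e) • (⊤ : Submodule Z V), ∃ t ∉ J, t • y = 0 := by
    intro y hy
    induction hy using Submodule.smul_induction_on' with
    | smul a ha w hw =>
      obtain ⟨t, ht, htw⟩ := he ha w
      exact ⟨t, ht, by rwa [smul_smul]⟩
    | add y hy w hw ihy ihw =>
      obtain ⟨t, ht, hty⟩ := ihy
      obtain ⟨t', ht', hty'⟩ := ihw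
      refine ⟨t * t', hJ.mul_notMem ht ht', ?_⟩
      rw [smul_add, mul_smul t t' w, hty', smul_zero, mul_comm, mul_smul, hty, smul_zero, add_zero]
  obtain ⟨t, ht, hty⟩ := hkill _ hsx
  rw [smul_smul] at hty
  exact hJ.mul_notMem ht hs ((hJx _).mpr hty)

end LinkedModules

section ShiftedGraphs

theorem exists_ringHom_extension {W T F : Type*} [CommRing W] [CommRing T] [Field F]
    [IsAlgClosed F] (g : W →+* T) (hg : g.IsIntegral) (Q : Ideal W) [Q.IsPrime]
    (hQ : RingHom.ker g ≤ Q) [Algebra (W ⧸ Q) F] [FaithfulSMul (W ⧸ Q) F] :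
    ∃ φ : T →+* F, ∀ w, φ (g w) = algebraMap (W ⧸ Q) F (Ideal.Quotient.mk Q w) := by
  let : Algebra W T := g.toAlgebra
  have : Algebra.IsIntegral W T := ⟨hg⟩
  obtain ⟨Q', -, hQ', hQQ'⟩ := Ideal.exists_ideal_over_prime_of_isIntegral (S := T) Q ⊥ hQ
  have hlo : Q'.LiesOver Q := ⟨hQQ'.symm⟩
  have : Algebra.IsIntegral (W ⧸ Q) (T ⧸ Q') := inferInstance
  have : Algebra.IsAlgebraic (W ⧸ Q) (T ⧸ Q') := inferInstance
  have : FaithfulSMul (W ⧸ Q) (T ⧸ Q') := by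
    rw [faithfulSMul_iff_algebraMap_injective, injective_iff_map_eq_zero]
    intro x hx
    obtain ⟨w, rfl⟩ := Ideal.Quotient.mk_surjective x
    have hx' : Ideal.Quotient.mk Q' (algebraMap W T w) = 0 := hx
    rw [Ideal.Quotient.eq_zero_iff_mem] at hx' ⊢
    rw [← hQQ']
    exact hx'
  let φ : T ⧸ Q' →ₐ[W ⧸ Q] F := IsAlgClosed.lift
  refine ⟨(φ : T ⧸ Q' →+* F).comp (Ideal.Quotient.mk Q'), fun w => ?_⟩
  exact φ.commutes (Ideal.Quotient.mk Q w)

variable {k : Type*} [Field k] {σ : Type*}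

/-- Translation by `μ` on polynomial functions. -/
noncomputable def shift (μ : σ → k) : MvPolynomial σ k →ₐ[k] MvPolynomial σ k :=
  MvPolynomial.aeval fun i => MvPolynomial.X i + MvPolynomial.C (μ i)

theorem shift_surjective (μ : σ → k) : Function.Surjective (shift μ) := by
  intro p
  refine ⟨shift (-μ) p, ?_⟩
  have : (shift μ).comp (shift (-μ)) = AlgHom.id k _ := by
    ext i
    simp [shift]
  exact DFunLike.congr_fun this p

variable [Finite σ]

variable {Z : Type*} [CommRing Z] [Algebra k Z]

theorem finiteType_of_finite_of_injective (γ : Z →ₐ[k] MvPolynomial σ k)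
    (hγ : Function.Injective γ) (hγf : (γ : Z →+* MvPolynomial σ k).Finite) :
    Algebra.FiniteType k Z := by
  let : Algebra Z (MvPolynomial σ k) := (γ : Z →+* MvPolynomial σ k).toAlgebra
  have : IsScalarTower k Z (MvPolynomial σ k) := IsScalarTower.of_algHom γ
  have : Module.Finite Z (MvPolynomial σ k) := hγf
  exact ⟨fg_of_fg_of_fg k Z (MvPolynomial σ k) Algebra.FiniteType.out Module.Finite.fg_top hγ⟩

open TensorProduct

/-- The prime of the graph of the translation by `μ`, pushed down along `γ ⊗ γ`. -/
noncomputable def shiftGraph (γ : Z →ₐ[k] MvPolynomial σ k) (μ : σ → k) : Ideal (Z ⊗[k] Z) :=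
  RingHom.ker (Algebra.TensorProduct.productMap ((shift μ).comp γ) γ)

theorem card_le_of_ringHom (γ : Z →ₐ[k] MvPolynomial σ k)
    (hγf : (γ : Z →+* MvPolynomial σ k).Finite) : ∃ n : ℕ, ∀ (F : Type*) [Field F] (ψ : Z →+* F),
    ∃ R : Finset (σ → F), R.card ≤ n ∧ ∀ φ : MvPolynomial σ k →+* F,
      (∀ z, φ (γ z) = ψ z) → (fun i => φ (MvPolynomial.X i)) ∈ R := by
  classical
  have := Fintype.ofFinite σ
  have hint := hγf.to_isIntegral
  choose f hf hf0 using fun i : σ => hint (MvPolynomial.X i)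
  refine ⟨∏ i, (f i).natDegree, fun F _ ψ => ?_⟩
  refine ⟨Fintype.piFinset fun i => ((f i).map ψ).roots.toFinset, ?_, ?_⟩
  · rw [Fintype.card_piFinset]
    refine Finset.prod_le_prod' fun i _ => ?_
    refine (Multiset.toFinset_card_le _).trans ((Polynomial.card_roots' _).trans ?_)
    exact Polynomial.natDegree_map_le
  · intro φ hφ
    rw [Fintype.mem_piFinset]
    intro i
    rw [Multiset.mem_toFinset, Polynomial.mem_roots ((hf i).map ψ).ne_zero, Polynomial.IsRoot,
      Polynomial.eval_map]
    have h1 : ψ = φ.comp (γ : Z →+* MvPolynomial σ k) := by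
      ext z; exact (hφ z).symm
    rw [h1, ← Polynomial.hom_eval₂]
    have h2 := hf0 i
    rw [h2, map_zero]

theorem exists_isCorrespondenceFamily (γ : Z →ₐ[k] MvPolynomial σ k)
    (hγ : Function.Injective γ) (hγf : (γ : Z →+* MvPolynomial σ k).Finite) :
    ∃ n B : ℕ, IsCorrespondenceFamily (Algebra.TensorProduct.includeLeft : Z →ₐ[k] Z ⊗[k] Z).toRingHom
      (Algebra.TensorProduct.includeRight : Z →ₐ[k] Z ⊗[k] Z).toRingHom (shiftGraph γ)
      (fun J => Algebra.trdeg k (Z ⧸ J)) n B := by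
  classical
  have hft := finiteType_of_finite_of_injective γ hγ hγf
  have hintγ := hγf.to_isIntegral
  obtain ⟨b, hb⟩ := card_le_of_ringHom γ hγf
  let G : (σ → k) → (Z ⊗[k] Z →ₐ[k] MvPolynomial σ k) := fun μ =>
    Algebra.TensorProduct.productMap ((shift μ).comp γ) γ
  have hGr : ∀ μ z, G μ (1 ⊗ₜ z) = γ z := by intro μ z; simp [G]
  have hGl : ∀ μ z, G μ (z ⊗ₜ 1) = shift μ (γ z) := by intro μ z; simp [G]
  have hir : ∀ μ, ((G μ : Z ⊗[k] Z →+* MvPolynomial σ k).comp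
      (Algebra.TensorProduct.includeRight : Z →ₐ[k] Z ⊗[k] Z).toRingHom).IsIntegral := by
    intro μ
    have : (G μ : Z ⊗[k] Z →+* MvPolynomial σ k).comp
      (Algebra.TensorProduct.includeRight : Z →ₐ[k] Z ⊗[k] Z).toRingHom = γ := by
      ext z : 1; exact hGr μ z
    rw [this]; exact hintγ
  have hil : ∀ μ, ((G μ : Z ⊗[k] Z →+* MvPolynomial σ k).comp
      (Algebra.TensorProduct.includeLeft : Z →ₐ[k] Z ⊗[k] Z).toRingHom).IsIntegral := by
    intro μ
    have : (G μ : Z ⊗[k] Z →+* MvPolynomial σ k).comp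
      (Algebra.TensorProduct.includeLeft : Z →ₐ[k] Z ⊗[k] Z).toRingHom =
        (shift μ : MvPolynomial σ k →+* MvPolynomial σ k).comp γ := by
      ext z : 1; exact hGl μ z
    rw [this]
    exact hintγ.trans _ _ (RingHom.isIntegral_of_surjective _ (shift_surjective μ))
  let : Algebra Z (MvPolynomial σ k) := (γ : Z →+* MvPolynomial σ k).toAlgebra
  have hfin : Module.Finite Z (MvPolynomial σ k) := hγf
  refine ⟨(⊤ : Submodule Z (MvPolynomial σ k)).spanFinrank, b * b, ⟨?_, ?_, ?_, ?_, ?_⟩⟩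
  · intro J J' hJ hJ' hle
    exact trdeg_le_of_surjective (Ideal.Quotient.factorₐ k hle) (Ideal.Quotient.factor_surjective hle)
  · intro J J' hJ hJ' hle hd
    exact eq_of_le_of_trdeg_eq hle hd
  · intro μ Q hQ hle
    have h1 := trdeg_quotient_comap_of_isIntegral
      (Algebra.TensorProduct.includeLeft : Z →ₐ[k] Z ⊗[k] Z) Q
      (isIntegral_mk_comp_of_ker_le _ (G μ : Z ⊗[k] Z →+* MvPolynomial σ k) (hil μ) Q hle)
    have h2 := trdeg_quotient_comap_of_isIntegral
      (Algebra.TensorProduct.includeRight : Z →ₐ[k] Z ⊗[k] Z) Q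
      (isIntegral_mk_comp_of_ker_le _ (G μ : Z ⊗[k] Z →+* MvPolynomial σ k) (hir μ) Q hle)
    exact h1.trans h2.symm
  · intro Q hQ S hS
    let F := AlgebraicClosure (FractionRing ((Z ⊗[k] Z) ⧸ Q))
    have hfaith : FaithfulSMul ((Z ⊗[k] Z) ⧸ Q) F := by
      rw [faithfulSMul_iff_algebraMap_injective, IsScalarTower.algebraMap_eq _
        (FractionRing ((Z ⊗[k] Z) ⧸ Q)) F]
      exact (algebraMap (FractionRing ((Z ⊗[k] Z) ⧸ Q)) F).injective.comp
        (IsFractionRing.injective ((Z ⊗[k] Z) ⧸ Q) (FractionRing ((Z ⊗[k] Z) ⧸ Q)))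
    let π : Z ⊗[k] Z →+* F := (algebraMap ((Z ⊗[k] Z) ⧸ Q) F).comp (Ideal.Quotient.mk Q)
    have hφ : ∀ μ ∈ S, ∃ φ : MvPolynomial σ k →+* F, ∀ w, φ (G μ w) = π w := by
      intro μ hμ
      exact exists_ringHom_extension (G μ : Z ⊗[k] Z →+* MvPolynomial σ k)
        (RingHom.IsIntegral.tower_top _ _ (hir μ)) Q (hS μ hμ)
    rcases S.eq_empty_or_nonempty with rfl | ⟨μ₀, hμ₀⟩
    · exact Nat.zero_le _
    have : Nonempty (MvPolynomial σ k →+* F) := ⟨(hφ μ₀ hμ₀).choose⟩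
    choose! φ hφ using hφ
    obtain ⟨R₁, hR₁c, hR₁⟩ := hb F (π.comp
      (Algebra.TensorProduct.includeRight : Z →ₐ[k] Z ⊗[k] Z).toRingHom)
    obtain ⟨R₂, hR₂c, hR₂⟩ := hb F (π.comp
      (Algebra.TensorProduct.includeLeft : Z →ₐ[k] Z ⊗[k] Z).toRingHom)
    have hC : ∀ μ ∈ S, ∀ c : k, φ μ (MvPolynomial.C c) = π (algebraMap k _ c) := by
      intro μ hμ c
      rw [← hφ μ hμ, AlgHom.commutes]; rfl
    have hcard : S.card ≤ (R₁ ×ˢ R₂).card := by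
      refine Finset.card_le_card_of_injOn (fun μ => (fun i => φ μ (MvPolynomial.X i),
        fun i => φ μ (shift μ (MvPolynomial.X i)))) ?_ ?_
      · intro μ hμ
        rw [Finset.mem_coe, Finset.mem_product]
        constructor
        · exact hR₁ (φ μ) (fun z => by rw [← hGr μ, hφ μ hμ]; rfl)
        · exact hR₂ ((φ μ).comp (shift μ : MvPolynomial σ k →+* MvPolynomial σ k)) (fun z => by
            change φ μ (shift μ (γ z)) = _
            rw [← hGl μ, hφ μ hμ]; rfl)
      · intro μ hμ ν hν h
        obtain ⟨h1, h2⟩ := Prod.ext_iff.mp h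
        funext i
        have e1 := congrFun h1 i
        have e2 := congrFun h2 i
        simp only [shift, MvPolynomial.aeval_X, map_add, hC μ hμ, hC ν hν] at e1 e2
        rw [e1] at e2
        exact (π.comp (algebraMap k _)).injective (add_left_cancel e2)
    rw [Finset.card_product] at hcard
    exact hcard.trans (Nat.mul_le_mul hR₁c hR₂c)
  · intro μ z
    obtain ⟨f, hf, hfd, hf0⟩ := LinearMap.exists_monic_and_natDegree_eq_and_aeval_eq_zero Z
      (LinearMap.mulRight Z (shift μ (γ z)) : Module.End Z (MvPolynomial σ k))
    refine ⟨f, hf, hfd, ?_⟩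
    change G μ _ = 0
    have h1 := congrArg (fun e : Module.End Z (MvPolynomial σ k) => e 1) hf0
    have h2 : ∀ f : Polynomial Z, (Polynomial.aeval (LinearMap.mulRight Z (shift μ (γ z)) :
        Module.End Z (MvPolynomial σ k)) f) 1 = f.eval₂ (γ : Z →+* MvPolynomial σ k) (shift μ (γ z)) := by
      intro f
      have h3 : ∀ n : ℕ, ((LinearMap.mulRight Z (shift μ (γ z)) :
        Module.End Z (MvPolynomial σ k)) ^ n) 1 = shift μ (γ z) ^ n := by
        intro n
        induction n with
        | zero => simp
        | succ n ih => rw [pow_succ', Module.End.mul_apply, ih]; simp [pow_succ]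
      induction f using Polynomial.induction_on' with
      | add p q hp hq => rw [map_add, LinearMap.add_apply, hp, hq, Polynomial.eval₂_add]
      | monomial n a =>
        rw [Polynomial.aeval_monomial, Polynomial.eval₂_monomial, Module.End.mul_apply, h3]
        rfl
    rw [h2] at h1
    have h4 := Polynomial.hom_eval₂ f (Algebra.TensorProduct.includeRight : Z →ₐ[k] Z ⊗[k] Z).toRingHom
      (G μ : Z ⊗[k] Z →+* MvPolynomial σ k) ((Algebra.TensorProduct.includeLeft : Z →ₐ[k] Z ⊗[k] Z).toRingHom z)
    refine h4.trans ?_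
    have h5 : (G μ : Z ⊗[k] Z →+* MvPolynomial σ k).comp
      (Algebra.TensorProduct.includeRight : Z →ₐ[k] Z ⊗[k] Z).toRingHom = γ := by
      ext z : 1; exact hGr μ z
    have h6 : (G μ : Z ⊗[k] Z →+* MvPolynomial σ k)
      ((Algebra.TensorProduct.includeLeft : Z →ₐ[k] Z ⊗[k] Z).toRingHom z) = shift μ (γ z) := hGl μ z
    rw [h5, h6]
    exact h1

theorem isNoetherianRing_tensor (γ : Z →ₐ[k] MvPolynomial σ k)
    (hγ : Function.Injective γ) (hγf : (γ : Z →+* MvPolynomial σ k).Finite) :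
    IsNoetherianRing Z ∧ IsNoetherianRing (Z ⊗[k] Z) := by
  have hft := finiteType_of_finite_of_injective γ hγ hγf
  have h1 : IsNoetherianRing Z := Algebra.FiniteType.isNoetherianRing k Z
  have h2 : Algebra.FiniteType Z (Z ⊗[k] Z) := Algebra.FiniteType.baseChange Z
  exact ⟨h1, Algebra.FiniteType.isNoetherianRing Z _⟩

end ShiftedGraphs

section Symbols

attribute [local instance] LieRing.ofAssociativeRing

variable {g : Type*} [LieRing g] [LieAlgebra ℂ g] {I : Type*} (b : Module.Basis I ℂ g)

/-- The image in the enveloping algebra of a word in the Lie algebra. -/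
noncomputable def word (l : List g) : UniversalEnvelopingAlgebra ℂ g :=
  (l.map (UniversalEnvelopingAlgebra.ι ℂ)).prod

theorem word_cons (x : g) (l : List g) :
    word (x :: l) = UniversalEnvelopingAlgebra.ι ℂ x * word l := by
  simp [word]

theorem word_append (l l' : List g) : word (l ++ l') = word l * word l' := by
  simp [word]

theorem span_range_word : Submodule.span ℂ (Set.range (word (g := g))) = ⊤ := by
  rw [eq_top_iff]
  let S : Subalgebra ℂ (UniversalEnvelopingAlgebra ℂ g) :=
    (Submodule.span ℂ (Set.range (word (g := g)))).toSubalgebra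
      (Submodule.subset_span ⟨[], rfl⟩) (by
        intro x y hx hy
        have := Submodule.mul_mem_mul hx hy
        rw [Submodule.span_mul_span] at this
        refine Submodule.span_mono ?_ this
        rintro _ ⟨_, ⟨l, rfl⟩, _, ⟨l', rfl⟩, rfl⟩
        exact ⟨l ++ l', word_append l l'⟩)
  let f : g →ₗ⁅ℂ⁆ S :=
    { toFun := fun x => ⟨UniversalEnvelopingAlgebra.ι ℂ x, Submodule.subset_span ⟨[x], by simp [word]⟩⟩
      map_add' := fun x y => Subtype.ext (map_add _ x y)
      map_smul' := fun c x => Subtype.ext (map_smul _ c x)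
      map_lie' := fun {x y} => Subtype.ext (LieHom.map_lie _ x y) }
  have h : S.val.comp (UniversalEnvelopingAlgebra.lift ℂ f) = AlgHom.id ℂ _ := by
    apply UniversalEnvelopingAlgebra.hom_ext
    ext x
    simp [f]
  intro u _
  have h2 := DFunLike.congr_fun h u
  have h3 : u = ((UniversalEnvelopingAlgebra.lift ℂ f u : S) : UniversalEnvelopingAlgebra ℂ g) := h2.symm
  rw [h3]
  exact (UniversalEnvelopingAlgebra.lift ℂ f u : S).2

/-- The linear polynomial attached to an element of the Lie algebra. -/
noncomputable def linPoly : g →ₗ[ℂ] MvPolynomial I ℂ := b.constr ℂ MvPolynomial.X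

@[simp] theorem linPoly_basis (i : I) : linPoly b (b i) = MvPolynomial.X i := by
  simp [linPoly]

/-- Pairs formed by an element of the enveloping algebra of filtration degree at most `n` and its
symbol of degree `n`. -/
noncomputable def symRel (n : ℕ) : Submodule ℂ (UniversalEnvelopingAlgebra ℂ g × MvPolynomial I ℂ) :=
  Submodule.span ℂ ({p | ∃ l : List I, l.length < n ∧ p = (word (l.map b), 0)} ∪
    {p | ∃ l : List I, l.length = n ∧ p = (word (l.map b), (l.map MvPolynomial.X).prod)})

theorem basis_word_mem_symRel (l : List I) :
    (word (l.map b), (l.map MvPolynomial.X).prod) ∈ symRel b l.length :=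
  Submodule.subset_span (Or.inr ⟨l, rfl, rfl⟩)

theorem basis_word_mem_symRel_of_lt {l : List I} {n : ℕ} (h : l.length < n) :
    (word (l.map b), 0) ∈ symRel b n :=
  Submodule.subset_span (Or.inl ⟨l, h, rfl⟩)

theorem symRel_mul {n m : ℕ} {p q : UniversalEnvelopingAlgebra ℂ g × MvPolynomial I ℂ}
    (hp : p ∈ symRel b n) (hq : q ∈ symRel b m) : p * q ∈ symRel b (n + m) := by
  have := Submodule.mul_mem_mul hp hq
  rw [symRel, symRel, Submodule.span_mul_span] at this
  refine Submodule.span_le.mpr ?_ this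
  rintro _ ⟨_, (⟨l, hl, rfl⟩ | ⟨l, hl, rfl⟩), _, (⟨l', hl', rfl⟩ | ⟨l', hl', rfl⟩), rfl⟩
  all_goals simp only [Prod.mk_mul_mk, ← word_append, ← List.map_append, zero_mul, mul_zero]
  any_goals exact basis_word_mem_symRel_of_lt b (by simp; omega)
  have := basis_word_mem_symRel b (l ++ l')
  rwa [List.map_append (f := MvPolynomial.X), List.prod_append, List.length_append, hl, hl'] at this

theorem one_mem_symRel : (1 : UniversalEnvelopingAlgebra ℂ g × MvPolynomial I ℂ) ∈ symRel b 0 :=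
  basis_word_mem_symRel b []

theorem symRel_of_lt {n m : ℕ} (h : n < m) {u : UniversalEnvelopingAlgebra ℂ g}
    {q : MvPolynomial I ℂ} (hp : (u, q) ∈ symRel b n) : (u, 0) ∈ symRel b m := by
  suffices H : symRel b n ≤ (symRel b m).comap
      (LinearMap.inl ℂ _ _ ∘ₗ LinearMap.fst ℂ _ _) from H hp
  refine Submodule.span_le.mpr ?_
  rintro _ (⟨l, hl, rfl⟩ | ⟨l, hl, rfl⟩)
  all_goals exact basis_word_mem_symRel_of_lt b (by omega)

theorem ι_mem_symRel (x : g) : (UniversalEnvelopingAlgebra.ι ℂ x, linPoly b x) ∈ symRel b 1 := by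
  suffices H : (⊤ : Submodule ℂ g) ≤ (symRel b 1).comap (LinearMap.prod
      ((UniversalEnvelopingAlgebra.ι ℂ : g →ₗ⁅ℂ⁆ UniversalEnvelopingAlgebra ℂ g) :
        g →ₗ[ℂ] UniversalEnvelopingAlgebra ℂ g) (linPoly b)) from
    H (Submodule.mem_top (x := x))
  rw [← b.span_eq, Submodule.span_le]
  rintro _ ⟨i, rfl⟩
  have := basis_word_mem_symRel b [i]
  simpa [word] using this

theorem word_mem_symRel (l : List g) : (word l, (l.map (linPoly b)).prod) ∈ symRel b l.length := by
  induction l with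
  | nil => exact one_mem_symRel b
  | cons x l ih =>
    have := symRel_mul b (ι_mem_symRel b x) ih
    rw [List.length_cons, add_comm, word_cons, List.map_cons, List.prod_cons]
    exact this

theorem word_mem_symRel_of_lt {l : List g} {n : ℕ} (h : l.length < n) : (word l, 0) ∈ symRel b n :=
  symRel_of_lt b h (word_mem_symRel b l)

theorem exists_mem_symRel (u : UniversalEnvelopingAlgebra ℂ g) : ∃ n, (u, 0) ∈ symRel b n := by
  have hu : u ∈ Submodule.span ℂ (Set.range (word (g := g))) := by rw [span_range_word]; trivial
  induction hu using Submodule.span_induction with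
  | mem x hx =>
    obtain ⟨l, rfl⟩ := hx
    exact ⟨_, word_mem_symRel_of_lt b (Nat.lt_succ_self _)⟩
  | zero => exact ⟨0, Submodule.zero_mem _⟩
  | add x y _ _ hx hy =>
    obtain ⟨n, hn⟩ := hx
    obtain ⟨m, hm⟩ := hy
    refine ⟨n + m + 1, ?_⟩
    have := Submodule.add_mem _ (symRel_of_lt b (show n < n + m + 1 by omega) hn)
      (symRel_of_lt b (show m < n + m + 1 by omega) hm)
    simpa [Function.comp_def] using this
  | smul c x _ hx =>
    obtain ⟨n, hn⟩ := hx
    refine ⟨n, ?_⟩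
    simpa using Submodule.smul_mem _ c hn

/-- The derivation of the symmetric algebra induced by `ad y`. -/
noncomputable def adDer (y : g) : Derivation ℂ (MvPolynomial I ℂ) (MvPolynomial I ℂ) :=
  MvPolynomial.mkDerivation ℂ fun i => linPoly b ⁅y, b i⁆

theorem adDer_linPoly (y x : g) : adDer b y (linPoly b x) = linPoly b ⁅y, x⁆ := by
  have : (adDer b y : MvPolynomial I ℂ →ₗ[ℂ] MvPolynomial I ℂ) ∘ₗ linPoly b =
      linPoly b ∘ₗ (LieAlgebra.ad ℂ g y : g →ₗ[ℂ] g) := by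
    apply b.ext
    intro i
    simp [adDer]
  exact DFunLike.congr_fun this x

/-- The inner derivation of the enveloping algebra given by `y`. -/
noncomputable def adU (y : g) : UniversalEnvelopingAlgebra ℂ g →ₗ[ℂ] UniversalEnvelopingAlgebra ℂ g :=
  LinearMap.mulLeft ℂ (UniversalEnvelopingAlgebra.ι ℂ y) -
    LinearMap.mulRight ℂ (UniversalEnvelopingAlgebra.ι ℂ y)

theorem adU_apply (y : g) (u : UniversalEnvelopingAlgebra ℂ g) :
    adU y u = UniversalEnvelopingAlgebra.ι ℂ y * u - u * UniversalEnvelopingAlgebra.ι ℂ y := rfl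

theorem adU_mul (y : g) (u v : UniversalEnvelopingAlgebra ℂ g) :
    adU y (u * v) = adU y u * v + u * adU y v := by
  simp only [adU_apply]; noncomm_ring

theorem adU_ι (y x : g) : adU y (UniversalEnvelopingAlgebra.ι ℂ x) =
    UniversalEnvelopingAlgebra.ι ℂ ⁅y, x⁆ := by
  rw [adU_apply, LieHom.map_lie, LieRing.of_associative_ring_bracket]

theorem ad_word_mem_symRel (y : g) (l : List g) :
    (adU y (word l), adDer b y (l.map (linPoly b)).prod) ∈ symRel b l.length := by
  induction l with
  | nil =>
    have h := Submodule.zero_mem (symRel b 0)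
    simp only [word, adU_apply, List.map_nil, List.prod_nil, mul_one, one_mul, sub_self,
      Derivation.map_one_eq_zero, List.length_nil]
    exact h
  | cons x l ih =>
    have h1 := symRel_mul b (ι_mem_symRel b ⁅y, x⁆) (word_mem_symRel b l)
    have h2 := symRel_mul b (ι_mem_symRel b x) ih
    have h3 := Submodule.add_mem _ h1 h2
    rw [word_cons, adU_mul, adU_ι, List.map_cons, List.prod_cons, Derivation.leibniz, adDer_linPoly,
      List.length_cons, add_comm l.length, add_comm (_ • _)]
    simpa [mul_comm] using h3

theorem ad_mem_symRel (y : g) {n : ℕ} {u : UniversalEnvelopingAlgebra ℂ g}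
    {q : MvPolynomial I ℂ} (h : (u, q) ∈ symRel b n) : (adU y u, adDer b y q) ∈ symRel b n := by
  suffices H : symRel b n ≤ (symRel b n).comap
      (LinearMap.prodMap (adU y) (adDer b y : MvPolynomial I ℂ →ₗ[ℂ] MvPolynomial I ℂ)) from H h
  refine Submodule.span_le.mpr ?_
  rintro _ (⟨l, hl, rfl⟩ | ⟨l, rfl, rfl⟩)
  · rw [← List.length_map (as := l) (f := b)] at hl
    have := symRel_of_lt b hl (ad_word_mem_symRel b y (l.map b))
    simpa [Function.comp_def] using this
  · have := ad_word_mem_symRel b y (l.map b)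
    simpa [Function.comp_def] using this

end Symbols

section Symbols

attribute [local instance] LieRing.ofAssociativeRing

theorem Derivation.mem_pow_of_mem_pow_succ {R A : Type*} [CommRing R] [CommRing A] [Algebra R A]
    (D : Derivation R A A) (J : Ideal A) (n : ℕ) {a : A} (ha : a ∈ J ^ (n + 1)) : D a ∈ J ^ n := by
  induction n generalizing a with
  | zero => simp
  | succ n ih =>
    rw [pow_succ] at ha
    induction ha using Submodule.mul_induction_on' with
    | mem_mul_mem x hx y hy =>
      rw [D.leibniz, smul_eq_mul, smul_eq_mul]
      refine Ideal.add_mem _ (Ideal.mul_mem_right _ _ hx) ?_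
      rw [mul_comm, pow_succ]
      exact Ideal.mul_mem_mul (ih hx) hy
    | add x _ y _ hx hy => rw [map_add]; exact Ideal.add_mem _ hx hy

variable {g : Type*} [LieRing g] [LieAlgebra ℂ g] {N : Type*} [Fintype N]

/-- The derivations of the coordinate ring of matrices given by right translation. -/
noncomputable def matDer (m : Matrix N N ℂ) :
    Derivation ℂ (MvPolynomial (N × N) ℂ) (MvPolynomial (N × N) ℂ) :=
  MvPolynomial.mkDerivation ℂ fun a => ∑ k, m k a.2 • MvPolynomial.X (a.1, k)

theorem matDer_X (m : Matrix N N ℂ) (a : N × N) :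
    matDer m (MvPolynomial.X a) = ∑ k, m k a.2 • MvPolynomial.X (a.1, k) := by
  simp [matDer]

theorem matDer_add (m m' : Matrix N N ℂ) : matDer (m + m') = matDer m + matDer m' := by
  apply MvPolynomial.derivation_ext
  intro a
  simp [matDer_X, add_smul, Finset.sum_add_distrib]

theorem matDer_smul (c : ℂ) (m : Matrix N N ℂ) : matDer (c • m) = c • matDer m := by
  apply MvPolynomial.derivation_ext
  intro a
  simp [matDer_X, Finset.smul_sum, smul_smul]

theorem matDer_commutator (m m' : Matrix N N ℂ) :
    matDer (m * m' - m' * m) = ⁅matDer m, matDer m'⁆ := by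
  apply MvPolynomial.derivation_ext
  intro a
  have h : ∀ m m' : Matrix N N ℂ, matDer m (matDer m' (MvPolynomial.X a)) =
      ∑ k, (m * m') k a.2 • MvPolynomial.X (a.1, k) := by
    intro m m'
    rw [matDer_X, map_sum]
    simp_rw [Derivation.map_smul, matDer_X, Finset.smul_sum, smul_smul, Matrix.mul_apply,
      Finset.sum_smul]
    rw [Finset.sum_comm]
    simp_rw [mul_comm]
  rw [Derivation.commutator_apply, h, h, matDer_X]
  simp [sub_smul]

/-- The action of the enveloping algebra on functions on matrices. -/
noncomputable def matAct (ρ : g →ₗ[ℂ] Matrix N N ℂ)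
    (hρ : ∀ x y, ρ ⁅x, y⁆ = ρ x * ρ y - ρ y * ρ x) :
    UniversalEnvelopingAlgebra ℂ g →ₐ[ℂ] Module.End ℂ (MvPolynomial (N × N) ℂ) :=
  UniversalEnvelopingAlgebra.lift ℂ
    { toFun := fun x => (matDer (ρ x) : MvPolynomial (N × N) ℂ →ₗ[ℂ] MvPolynomial (N × N) ℂ)
      map_add' := fun x y => by rw [map_add, matDer_add]; rfl
      map_smul' := fun c x => by rw [map_smul, matDer_smul]; rfl
      map_lie' := fun {x y} => by
        rw [hρ, matDer_commutator]
        rfl }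

theorem matAct_ι (ρ : g →ₗ[ℂ] Matrix N N ℂ) (hρ : ∀ x y, ρ ⁅x, y⁆ = ρ x * ρ y - ρ y * ρ x) (x : g)
    (q : MvPolynomial (N × N) ℂ) :
    matAct ρ hρ (UniversalEnvelopingAlgebra.ι ℂ x) q = matDer (ρ x) q := by
  rw [matAct, UniversalEnvelopingAlgebra.lift_ι_apply]
  rfl

theorem exists_matAct_word (ρ : g →ₗ[ℂ] Matrix N N ℂ)
    (hρ : ∀ x y, ρ ⁅x, y⁆ = ρ x * ρ y - ρ y * ρ x) {B : Type*} [CommRing B]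
    (e : MvPolynomial (N × N) ℂ →+* B)
    (f : MvPolynomial (N × N) ℂ) (hf : e f = 0) (n : ℕ) (l : List g) (hl : l.length ≤ n) :
    ∃ c r, r ∈ RingHom.ker e ^ (n - l.length + 1) ∧
      matAct ρ hρ (word l) (f ^ n) = c * f ^ (n - l.length) + r ∧
      e c = n.descFactorial l.length * (l.map fun x => e (matDer (ρ x) f)).prod := by
  induction l with
  | nil => exact ⟨1, 0, Submodule.zero_mem _, by simp [word], by simp⟩
  | cons x l ih =>
    rw [List.length_cons] at hl
    obtain ⟨c, r, hr, h1, h2⟩ := ih (by omega)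
    obtain ⟨j, hj⟩ : ∃ j, n - l.length = j + 1 := ⟨n - l.length - 1, by omega⟩
    have hj' : n - (x :: l).length = j := by rw [List.length_cons]; omega
    rw [hj] at hr h1
    rw [hj']
    refine ⟨c * (j + 1) * matDer (ρ x) f, matDer (ρ x) c * f ^ (j + 1) + matDer (ρ x) r, ?_, ?_, ?_⟩
    · refine Ideal.add_mem _ (Ideal.mul_mem_left _ _ (Ideal.pow_mem_pow hf _)) ?_
      exact Derivation.mem_pow_of_mem_pow_succ _ _ _ hr
    · rw [word_cons, map_mul, Module.End.mul_apply, h1, matAct_ι, map_add, Derivation.leibniz,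
        Derivation.leibniz_pow]
      simp only [smul_eq_mul, nsmul_eq_mul, Nat.add_sub_cancel]
      push_cast
      ring
    · rw [map_mul, map_mul, h2, List.length_cons, Nat.descFactorial_succ, hj, List.map_cons,
        List.prod_cons]
      push_cast
      simp only [map_add, map_one, map_natCast]
      ring

theorem symRel_zero_left {I : Type*} [Finite I] (b : Module.Basis I ℂ g)
    (ρ : g →ₗ[ℂ] Matrix N N ℂ) (hρ : ∀ x y, ρ ⁅x, y⁆ = ρ x * ρ y - ρ y * ρ x)
    (hinj : Function.Injective ρ) {n : ℕ} {q : MvPolynomial I ℂ} (h : (0, q) ∈ symRel b n) :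
    q = 0 := by
  classical
  have := Fintype.ofFinite I
  apply MvPolynomial.funext
  intro ξ
  rw [map_zero]
  obtain ⟨θ, hθ⟩ := LinearMap.exists_leftInverse_of_injective ρ (LinearMap.ker_eq_bot.mpr hinj)
  let m : N → N → ℂ := fun a c => (b.constr ℂ ξ : g →ₗ[ℂ] ℂ) (θ (Matrix.single a c 1))
  let e : MvPolynomial (N × N) ℂ →ₐ[ℂ] ℂ := MvPolynomial.aeval fun a => (1 : Matrix N N ℂ) a.1 a.2
  let f : MvPolynomial (N × N) ℂ := ∑ a, ∑ c, m a c • (MvPolynomial.X (a, c) -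
    MvPolynomial.C ((1 : Matrix N N ℂ) a c))
  have hf : e f = 0 := by simp [e, f]
  have hd : ∀ x, e (matDer (ρ x) f) = b.constr ℂ ξ x := by
    intro x
    have h1 : e (matDer (ρ x) f) = ∑ a, ∑ c, m a c * ρ x a c := by
      have hC : ∀ z, matDer (ρ x) (MvPolynomial.C z) = 0 := fun z => Derivation.map_algebraMap _ z
      simp only [f, map_sum, Derivation.map_smul, map_sub, matDer_X, hC, sub_zero]
      simp [e, Matrix.one_apply]
    rw [h1]
    have h2 : x = θ (ρ x) := (DFunLike.congr_fun hθ x).symm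
    conv_rhs => rw [h2, Matrix.matrix_eq_sum_single (ρ x)]
    simp only [map_sum, m]
    refine Finset.sum_congr rfl fun a _ => Finset.sum_congr rfl fun c _ => ?_
    have h3 : Matrix.single a c (ρ x a c) = ρ x a c • Matrix.single a c (1 : ℂ) := by
      simp [Matrix.smul_single]
    rw [h3, map_smul, map_smul, smul_eq_mul, mul_comm]
  have key : symRel b n ≤ LinearMap.ker
      (((e : MvPolynomial (N × N) ℂ →ₗ[ℂ] ℂ) ∘ₗ LinearMap.applyₗ (f ^ n) ∘ₗ
        (matAct ρ hρ : _ →ₗ[ℂ] _)) ∘ₗ LinearMap.fst ℂ _ _ -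
      ((n.factorial : ℂ) • (MvPolynomial.aeval ξ : MvPolynomial I ℂ →ₐ[ℂ] ℂ) :
        MvPolynomial I ℂ →ₗ[ℂ] ℂ) ∘ₗ LinearMap.snd ℂ _ _) := by
    refine Submodule.span_le.mpr ?_
    rintro _ (⟨l, hl, rfl⟩ | ⟨l, rfl, rfl⟩)
    · rw [← List.length_map (as := l) (f := b)] at hl
      generalize l.map b = l' at hl ⊢
      obtain ⟨c, r, hr, h1, h2⟩ := exists_matAct_word ρ hρ (e : _ →+* ℂ) f hf n l' hl.le
      have hr' : e r = 0 := (Ideal.pow_le_self (Nat.succ_ne_zero _) hr : r ∈ RingHom.ker (e : _ →+* ℂ))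
      simp [LinearMap.mem_ker, h1, hr', hf, Nat.sub_ne_zero_of_lt hl]
    · have hX : l.map MvPolynomial.X = (l.map b).map (linPoly b) := by simp
      rw [hX, ← List.length_map (as := l) (f := b)]
      generalize l.map b = l'
      obtain ⟨c, r, hr, h1, h2⟩ := exists_matAct_word ρ hρ (e : _ →+* ℂ) f hf l'.length l' le_rfl
      have hr' : e r = 0 := (Ideal.pow_le_self (Nat.succ_ne_zero _) hr : r ∈ RingHom.ker (e : _ →+* ℂ))
      have h2' : e c = (l'.length.factorial : ℂ) * (l'.map fun x => b.constr ℂ ξ x).prod := by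
        have : e c = _ := h2
        rw [this, Nat.descFactorial_self]
        simp only [RingHom.coe_coe, hd]
      have h3 : ∀ x, MvPolynomial.aeval ξ (linPoly b x) = b.constr ℂ ξ x := by
        intro x
        have : (MvPolynomial.aeval ξ : MvPolynomial I ℂ →ₐ[ℂ] ℂ).toLinearMap ∘ₗ linPoly b =
            b.constr ℂ ξ := by
          apply b.ext; intro i; simp
        exact DFunLike.congr_fun this x
      have h4 : MvPolynomial.aeval ξ (l'.map (linPoly b)).prod =
          (l'.map fun x => b.constr ℂ ξ x).prod := by
        rw [map_list_prod, List.map_map]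
        simp only [Function.comp_def, h3]
      have h5 : e (matAct ρ hρ (word l') (f ^ l'.length)) =
          (l'.length.factorial : ℂ) * (l'.map fun x => b.constr ℂ ξ x).prod := by
        rw [h1, map_add, hr', Nat.sub_self, pow_zero, mul_one, h2', add_zero]
      exact sub_eq_zero.mpr (h5.trans (congrArg _ h4.symm))
  have h1 := key h
  rw [LinearMap.mem_ker] at h1
  have h2 : (n.factorial : ℂ) ≠ 0 := by exact_mod_cast n.factorial_ne_zero
  simp only [LinearMap.sub_apply, LinearMap.comp_apply, LinearMap.fst_apply, LinearMap.snd_apply,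
    map_zero, zero_sub, neg_eq_zero, LinearMap.smul_apply, smul_eq_mul, mul_eq_zero, h2,
    false_or] at h1
  simpa [MvPolynomial.aeval_eq_eval] using h1

end Symbols

section Ordered

attribute [local instance] LieRing.ofAssociativeRing

variable {g : Type*} [LieRing g] [LieAlgebra ℂ g] {I : Type*} (b : Module.Basis I ℂ g)

/-- The span of the nonempty words of length less than `n` in basis elements with index in `S`. -/
noncomputable def wordSpan (S : Set I) (n : ℕ) : Submodule ℂ (UniversalEnvelopingAlgebra ℂ g) :=
  Submodule.span ℂ {u | ∃ l : List I, (∀ i ∈ l, i ∈ S) ∧ l ≠ [] ∧ l.length < n ∧ u = word (l.map b)}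

theorem wordSpan_mono (S : Set I) {n m : ℕ} (h : n ≤ m) : wordSpan b S n ≤ wordSpan b S m :=
  Submodule.span_mono fun _ ⟨l, h1, h2, h3, h4⟩ => ⟨l, h1, h2, h3.trans_le h, h4⟩

theorem ι_mul_mem_wordSpan {S : Set I} {n : ℕ} {i : I} (hi : i ∈ S)
    {u : UniversalEnvelopingAlgebra ℂ g} (hu : u ∈ wordSpan b S n) :
    UniversalEnvelopingAlgebra.ι ℂ (b i) * u ∈ wordSpan b S (n + 1) := by
  suffices H : wordSpan b S n ≤ (wordSpan b S (n + 1)).comap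
    (LinearMap.mulLeft ℂ (UniversalEnvelopingAlgebra.ι ℂ (b i))) from H hu
  refine Submodule.span_le.mpr ?_
  rintro _ ⟨l, h1, h2, h3, rfl⟩
  refine Submodule.subset_span ⟨i :: l, ?_, by simp, by simpa using h3, ?_⟩
  · simpa [hi] using h1
  · simp [word_cons]

theorem word_sub_word_mem {S : Set I}
    (hS : ∀ i ∈ S, ∀ j ∈ S, ⁅b i, b j⁆ ∈ Submodule.span ℂ (b '' S)) {l l' : List I}
    (h : l.Perm l') (hl : ∀ i ∈ l, i ∈ S) :
    word (l.map b) - word (l'.map b) ∈ wordSpan b S l.length := by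
  induction h with
  | nil => simp
  | cons x h ih =>
    rw [List.map_cons, List.map_cons, word_cons, word_cons, ← mul_sub]
    exact ι_mul_mem_wordSpan b (hl x (by simp)) (ih fun i hi => hl i (by simp [hi]))
  | swap x y l =>
    have h1 : word (List.map b (y :: x :: l)) - word (List.map b (x :: y :: l)) =
        UniversalEnvelopingAlgebra.ι ℂ ⁅b y, b x⁆ * word (l.map b) := by
      simp only [List.map_cons, word_cons, LieHom.map_lie, LieRing.of_associative_ring_bracket]
      noncomm_ring
    rw [h1]
    have h2 : Submodule.span ℂ (b '' S) ≤ (wordSpan b S (l.length + 2)).comap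
        (LinearMap.mulRight ℂ (word (l.map b)) ∘ₗ
          ((UniversalEnvelopingAlgebra.ι ℂ : g →ₗ⁅ℂ⁆ UniversalEnvelopingAlgebra ℂ g) :
            g →ₗ[ℂ] UniversalEnvelopingAlgebra ℂ g)) := by
      refine Submodule.span_le.mpr ?_
      rintro _ ⟨i, hi, rfl⟩
      refine Submodule.subset_span ⟨i :: l, ?_, by simp, by simp, ?_⟩
      · intro j hj
        rcases List.mem_cons.mp hj with rfl | hj
        · exact hi
        · exact hl j (by simp [hj])
      · simp [word_cons]
    exact h2 (hS y (hl y (by simp)) x (hl x (by simp)))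
  | trans h1 h2 ih1 ih2 =>
    have := Submodule.add_mem _ (ih1 hl) (h1.length_eq ▸ ih2 fun i hi => hl i (h1.mem_iff.mpr hi))
    simpa using this

variable [LinearOrder I]

/-- The ordered monomial with the given exponents. -/
noncomputable def ordMon (s : I →₀ ℕ) : UniversalEnvelopingAlgebra ℂ g :=
  word ((Finsupp.toMultiset s).sort.map b)

/-- The span of the nonconstant ordered monomials of degree less than `n` in basis elements with
index in `S`. -/
noncomputable def ordSpan (S : Set I) (n : ℕ) : Submodule ℂ (UniversalEnvelopingAlgebra ℂ g) :=
  Submodule.span ℂ {u | ∃ s : I →₀ ℕ, (∀ i ∈ s.support, i ∈ S) ∧ s ≠ 0 ∧ s.degree < n ∧ u = ordMon b s}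

theorem ordSpan_mono (S : Set I) {n m : ℕ} (h : n ≤ m) : ordSpan b S n ≤ ordSpan b S m :=
  Submodule.span_mono fun _ ⟨l, h1, h2, h3, h4⟩ => ⟨l, h1, h2, h3.trans_le h, h4⟩

/-- The exponents of a word. -/
noncomputable def exponents (l : List I) : I →₀ ℕ := Multiset.toFinsupp (l : Multiset I)

theorem degree_exponents (l : List I) : (exponents l).degree = l.length := by
  have := Finsupp.card_toMultiset (exponents l)
  rw [exponents, Multiset.toFinsupp_toMultiset, Multiset.coe_card] at this
  rw [this]; rfl

theorem mem_support_exponents (l : List I) (i : I) : i ∈ (exponents l).support ↔ i ∈ l := by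
  simp [exponents, Multiset.toFinsupp_support]

theorem exponents_perm (l : List I) : l.Perm (Finsupp.toMultiset (exponents l)).sort := by
  rw [← Multiset.coe_eq_coe, Multiset.sort_eq, exponents, Multiset.toFinsupp_toMultiset]

theorem exponents_ne_zero {l : List I} (hl : l ≠ []) : exponents l ≠ 0 := by
  intro h
  have := degree_exponents l
  rw [h, map_zero] at this
  exact hl (List.length_eq_zero_iff.mp this.symm)

theorem ordMon_exponents_of_pairwise {l : List I} (hl : l.Pairwise (· ≤ ·)) :
    ordMon b (exponents l) = word (l.map b) := by
  rw [ordMon, (exponents_perm l).symm.eq_of_pairwise' (Multiset.pairwise_sort _ _) hl]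

theorem wordSpan_le_ordSpan {S : Set I}
    (hS : ∀ i ∈ S, ∀ j ∈ S, ⁅b i, b j⁆ ∈ Submodule.span ℂ (b '' S)) (n : ℕ) :
    wordSpan b S n ≤ ordSpan b S n := by
  induction n with
  | zero =>
    refine Submodule.span_le.mpr ?_
    rintro _ ⟨l, h1, h2, h3, rfl⟩
    exact absurd h3 (Nat.not_lt_zero _)
  | succ n ih =>
    refine Submodule.span_le.mpr ?_
    rintro _ ⟨l, h1, h2, h3, rfl⟩
    have h4 := word_sub_word_mem b hS (exponents_perm l) h1
    have h5 := ordSpan_mono b S (Nat.le_succ n) (ih (wordSpan_mono b S (Nat.lt_succ_iff.mp h3) h4))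
    have h6 : ordMon b (exponents l) ∈ ordSpan b S (n + 1) :=
      Submodule.subset_span ⟨exponents l, fun i hi => h1 i ((mem_support_exponents l i).mp hi),
        exponents_ne_zero h2, by rwa [degree_exponents], rfl⟩
    have := Submodule.add_mem _ h5 h6
    simpa [ordMon] using this

theorem word_sub_ordMon_mem {S : Set I}
    (hS : ∀ i ∈ S, ∀ j ∈ S, ⁅b i, b j⁆ ∈ Submodule.span ℂ (b '' S)) {l : List I}
    (hl : ∀ i ∈ l, i ∈ S) : word (l.map b) - ordMon b (exponents l) ∈ ordSpan b S l.length :=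
  wordSpan_le_ordSpan b hS _ (word_sub_word_mem b hS (exponents_perm l) hl)

/-- The linear map from polynomials to the enveloping algebra given by ordered monomials. -/
noncomputable def ordMap : MvPolynomial I ℂ →ₗ[ℂ] UniversalEnvelopingAlgebra ℂ g :=
  (MvPolynomial.basisMonomials I ℂ).constr ℂ (ordMon b)

theorem ordMap_monomial (s : I →₀ ℕ) (c : ℂ) :
    ordMap b (MvPolynomial.monomial s c) = c • ordMon b s := by
  have h : MvPolynomial.monomial s c = c • MvPolynomial.basisMonomials I ℂ s := by
    simp [MvPolynomial.smul_monomial]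
  rw [h, map_smul, ordMap, Module.Basis.constr_basis]

theorem ordMap_eq_sum (q : MvPolynomial I ℂ) :
    ordMap b q = ∑ s ∈ q.support, q.coeff s • ordMon b s := by
  conv_lhs => rw [q.as_sum, map_sum]
  simp_rw [ordMap_monomial]

theorem ordMon_mem_symRel (s : I →₀ ℕ) :
    (ordMon b s, MvPolynomial.monomial s 1) ∈ symRel b s.degree := by
  have := basis_word_mem_symRel b (Finsupp.toMultiset s).sort
  rw [Multiset.length_sort, Finsupp.card_toMultiset] at this
  have h : ((Finsupp.toMultiset s).sort.map (MvPolynomial.X (R := ℂ))).prod =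
      ((Finsupp.toMultiset s).map (MvPolynomial.X (R := ℂ))).prod := by
    conv_rhs => rw [← Multiset.sort_eq (Finsupp.toMultiset s) (· ≤ ·)]
    rw [Multiset.map_coe, Multiset.prod_coe]
  have h' : MvPolynomial.monomial s (1 : ℂ) =
      ((Finsupp.toMultiset s).map (MvPolynomial.X (R := ℂ))).prod := by
    rw [MvPolynomial.monomial_eq, Finsupp.toMultiset_map, Finsupp.prod_toMultiset]
    simp [Finsupp.prod_mapDomain_index, pow_add]
  rw [h', ← h]
  exact this

theorem ordMap_mem_symRel {q : MvPolynomial I ℂ} {n : ℕ} (hq : q.totalDegree ≤ n) :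
    (ordMap b q, MvPolynomial.homogeneousComponent n q) ∈ symRel b n := by
  have h1 : MvPolynomial.homogeneousComponent n q = ∑ s ∈ q.support, q.coeff s •
      (if s.degree = n then MvPolynomial.monomial s (1 : ℂ) else 0) := by
    conv_lhs => rw [q.as_sum, map_sum]
    refine Finset.sum_congr rfl fun s hs => ?_
    split_ifs with h
    · rw [MvPolynomial.homogeneousComponent_of_mem (m := n)
        ((MvPolynomial.mem_homogeneousSubmodule n _).mpr (MvPolynomial.isHomogeneous_monomial _ h)),
        if_pos rfl, MvPolynomial.smul_monomial]
      simp
    · rw [smul_zero]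
      refine MvPolynomial.homogeneousComponent_eq_zero' _ _ fun d hd => ?_
      rw [Finset.mem_singleton.mp (MvPolynomial.support_monomial_subset hd)]
      exact h
  have h2 : (ordMap b q, MvPolynomial.homogeneousComponent n q) = ∑ s ∈ q.support, q.coeff s •
      (ordMon b s, if s.degree = n then MvPolynomial.monomial s (1 : ℂ) else 0) := by
    rw [h1, ordMap_eq_sum]
    simp only [Prod.smul_mk]
    exact Prod.ext (by simp [Prod.fst_sum]) (by simp [Prod.snd_sum])
  rw [h2]
  refine Submodule.sum_mem _ fun s hs => Submodule.smul_mem _ _ ?_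
  have h3 : s.degree ≤ n := (MvPolynomial.le_totalDegree hs).trans hq
  split_ifs with h
  · exact h ▸ ordMon_mem_symRel b s
  · exact symRel_of_lt b (lt_of_le_of_ne h3 h) (ordMon_mem_symRel b s)

theorem exists_of_mem_ordSpan {S : Set I} {n : ℕ} {u : UniversalEnvelopingAlgebra ℂ g}
    (hu : u ∈ ordSpan b S n) : ∃ q : MvPolynomial I ℂ, ordMap b q = u ∧
      ∀ s ∈ q.support, (∀ i ∈ s.support, i ∈ S) ∧ s ≠ 0 ∧ s.degree < n := by
  suffices H : ordSpan b S n ≤ (MvPolynomial.restrictSupport ℂ {s : I →₀ ℕ |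
      (∀ i ∈ s.support, i ∈ S) ∧ s ≠ 0 ∧ s.degree < n}).map (ordMap b) by
    obtain ⟨q, hq, rfl⟩ := H hu
    exact ⟨q, rfl, fun s hs => hq hs⟩
  refine Submodule.span_le.mpr ?_
  rintro _ ⟨s, h1, h2, h3, rfl⟩
  refine ⟨MvPolynomial.monomial s 1, ?_, by rw [ordMap_monomial, one_smul]⟩
  intro d hd
  rw [Finset.mem_singleton.mp (MvPolynomial.support_monomial_subset hd)]
  exact ⟨h1, h2, h3⟩

theorem exists_ordMap_eq_word (l : List I) : ∃ q : MvPolynomial I ℂ,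
    word (l.map b) = ordMon b (exponents l) + ordMap b q ∧ ∀ s ∈ q.support, s.degree < l.length := by
  have h := word_sub_ordMon_mem b (S := Set.univ) (fun i _ j _ => by
    rw [Set.image_univ, b.span_eq]; trivial) (l := l) fun _ _ => trivial
  obtain ⟨q, hq, hqs⟩ := exists_of_mem_ordSpan b h
  exact ⟨q, by rw [hq]; abel, fun s hs => (hqs s hs).2.2⟩

theorem prod_X_eq_monomial (l : List I) :
    (l.map (MvPolynomial.X (R := ℂ))).prod = MvPolynomial.monomial (exponents l) 1 := by
  have h : (l.map (MvPolynomial.X (R := ℂ))).prod =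
      ((Finsupp.toMultiset (exponents l)).map (MvPolynomial.X (R := ℂ))).prod := by
    rw [exponents, Multiset.toFinsupp_toMultiset, Multiset.map_coe, Multiset.prod_coe]
  rw [h, MvPolynomial.monomial_eq, Finsupp.toMultiset_map, Finsupp.prod_toMultiset]
  simp [Finsupp.prod_mapDomain_index, pow_add]

theorem exists_ordMap_eq_of_mem_symRel {u : UniversalEnvelopingAlgebra ℂ g} {h : MvPolynomial I ℂ}
    {n : ℕ} (hu : (u, h) ∈ symRel b n) : ∃ q : MvPolynomial I ℂ, q.totalDegree ≤ n ∧
      ordMap b q = u ∧ MvPolynomial.homogeneousComponent n q = h := by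
  let f : MvPolynomial I ℂ →ₗ[ℂ] UniversalEnvelopingAlgebra ℂ g × MvPolynomial I ℂ :=
    (ordMap b).prod (MvPolynomial.homogeneousComponent n)
  suffices H : symRel b n ≤ (MvPolynomial.restrictTotalDegree I ℂ n).map f by
    obtain ⟨q, hq, hqu⟩ := H hu
    obtain ⟨h1, h2⟩ := Prod.ext_iff.mp hqu
    exact ⟨q, (MvPolynomial.mem_restrictTotalDegree _ _ _).mp hq, h1, h2⟩
  refine Submodule.span_le.mpr ?_
  rintro _ (⟨l, hl, rfl⟩ | ⟨l, rfl, rfl⟩)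
  all_goals
    obtain ⟨q, hq, hqs⟩ := exists_ordMap_eq_word b l
    refine ⟨MvPolynomial.monomial (exponents l) 1 + q, ?_, ?_⟩
  · refine Submodule.add_mem _ ?_ ?_
    · rw [MvPolynomial.mem_restrictTotalDegree]
      refine (MvPolynomial.totalDegree_monomial_le _ _).trans ?_
      exact (degree_exponents l).trans_le hl.le
    · rw [MvPolynomial.mem_restrictTotalDegree, MvPolynomial.totalDegree]
      exact Finset.sup_le fun s hs => ((hqs s hs).trans hl).le
  · refine Prod.ext ?_ ?_
    · change ordMap b _ = _
      rw [map_add, ordMap_monomial, one_smul, hq]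
    · change MvPolynomial.homogeneousComponent n _ = 0
      refine MvPolynomial.homogeneousComponent_eq_zero' _ _ fun d hd => ?_
      rcases Finset.mem_union.mp (MvPolynomial.support_add hd) with hd | hd
      · rw [Finset.mem_singleton.mp (MvPolynomial.support_monomial_subset hd), degree_exponents]
        exact hl.ne
      · exact ((hqs d hd).trans hl).ne
  · refine Submodule.add_mem _ ?_ ?_
    · rw [MvPolynomial.mem_restrictTotalDegree]
      refine (MvPolynomial.totalDegree_monomial_le _ _).trans ?_
      exact (degree_exponents l).le
    · rw [MvPolynomial.mem_restrictTotalDegree, MvPolynomial.totalDegree]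
      exact Finset.sup_le fun s hs => (hqs s hs).le
  · refine Prod.ext ?_ ?_
    · change ordMap b _ = _
      rw [map_add, ordMap_monomial, one_smul, hq]
    · change MvPolynomial.homogeneousComponent _ _ = _
      rw [prod_X_eq_monomial, map_add, MvPolynomial.homogeneousComponent_of_mem (m := l.length)
        ((MvPolynomial.mem_homogeneousSubmodule _ _).mpr
          (MvPolynomial.isHomogeneous_monomial _ (degree_exponents l))), if_pos rfl,
        MvPolynomial.homogeneousComponent_eq_zero' _ _ fun d hd => (hqs d hd).ne, add_zero]

theorem ordMap_surjective : Function.Surjective (ordMap b) := by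
  intro u
  obtain ⟨n, hn⟩ := exists_mem_symRel b u
  obtain ⟨q, -, hq, -⟩ := exists_ordMap_eq_of_mem_symRel b hn
  exact ⟨q, hq⟩

theorem MvPolynomial.homogeneousComponent_totalDegree_ne_zero {σ R : Type*} [CommSemiring R]
    {q : MvPolynomial σ R} (hq : q ≠ 0) :
    MvPolynomial.homogeneousComponent q.totalDegree q ≠ 0 := by
  obtain ⟨s, hs, hsd⟩ := Finset.exists_mem_eq_sup q.support
    (Finset.nonempty_iff_ne_empty.mpr fun h => hq (MvPolynomial.support_eq_empty.mp h))
    fun s => s.sum fun _ e => e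
  intro h
  have h2 := congrArg (MvPolynomial.coeff s) h
  rw [MvPolynomial.coeff_homogeneousComponent, if_pos (show s.degree = q.totalDegree from hsd.symm)] at h2
  exact MvPolynomial.mem_support_iff.mp hs h2

theorem ordMap_injective [Finite I] {N : Type*} [Fintype N] (ρ : g →ₗ[ℂ] Matrix N N ℂ)
    (hρ : ∀ x y, ρ ⁅x, y⁆ = ρ x * ρ y - ρ y * ρ x) (hinj : Function.Injective ρ) :
    Function.Injective (ordMap b) := by
  rw [injective_iff_map_eq_zero]
  intro q hq
  have h := ordMap_mem_symRel b (le_refl q.totalDegree)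
  rw [hq] at h
  have h2 := symRel_zero_left b ρ hρ hinj h
  by_contra hne
  exact MvPolynomial.homogeneousComponent_totalDegree_ne_zero hne h2

/-- An element of filtration degree at most `n` is given by a polynomial of degree at most `n`,
whose component of degree `n` is the symbol. -/
theorem totalDegree_le_and_homogeneousComponent_eq (hb : Function.Injective (ordMap b))
    {n : ℕ} {q h : MvPolynomial I ℂ} (hu : (ordMap b q, h) ∈ symRel b n) :
    q.totalDegree ≤ n ∧ MvPolynomial.homogeneousComponent n q = h := by
  obtain ⟨q', h1, h2, h3⟩ := exists_ordMap_eq_of_mem_symRel b hu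
  rw [← hb h2]
  exact ⟨h1, h3⟩

end Ordered

section Triangular

attribute [local instance] LieRing.ofAssociativeRing

/-- A basis adapted to a triangular decomposition of a reductive Lie algebra, together with a
representation whose trace form is nondegenerate. The basis vectors with `c i = 0` span a Cartan
subalgebra containing the regular element `h`, and `c` is the eigenvalue of `ad h`. -/
structure TriangularData (g : Type*) [LieRing g] [LieAlgebra ℂ g] (I N : Type*) [LinearOrder I]
    [Fintype N] where
  b : Module.Basis I ℂ g
  c : I → ℂ
  re_ne : ∀ i, c i ≠ 0 → (c i).re ≠ 0
  mono : ∀ i j, i ≤ j → (c i).re ≤ (c j).re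
  a : I → I → ℂ
  lie_eq : ∀ i j, c i = 0 → ⁅b i, b j⁆ = a i j • b j
  a_zero : ∀ i j, c i = 0 → c j = 0 → a i j = 0
  h : g
  h_mem : h ∈ Submodule.span ℂ (b '' {i | c i = 0})
  lie_h : ∀ j, ⁅h, b j⁆ = c j • b j
  ρ : g →ₗ[ℂ] Matrix N N ℂ
  ρ_lie : ∀ x y, ρ ⁅x, y⁆ = ρ x * ρ y - ρ y * ρ x
  ρ_diag : ∀ i, c i = 0 → (ρ (b i)).IsDiag
  nondeg : ∀ x, (∀ y, (ρ x * ρ y).trace = 0) → x = 0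

namespace TriangularData

variable {g : Type*} [LieRing g] [LieAlgebra ℂ g] {I N : Type*} [LinearOrder I] [Fintype N]
  (D : TriangularData g I N)

theorem ρ_injective : Function.Injective D.ρ := by
  rw [injective_iff_map_eq_zero]
  intro x hx
  exact D.nondeg x fun y => by simp [hx]

theorem ordMap_injective [Finite I] : Function.Injective (ordMap D.b) :=
  _root_.ordMap_injective D.b D.ρ D.ρ_lie D.ρ_injective

/-- The indices of positive root vectors. -/
def plus : Set I := {i | 0 < (D.c i).re}

theorem repr_lie_h (x : g) (k : I) : D.b.repr ⁅D.h, x⁆ k = D.c k * D.b.repr x k := by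
  have : D.b.coord k ∘ₗ (LieAlgebra.ad ℂ g D.h : g →ₗ[ℂ] g) = D.c k • D.b.coord k := by
    apply D.b.ext
    intro j
    by_cases hjk : j = k
    · subst hjk; simp [D.lie_h]
    · simp [D.lie_h, hjk]
  exact DFunLike.congr_fun this x

theorem lie_mem_span_plus {i j : I} (hi : i ∈ D.plus) (hj : j ∈ D.plus) :
    ⁅D.b i, D.b j⁆ ∈ Submodule.span ℂ (D.b '' D.plus) := by
  have h1 : ⁅D.h, ⁅D.b i, D.b j⁆⁆ = (D.c i + D.c j) • ⁅D.b i, D.b j⁆ := by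
    rw [leibniz_lie, D.lie_h, D.lie_h, smul_lie, lie_smul, add_smul]
  have h2 := D.repr_lie_h
  rw [Module.Basis.mem_span_image]
  intro k hk
  have h3 := h2 ⁅D.b i, D.b j⁆ k
  rw [h1, map_smul, Finsupp.smul_apply, smul_eq_mul] at h3
  have h4 := mul_right_cancel₀ (Finsupp.mem_support_iff.mp hk) h3
  change 0 < (D.c k).re
  rw [← h4, Complex.add_re]
  exact add_pos hi hj

/-- The left ideal generated by the positive root vectors. -/
noncomputable def nplus : Ideal (UniversalEnvelopingAlgebra ℂ g) :=
  Ideal.span {u | ∃ i ∈ D.plus, u = UniversalEnvelopingAlgebra.ι ℂ (D.b i)}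

theorem ι_mem_nplus {i : I} (hi : i ∈ D.plus) : UniversalEnvelopingAlgebra.ι ℂ (D.b i) ∈ D.nplus :=
  Ideal.subset_span ⟨i, hi, rfl⟩

theorem smul_mem_nplus (c : ℂ) {u : UniversalEnvelopingAlgebra ℂ g} (hu : u ∈ D.nplus) :
    c • u ∈ D.nplus := by
  rw [Algebra.smul_def]
  exact Ideal.mul_mem_left _ _ hu

theorem le_of_mem_plus {i j : I} (hi : i ∉ D.plus) (hj : j ∈ D.plus) : i ≤ j := by
  by_contra h
  exact hi (lt_of_lt_of_le hj (D.mono j i (not_le.mp h).le))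

theorem ordMon_mem_nplus {s : I →₀ ℕ} (hs : ∃ i ∈ s.support, i ∈ D.plus) :
    ordMon D.b s ∈ D.nplus := by
  obtain ⟨i, hi, hip⟩ := hs
  have hmem : i ∈ (Finsupp.toMultiset s).sort := by
    rw [Multiset.mem_sort, Finsupp.mem_toMultiset]; exact hi
  have hne : (Finsupp.toMultiset s).sort ≠ [] := List.ne_nil_of_mem hmem
  have hlast : (Finsupp.toMultiset s).sort.getLast hne ∈ D.plus := by
    have h1 := Multiset.pairwise_sort (Finsupp.toMultiset s) (· ≤ ·)
    rw [← List.dropLast_append_getLast hne] at h1 hmem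
    rcases List.mem_append.mp hmem with h | h
    · exact lt_of_lt_of_le hip (D.mono _ _ ((List.pairwise_append.mp h1).2.2 i h _ (by simp)))
    · rw [List.mem_singleton] at h; rwa [← h]
  rw [ordMon, ← List.dropLast_append_getLast hne, List.map_append, word_append]
  refine Ideal.mul_mem_left _ _ ?_
  simpa [word] using D.ι_mem_nplus hlast

theorem exists_of_mem_nplus {u : UniversalEnvelopingAlgebra ℂ g} (hu : u ∈ D.nplus) :
    ∃ q : MvPolynomial I ℂ, ordMap D.b q = u ∧ ∀ s ∈ q.support, ∃ i ∈ s.support, i ∈ D.plus := by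
  let M : Submodule ℂ (UniversalEnvelopingAlgebra ℂ g) :=
    (MvPolynomial.restrictSupport ℂ {s : I →₀ ℕ | ∃ i ∈ s.support, i ∈ D.plus}).map (ordMap D.b)
  have hM : ∀ s : I →₀ ℕ, (∃ i ∈ s.support, i ∈ D.plus) → ordMon D.b s ∈ M := by
    intro s hs
    refine ⟨MvPolynomial.monomial s 1, fun d hd => ?_, by rw [ordMap_monomial, one_smul]⟩
    rwa [Finset.mem_singleton.mp (MvPolynomial.support_monomial_subset hd)]
  have h1 : ∀ i ∈ D.plus, ∀ s, ordMon D.b s * UniversalEnvelopingAlgebra.ι ℂ (D.b i) ∈ M := by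
    intro i hi s
    classical
    let l := (Finsupp.toMultiset s).sort
    let l₁ := l.takeWhile (fun j => decide (j ∉ D.plus))
    let l₂ := l.dropWhile (fun j => decide (j ∉ D.plus))
    have hl : l₁ ++ l₂ = l := List.takeWhile_append_dropWhile
    have hp : (l₁ ++ l₂).Pairwise (· ≤ ·) := by rw [hl]; exact Multiset.pairwise_sort _ _
    have hl₁ : ∀ j ∈ l₁, j ∉ D.plus := fun j hj => of_decide_eq_true (List.mem_takeWhile_imp (l := l) (p := fun j => decide (j ∉ D.plus)) hj)
    have hl₂ : ∀ j ∈ l₂, j ∈ D.plus := by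
      intro j hj
      have hne : l₂ ≠ [] := List.ne_nil_of_mem hj
      have h0 : l₂.head hne ∈ D.plus := by
        have := List.head_dropWhile_not (fun j => decide (j ∉ D.plus)) (l := l) hne
        by_contra hcon
        exact absurd (decide_eq_true hcon) (by rw [Bool.not_eq_true]; exact this)
      have hp₂ := (List.pairwise_append.mp hp).2.1
      rw [← List.cons_head_tail hne] at hj hp₂
      rcases List.mem_cons.mp hj with h | h
      · rwa [h]
      · exact lt_of_lt_of_le h0 (D.mono _ _ ((List.pairwise_cons.mp hp₂).1 j h))
    have e : ordMon D.b s * UniversalEnvelopingAlgebra.ι ℂ (D.b i) =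
        word (l₁.map D.b) * word ((l₂ ++ [i]).map D.b) := by
      change word (l.map D.b) * _ = _
      rw [← hl, List.map_append, List.map_append, word_append, word_append, mul_assoc]
      simp [word]
    rw [e]
    have h2 : word ((l₂ ++ [i]).map D.b) ∈ ordSpan D.b D.plus ((l₂ ++ [i]).length + 1) := by
      refine wordSpan_le_ordSpan D.b (fun i hi j hj => D.lie_mem_span_plus hi hj) _
        (Submodule.subset_span ⟨l₂ ++ [i], ?_, by simp, Nat.lt_succ_self _, rfl⟩)
      intro j hj
      rcases List.mem_append.mp hj with h | h
      · exact hl₂ j h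
      · rw [List.mem_singleton.mp h]; exact hi
    suffices H : ∀ n, ordSpan D.b D.plus n ≤ M.comap (LinearMap.mulLeft ℂ (word (l₁.map D.b))) from
      H _ h2
    intro n
    refine Submodule.span_le.mpr ?_
    rintro _ ⟨t, ht, ht0, -, rfl⟩
    have ht' : ∀ j ∈ (Finsupp.toMultiset t).sort, j ∈ D.plus := by
      intro j hj
      rw [Multiset.mem_sort, Finsupp.mem_toMultiset] at hj
      exact ht j hj
    have hpw : (l₁ ++ (Finsupp.toMultiset t).sort).Pairwise (· ≤ ·) := by
      rw [List.pairwise_append]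
      exact ⟨(List.pairwise_append.mp hp).1, Multiset.pairwise_sort _ _,
        fun x hx y hy => D.le_of_mem_plus (hl₁ x hx) (ht' y hy)⟩
    have h3 := ordMon_exponents_of_pairwise D.b hpw
    rw [List.map_append, word_append] at h3
    change word (l₁.map D.b) * ordMon D.b t ∈ M
    rw [ordMon, ← h3]
    refine hM _ ?_
    obtain ⟨j, hj⟩ := Finsupp.support_nonempty_iff.mpr ht0
    refine ⟨j, ?_, ht j hj⟩
    rw [mem_support_exponents]
    exact List.mem_append_right _ (by rwa [Multiset.mem_sort, Finsupp.mem_toMultiset])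
  have h2 : ∀ i ∈ D.plus, ∀ w, w * UniversalEnvelopingAlgebra.ι ℂ (D.b i) ∈ M := by
    intro i hi w
    obtain ⟨q, rfl⟩ := ordMap_surjective D.b w
    rw [ordMap_eq_sum, Finset.sum_mul]
    refine Submodule.sum_mem _ fun s _ => ?_
    rw [smul_mul_assoc]
    exact Submodule.smul_mem _ _ (h1 i hi s)
  have h3 : ∀ w, w * u ∈ M := by
    refine Submodule.span_induction (p := fun u _ => ∀ w, w * u ∈ M) ?_ ?_ ?_ ?_ hu
    · rintro _ ⟨i, hi, rfl⟩ w
      exact h2 i hi w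
    · intro w; rw [mul_zero]; exact M.zero_mem
    · intro x y _ _ hx hy w
      rw [mul_add]; exact M.add_mem (hx w) (hy w)
    · intro c x _ hx w
      rw [smul_eq_mul, ← mul_assoc]; exact hx _
  obtain ⟨q, hq, hqu⟩ := h3 1
  exact ⟨q, by rw [hqu, one_mul], fun s hs => hq hs⟩

/-- The exponents of the leading terms of elements of `nplus` involve a positive root vector. -/
theorem exists_plus_of_symRel [Finite I] {u : UniversalEnvelopingAlgebra ℂ g} (hu : u ∈ D.nplus)
    {n : ℕ} {h : MvPolynomial I ℂ} (hh : (u, h) ∈ symRel D.b n) :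
    ∀ s ∈ h.support, ∃ i ∈ s.support, i ∈ D.plus := by
  obtain ⟨q, rfl, hq⟩ := D.exists_of_mem_nplus hu
  obtain ⟨-, h2⟩ := totalDegree_le_and_homogeneousComponent_eq D.b D.ordMap_injective hh
  intro s hs
  refine hq s ?_
  rw [MvPolynomial.mem_support_iff, ← h2, MvPolynomial.coeff_homogeneousComponent] at hs
  rw [MvPolynomial.mem_support_iff]
  exact fun h0 => hs (by rw [h0]; simp)

end TriangularData

end Triangular

/-- A derivation preserving an ideal preserves its powers. -/
theorem Derivation.mem_pow_of_mem_pow {k S : Type*} [CommRing k] [CommRing S] [Algebra k S]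
    (d : Derivation k S S) {J : Ideal S} (hd : ∀ x ∈ J, d x ∈ J) (n : ℕ) :
    ∀ x ∈ J ^ n, d x ∈ J ^ n := by
  induction n with
  | zero => intro x _; simp
  | succ n ih =>
    intro x hx
    rw [pow_succ] at hx ⊢
    induction hx using Submodule.mul_induction_on' with
    | mem_mul_mem a ha b hb =>
      rw [Derivation.leibniz]
      have h := ih a ha
      refine Ideal.add_mem _ (Ideal.mul_mem_mul ha (hd b hb)) ?_
      rw [smul_eq_mul, mul_comm b]
      exact Ideal.mul_mem_mul h hb
    | add a _ b _ iha ihb => rw [map_add]; exact Ideal.add_mem _ iha ihb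

/-- A set of polynomials vanishing on `{X i = 0, i ∈ S}` and stable under vector fields which are
transversal to this subspace at the origin consists of `0`. -/
theorem MvPolynomial.eq_zero_of_mem_of_derivation_mem {σ k : Type*} [DecidableEq σ] [Field k]
    [CharZero k] (S : Set σ)
    (Q : Set (MvPolynomial σ k)) (hS : ∀ q ∈ Q, ∀ s ∈ q.support, ∃ i ∈ S, s i ≠ 0)
    (hd : ∀ β ∈ S, ∃ d : Derivation k (MvPolynomial σ k) (MvPolynomial σ k),
      (∀ i, MvPolynomial.constantCoeff (d (MvPolynomial.X i)) = if i = β then 1 else 0) ∧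
        ∀ q ∈ Q, d q ∈ Q) : ∀ q ∈ Q, q = 0 := by
  have key : ∀ m : ℕ, ∀ q ∈ Q, q ∈ MvPolynomial.idealOfVars σ k ^ m := by
    intro m
    induction m with
    | zero => intro q _; simp
    | succ m ih =>
      intro q hq
      rw [MvPolynomial.mem_pow_idealOfVars_iff']
      intro s hs
      rcases lt_or_eq_of_le (Nat.lt_succ_iff.mp hs) with h | h
      · exact (MvPolynomial.mem_pow_idealOfVars_iff' m q).mp (ih q hq) s h
      by_contra hne
      obtain ⟨β, hβ, hsβ⟩ := hS q hq s (MvPolynomial.mem_support_iff.mpr hne)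
      obtain ⟨d, hd1, hd2⟩ := hd β hβ
      let d' := d - MvPolynomial.pderiv β
      have hconst : ∀ p : MvPolynomial σ k, MvPolynomial.constantCoeff p = 0 →
          p ∈ MvPolynomial.idealOfVars σ k := by
        intro p hp
        have := MvPolynomial.mem_pow_idealOfVars_iff' 1 p
        rw [pow_one] at this
        rw [this]
        intro x hx
        rw [(Finsupp.degree_eq_zero_iff x).mp (Nat.lt_one_iff.mp hx)]
        exact hp
      have hd' : ∀ x ∈ MvPolynomial.idealOfVars σ k, d' x ∈ MvPolynomial.idealOfVars σ k := by
        intro x hx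
        induction hx using Submodule.span_induction with
        | mem x hx =>
          obtain ⟨i, rfl⟩ := hx
          refine hconst _ ?_
          change MvPolynomial.constantCoeff (d _ - MvPolynomial.pderiv β _) = 0
          rw [map_sub, hd1, MvPolynomial.pderiv_X]
          by_cases hi : i = β
          · subst hi; simp
          · simp [hi]
        | zero => simp
        | add x y _ _ hx hy => rw [map_add]; exact Ideal.add_mem _ hx hy
        | smul a x hx' hx =>
          rw [smul_eq_mul, Derivation.leibniz]
          refine Ideal.add_mem _ (Ideal.mul_mem_left _ _ hx) ?_
          rw [smul_eq_mul, mul_comm]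
          exact Ideal.mul_mem_left _ _ hx'
      have h1 : MvPolynomial.pderiv β q ∈ MvPolynomial.idealOfVars σ k ^ m := by
        have h2 := d'.mem_pow_of_mem_pow hd' m q (ih q hq)
        have h3 := Ideal.sub_mem _ (ih _ (hd2 q hq)) h2
        have : d q - d' q = MvPolynomial.pderiv β q := sub_sub_cancel _ _
        rwa [this] at h3
      have hle : Finsupp.single β 1 ≤ s := by
        rw [Finsupp.single_le_iff]; omega
      obtain ⟨t, rfl⟩ := exists_add_of_le hle
      rw [map_add, Finsupp.degree_single] at h
      have h4 := (MvPolynomial.mem_pow_idealOfVars_iff' m _).mp h1 t (by omega)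
      rw [MvPolynomial.coeff_pderiv, add_comm t] at h4
      rcases mul_eq_zero.mp h4 with h5 | h5
      · exact hne h5
      · exact Nat.cast_add_one_ne_zero _ h5
  intro q hq
  ext s
  rw [MvPolynomial.coeff_zero]
  exact (MvPolynomial.mem_pow_idealOfVars_iff' _ q).mp (key (s.degree + 1) q hq) s
    (Nat.lt_succ_self _)

section Triangular

attribute [local instance] LieRing.ofAssociativeRing

namespace TriangularData

variable {g : Type*} [LieRing g] [LieAlgebra ℂ g] {I N : Type*} [LinearOrder I] [Fintype N]
  (D : TriangularData g I N)

/-- The trace form of the representation. -/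
noncomputable def traceForm : LinearMap.BilinForm ℂ g :=
  LinearMap.mk₂ ℂ (fun x y => (D.ρ x * D.ρ y).trace)
    (fun x y z => by simp [add_mul]) (fun c x y => by simp)
    (fun x y z => by simp [mul_add]) (fun c x y => by simp)

theorem traceForm_apply (x y : g) : D.traceForm x y = (D.ρ x * D.ρ y).trace := rfl

theorem traceForm_symm (x y : g) : D.traceForm x y = D.traceForm y x := by
  rw [traceForm_apply, traceForm_apply, Matrix.trace_mul_comm]

theorem traceForm_lie (x y z : g) : D.traceForm ⁅x, y⁆ z = D.traceForm x ⁅y, z⁆ := by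
  simp only [traceForm_apply, D.ρ_lie, sub_mul, mul_sub, Matrix.trace_sub]
  rw [mul_assoc (D.ρ y), Matrix.trace_mul_comm (D.ρ y)]
  simp only [mul_assoc]

theorem traceForm_nondegenerate [Finite I] : D.traceForm.Nondegenerate := by
  have := Module.Finite.of_basis D.b
  exact LinearMap.BilinForm.Nondegenerate.ofSeparatingLeft fun x hx => D.nondeg x hx

/-- The basis dual to `b` for the trace form. -/
noncomputable def dual [Finite I] : Module.Basis I ℂ g :=
  D.traceForm.dualBasis D.traceForm_nondegenerate D.b

theorem traceForm_dual [Finite I] (i j : I) :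
    D.traceForm (D.dual i) (D.b j) = if j = i then 1 else 0 :=
  LinearMap.BilinForm.apply_dualBasis_left _ _ _ _

/-- Evaluation of the trace form at the regular element. -/
noncomputable def regular : g →ₗ[ℂ] ℂ := D.traceForm D.h

theorem regular_basis {i : I} (hi : D.c i ≠ 0) : D.regular (D.b i) = 0 := by
  have h1 : D.regular (D.c i • D.b i) = 0 := by
    rw [← D.lie_h, regular, ← traceForm_lie, lie_self]
    simp
  rw [map_smul, smul_eq_mul] at h1
  exact (mul_eq_zero.mp h1).resolve_left hi

theorem exists_regular_lie [Finite I] {β : I} (hβ : D.c β ≠ 0) :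
    ∃ y : g, ∀ i, D.regular ⁅y, D.b i⁆ = if i = β then 1 else 0 := by
  refine ⟨-(D.c β)⁻¹ • D.dual β, fun i => ?_⟩
  have h1 : D.regular ⁅D.dual β, D.b i⁆ = -(D.c i * D.traceForm (D.dual β) (D.b i)) := by
    rw [regular, ← traceForm_lie, ← lie_skew, map_neg, LinearMap.neg_apply, traceForm_lie, D.lie_h,
      map_smul, smul_eq_mul]
  rw [smul_lie, map_smul, h1, traceForm_dual, smul_eq_mul]
  split_ifs with h
  · subst h; field_simp
  · simp

/-- The enveloping algebra acts faithfully on its quotient by the left ideal `nplus`. -/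
theorem eq_zero_of_forall_mul_mem_nplus [Finite I] {u : UniversalEnvelopingAlgebra ℂ g}
    (hu : ∀ w, u * w ∈ D.nplus) : u = 0 := by
  let τ : MvPolynomial I ℂ →ₐ[ℂ] MvPolynomial I ℂ :=
    MvPolynomial.aeval fun i => MvPolynomial.X i + MvPolynomial.C (D.regular (D.b i))
  let τ' : MvPolynomial I ℂ →ₐ[ℂ] MvPolynomial I ℂ :=
    MvPolynomial.aeval fun i => MvPolynomial.X i - MvPolynomial.C (D.regular (D.b i))
  have hττ : ∀ q, τ' (τ q) = q := by
    intro q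
    have : τ'.comp τ = AlgHom.id ℂ _ := by
      apply MvPolynomial.algHom_ext
      intro i
      have : ∀ c, τ' (MvPolynomial.C c) = MvPolynomial.C c := fun c => τ'.commutes c
      simp only [AlgHom.comp_apply, AlgHom.id_apply, τ, MvPolynomial.aeval_X, map_add, this]
      simp [τ']
    exact DFunLike.congr_fun this q
  have hττ' : ∀ q, τ (τ' q) = q := by
    intro q
    have : τ.comp τ' = AlgHom.id ℂ _ := by
      apply MvPolynomial.algHom_ext
      intro i
      have : ∀ c, τ (MvPolynomial.C c) = MvPolynomial.C c := fun c => τ.commutes c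
      simp only [AlgHom.comp_apply, AlgHom.id_apply, τ', MvPolynomial.aeval_X, map_sub, this]
      simp [τ]
    exact DFunLike.congr_fun this q
  have hτlin : ∀ x, MvPolynomial.constantCoeff (τ (linPoly D.b x)) = D.regular x := by
    intro x
    let f : MvPolynomial I ℂ →ₐ[ℂ] ℂ := (MvPolynomial.aeval (fun _ : I => (0 : ℂ)))
    have hf : ∀ p, MvPolynomial.constantCoeff p = f p := by
      intro p
      change _ = MvPolynomial.aeval (0 : I → ℂ) p
      rw [MvPolynomial.aeval_zero]; rfl
    rw [hf]
    have : f.toLinearMap ∘ₗ τ.toLinearMap ∘ₗ linPoly D.b = D.regular := by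
      apply D.b.ext
      intro i
      simp [τ, f]
    exact DFunLike.congr_fun this x
  let Q : Set (MvPolynomial I ℂ) :=
    {p | ∃ q n w, τ q = p ∧ (∀ v, w * v ∈ D.nplus) ∧ (w, q) ∈ symRel D.b n}
  have hQ : ∀ p ∈ Q, p = 0 := by
    apply MvPolynomial.eq_zero_of_mem_of_derivation_mem D.plus
    · rintro _ ⟨q, n, w, rfl, hw, hq⟩
      have h1 := D.exists_plus_of_symRel (by simpa using hw 1) hq
      have h2 : q ∈ Ideal.span (MvPolynomial.X '' D.plus : Set (MvPolynomial I ℂ)) := by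
        rw [MvPolynomial.mem_ideal_span_X_image]
        intro s hs
        obtain ⟨i, hi, hi'⟩ := h1 s hs
        exact ⟨i, hi', Finsupp.mem_support_iff.mp hi⟩
      have h3 : Ideal.span (MvPolynomial.X '' D.plus : Set (MvPolynomial I ℂ)) ≤
          (Ideal.span (MvPolynomial.X '' D.plus : Set (MvPolynomial I ℂ))).comap τ := by
        rw [Ideal.span_le]
        rintro _ ⟨i, hi, rfl⟩
        have : D.regular (D.b i) = 0 := D.regular_basis fun h0 => by
          have : 0 < (D.c i).re := hi
          rw [h0] at this
          exact lt_irrefl _ this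
        change τ (MvPolynomial.X i) ∈ Ideal.span (MvPolynomial.X '' D.plus)
        simp only [τ, MvPolynomial.aeval_X, this, map_zero, add_zero]
        exact Ideal.subset_span ⟨i, hi, rfl⟩
      exact MvPolynomial.mem_ideal_span_X_image.mp (h3 h2)
    · intro β hβ
      obtain ⟨y, hy⟩ := D.exists_regular_lie (β := β) fun h0 => by
          have : 0 < (D.c β).re := hβ
          rw [h0] at this
          exact lt_irrefl _ this
      let d : Derivation ℂ (MvPolynomial I ℂ) (MvPolynomial I ℂ) :=
        MvPolynomial.mkDerivation ℂ fun i => τ (linPoly D.b ⁅y, D.b i⁆)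
      have hd : ∀ q, d (τ q) = τ (adDer D.b y q) := by
        intro q
        induction q using MvPolynomial.induction_on with
        | C c =>
          have : τ (MvPolynomial.C c) = MvPolynomial.C c := τ.commutes c
          rw [this, MvPolynomial.derivation_C, MvPolynomial.derivation_C, map_zero]
        | add p q hp hq => rw [map_add, map_add, map_add, map_add, hp, hq]
        | mul_X p i hp =>
          have h1 : d (τ (MvPolynomial.X i)) = τ (adDer D.b y (MvPolynomial.X i)) := by
            simp only [τ, MvPolynomial.aeval_X, map_add, MvPolynomial.derivation_C, add_zero, d, adDer,
              MvPolynomial.mkDerivation_X]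
          rw [map_mul, Derivation.leibniz, Derivation.leibniz, map_add, smul_eq_mul, smul_eq_mul,
            smul_eq_mul, smul_eq_mul, map_mul, map_mul, hp, h1]
      refine ⟨d, fun i => ?_, ?_⟩
      · rw [MvPolynomial.mkDerivation_X, hτlin, hy]
      · rintro _ ⟨q, n, w, rfl, hw, hq⟩
        refine ⟨adDer D.b y q, n, adU y w, (hd q).symm, fun v => ?_, ad_mem_symRel D.b y hq⟩
        rw [adU_apply, sub_mul, mul_assoc, mul_assoc]
        exact Ideal.sub_mem _ (Ideal.mul_mem_left _ _ (hw v)) (hw _)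
  obtain ⟨q, rfl⟩ := ordMap_surjective D.b u
  by_contra hne
  have hq : q ≠ 0 := fun h => hne (by rw [h, map_zero])
  apply MvPolynomial.homogeneousComponent_totalDegree_ne_zero hq
  have h := hQ _ ⟨_, _, _, rfl, hu, ordMap_mem_symRel D.b (le_refl q.totalDegree)⟩
  rw [← hττ (MvPolynomial.homogeneousComponent _ _), h, map_zero]

end TriangularData

end Triangular

section Triangular

attribute [local instance] LieRing.ofAssociativeRing

namespace TriangularData

variable {g : Type*} [LieRing g] [LieAlgebra ℂ g] {I N : Type*} [LinearOrder I] [Fintype N]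
  (D : TriangularData g I N)

/-- The indices of the basis of the Cartan subalgebra. -/
abbrev Cartan : Type _ := {i // D.c i = 0}

theorem commute_cartan (i j : D.Cartan) :
    Commute (UniversalEnvelopingAlgebra.ι ℂ (D.b i)) (UniversalEnvelopingAlgebra.ι ℂ (D.b j)) := by
  have h : ⁅D.b i, D.b j⁆ = 0 := by rw [D.lie_eq _ _ i.2, D.a_zero _ _ i.2 j.2, zero_smul]
  have h2 := LieHom.map_lie (UniversalEnvelopingAlgebra.ι ℂ) (D.b i) (D.b j)
  rw [h, map_zero, LieRing.of_associative_ring_bracket] at h2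
  exact (sub_eq_zero.mp h2.symm)

open scoped IsMulCommutative in
/-- The inclusion of the symmetric algebra of the Cartan subalgebra in the enveloping algebra. -/
noncomputable def cartanHom : MvPolynomial D.Cartan ℂ →ₐ[ℂ] UniversalEnvelopingAlgebra ℂ g := by
  let s : Set (UniversalEnvelopingAlgebra ℂ g) :=
    Set.range fun i : D.Cartan => UniversalEnvelopingAlgebra.ι ℂ (D.b i)
  have : IsMulCommutative (Algebra.adjoin ℂ s) := Algebra.isMulCommutative_adjoin ℂ (by
    rintro _ ⟨i, rfl⟩ _ ⟨j, rfl⟩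
    exact D.commute_cartan i j)
  exact (Algebra.adjoin ℂ s).val.comp
    (MvPolynomial.aeval fun i => ⟨UniversalEnvelopingAlgebra.ι ℂ (D.b i),
      Algebra.subset_adjoin ⟨i, rfl⟩⟩)

@[simp] theorem cartanHom_X (i : D.Cartan) :
    D.cartanHom (MvPolynomial.X i) = UniversalEnvelopingAlgebra.ι ℂ (D.b i) := by
  simp [cartanHom]

theorem cartanHom_eq (t : MvPolynomial D.Cartan ℂ) :
    D.cartanHom t = ordMap D.b (MvPolynomial.rename Subtype.val t) := by
  have : D.cartanHom.toLinearMap =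
      ordMap D.b ∘ₗ (MvPolynomial.rename (R := ℂ) (Subtype.val : D.Cartan → I)).toLinearMap := by
    apply (MvPolynomial.basisMonomials D.Cartan ℂ).ext
    intro s
    rw [MvPolynomial.coe_basisMonomials]
    beta_reduce
    obtain ⟨l, hl, rfl⟩ : ∃ l : List D.Cartan, l.Pairwise (· ≤ ·) ∧ exponents l = s :=
      ⟨(Finsupp.toMultiset s).sort, Multiset.pairwise_sort _ _, by simp [exponents]⟩
    have h1 : (l.map (Subtype.val : D.Cartan → I)).Pairwise (· ≤ ·) := by
      rw [List.pairwise_map]; exact hl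
    have h2 := ordMon_exponents_of_pairwise D.b h1
    rw [LinearMap.comp_apply, ← prod_X_eq_monomial, AlgHom.toLinearMap_apply,
      AlgHom.toLinearMap_apply, map_list_prod, map_list_prod, List.map_map, List.map_map]
    have h3 : (MvPolynomial.rename (R := ℂ) (Subtype.val : D.Cartan → I) : _ → _) ∘ MvPolynomial.X =
        MvPolynomial.X ∘ Subtype.val := by
      funext i; simp
    rw [h3, ← List.map_map (g := MvPolynomial.X) (f := Subtype.val), prod_X_eq_monomial,
      ordMap_monomial, one_smul, h2, word, List.map_map,
      List.map_map]
    congr 1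
    apply List.map_congr_left
    intro i _
    simp
  exact DFunLike.congr_fun this t

theorem eq_zero_of_cartanHom_mem_nplus [Finite I] {t : MvPolynomial D.Cartan ℂ}
    (ht : D.cartanHom t ∈ D.nplus) : t = 0 := by
  obtain ⟨q, hq, hs⟩ := D.exists_of_mem_nplus ht
  rw [cartanHom_eq] at hq
  have hq' := D.ordMap_injective hq
  subst hq'
  by_contra hne
  obtain ⟨s, hs'⟩ := MvPolynomial.support_nonempty.mpr hne
  rw [MvPolynomial.mem_support_iff, ← MvPolynomial.coeff_rename_mapDomain _ Subtype.val_injective] at hs'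
  obtain ⟨i, hi, hip⟩ := hs _ (MvPolynomial.mem_support_iff.mpr hs')
  have := Finsupp.mapDomain_support hi
  obtain ⟨j, -, rfl⟩ := Finset.mem_image.mp this
  have h : 0 < (D.c j).re := hip
  rw [j.2] at h
  exact lt_irrefl _ h

theorem mul_cartanHom_mem_nplus {u : UniversalEnvelopingAlgebra ℂ g} (hu : u ∈ D.nplus)
    (t : MvPolynomial D.Cartan ℂ) : u * D.cartanHom t ∈ D.nplus := by
  induction t using MvPolynomial.induction_on generalizing u with
  | C c =>
    have : D.cartanHom (MvPolynomial.C c) = algebraMap ℂ _ c := D.cartanHom.commutes c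
    rw [this, ← Algebra.commutes]
    exact Ideal.mul_mem_left _ _ hu
  | add p q hp hq => rw [map_add, mul_add]; exact Ideal.add_mem _ (hp hu) (hq hu)
  | mul_X p i hp =>
    rw [map_mul, ← mul_assoc]
    have := hp hu
    generalize u * D.cartanHom p = v at this
    rw [cartanHom_X]
    induction this using Submodule.span_induction with
    | mem x hx =>
      obtain ⟨j, hj, rfl⟩ := hx
      have h2 := adU_ι (D.b i) (D.b j)
      rw [D.lie_eq _ _ i.2, adU_apply, map_smul, sub_eq_iff_eq_add, ← sub_eq_iff_eq_add'] at h2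
      rw [← h2]
      exact Ideal.sub_mem _ (Ideal.mul_mem_left _ _ (D.ι_mem_nplus hj))
        (D.smul_mem_nplus _ (D.ι_mem_nplus hj))
    | zero => simp
    | add x y _ _ hx hy => rw [add_mul]; exact Ideal.add_mem _ hx hy
    | smul a x _ hx => rw [smul_eq_mul, mul_assoc]; exact Ideal.mul_mem_left _ _ hx

theorem adU_ordMon (s : I →₀ ℕ) :
    adU D.h (ordMon D.b s) = (((Finsupp.toMultiset s).map D.c).sum) • ordMon D.b s := by
  have h : ∀ l : List I, adU D.h (word (l.map D.b)) = ((l.map D.c).sum) • word (l.map D.b) := by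
    intro l
    induction l with
    | nil => simp [word, adU_apply]
    | cons i l ih =>
      rw [List.map_cons, word_cons, adU_mul, ih, adU_ι, D.lie_h, List.map_cons, List.sum_cons,
        map_smul, add_smul, smul_mul_assoc, mul_smul_comm]
  have h2 := h (Finsupp.toMultiset s).sort
  rw [ordMon, h2]
  congr 1
  conv_rhs => rw [← Multiset.sort_eq (Finsupp.toMultiset s) (· ≤ ·)]
  rw [Multiset.map_coe, Multiset.sum_coe]

theorem sub_cartanHom_mem_nplus [Finite I] {q : MvPolynomial I ℂ}
    (hq : ordMap D.b q ∈ Subalgebra.center ℂ (UniversalEnvelopingAlgebra ℂ g)) :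
    ordMap D.b q - D.cartanHom (MvPolynomial.killCompl Subtype.val_injective q) ∈ D.nplus := by
  have hw : ∀ s ∈ q.support, ((Finsupp.toMultiset s).map D.c).sum = 0 := by
    intro s hs
    have h1 : adU D.h (ordMap D.b q) = 0 := by
      rw [adU_apply, sub_eq_zero]
      exact (Subalgebra.mem_center_iff.mp hq _)
    let wt : MvPolynomial I ℂ →ₗ[ℂ] MvPolynomial I ℂ :=
      (MvPolynomial.basisMonomials I ℂ).constr ℂ fun s =>
        ((Finsupp.toMultiset s).map D.c).sum • MvPolynomial.monomial s 1
    have h2 : adU D.h ∘ₗ ordMap D.b = ordMap D.b ∘ₗ wt := by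
      apply (MvPolynomial.basisMonomials I ℂ).ext
      intro s
      rw [LinearMap.comp_apply, LinearMap.comp_apply, Module.Basis.constr_basis,
        MvPolynomial.coe_basisMonomials, map_smul, ordMap_monomial, one_smul, adU_ordMon]
    have h3 : wt q = 0 := by
      apply D.ordMap_injective
      rw [map_zero, ← h1]
      exact (DFunLike.congr_fun h2 q).symm
    have h4 : ∀ p, (wt p).coeff s = ((Finsupp.toMultiset s).map D.c).sum * p.coeff s := by
      intro p
      have : MvPolynomial.lcoeff ℂ s ∘ₗ wt =
          ((Finsupp.toMultiset s).map D.c).sum • MvPolynomial.lcoeff ℂ s := by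
        apply (MvPolynomial.basisMonomials I ℂ).ext
        intro s'
        rw [LinearMap.comp_apply, Module.Basis.constr_basis, MvPolynomial.coe_basisMonomials]
        by_cases h : s' = s
        · subst h; simp
        · simp [MvPolynomial.coeff_monomial, h]
      exact DFunLike.congr_fun this p
    have h5 := h4 q
    rw [h3, MvPolynomial.coeff_zero] at h5
    exact (mul_eq_zero.mp h5.symm).resolve_right (MvPolynomial.mem_support_iff.mp hs)
  rw [q.as_sum, map_sum, map_sum, map_sum, ← Finset.sum_sub_distrib]
  refine Ideal.sum_mem _ fun s hs => ?_
  by_cases hsub : (s.support : Set I) ⊆ Set.range (Subtype.val : D.Cartan → I)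
  · rw [MvPolynomial.killCompl_monomial_eq_monomial_comapDomain_of_subset _ _ hsub, cartanHom_eq,
      MvPolynomial.rename_monomial, Finsupp.mapDomain_comapDomain _ Subtype.val_injective _ hsub,
      sub_self]
    exact Ideal.zero_mem _
  · rw [MvPolynomial.killCompl_monomial_eq_zero_of_not_subset _ _ hsub, map_zero, sub_zero,
      ordMap_monomial]
    refine D.smul_mem_nplus _ (D.ordMon_mem_nplus ?_)
    by_contra hcon
    push Not at hcon
    obtain ⟨i, hi, hi'⟩ := Set.not_subset.mp hsub
    have hci : D.c i ≠ 0 := fun h => hi' ⟨⟨i, h⟩, rfl⟩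
    have h0 := congrArg Complex.re (hw s hs)
    have hre : (((Finsupp.toMultiset s).map D.c).sum).re =
        ((Finsupp.toMultiset s).map fun i => (D.c i).re).sum := by
      rw [← Complex.reLm_coe, map_multiset_sum, Multiset.map_map]
      rfl
    rw [hre] at h0
    have hle : ∀ j ∈ Finsupp.toMultiset s, (D.c j).re ≤ 0 := fun j hj =>
      not_lt.mp (hcon j ((Finsupp.mem_toMultiset _ _).mp hj))
    have hmem : i ∈ Finsupp.toMultiset s := (Finsupp.mem_toMultiset _ _).mpr hi
    obtain ⟨r, hr⟩ := Multiset.exists_cons_of_mem hmem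
    rw [hr, Multiset.map_cons, Multiset.sum_cons] at h0
    have h6 : (r.map fun i => (D.c i).re).sum ≤ 0 := by
      refine (Multiset.sum_le_card_nsmul _ 0 fun x hx => ?_).trans_eq (smul_zero _)
      obtain ⟨j, hj, rfl⟩ := Multiset.mem_map.mp hx
      exact hle j (by rw [hr]; exact Multiset.mem_cons_of_mem hj)
    have h7 : (D.c i).re < 0 := lt_of_le_of_ne (hle i hmem) (D.re_ne i hci)
    simp only [Complex.zero_re] at h0
    linarith

theorem exists_sub_cartanHom_mem_nplus [Finite I]
    (z : Subalgebra.center ℂ (UniversalEnvelopingAlgebra ℂ g)) :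
    ∃ t, (z : UniversalEnvelopingAlgebra ℂ g) - D.cartanHom t ∈ D.nplus := by
  obtain ⟨q, hq⟩ := ordMap_surjective D.b (z : UniversalEnvelopingAlgebra ℂ g)
  have h := z.2
  rw [← hq] at h ⊢
  exact ⟨_, D.sub_cartanHom_mem_nplus h⟩

theorem eq_of_sub_cartanHom_mem_nplus [Finite I] {u : UniversalEnvelopingAlgebra ℂ g}
    {t t' : MvPolynomial D.Cartan ℂ} (h : u - D.cartanHom t ∈ D.nplus)
    (h' : u - D.cartanHom t' ∈ D.nplus) : t = t' := by
  rw [← sub_eq_zero]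
  apply D.eq_zero_of_cartanHom_mem_nplus
  rw [map_sub]
  simpa using Ideal.sub_mem _ h' h

/-- The Harish-Chandra projection of the center of the enveloping algebra. -/
noncomputable def hc [Finite I] :
    Subalgebra.center ℂ (UniversalEnvelopingAlgebra ℂ g) →ₐ[ℂ] MvPolynomial D.Cartan ℂ :=
  let f := fun z => Classical.choose (D.exists_sub_cartanHom_mem_nplus z)
  have hf : ∀ z : Subalgebra.center ℂ (UniversalEnvelopingAlgebra ℂ g),
      (z : UniversalEnvelopingAlgebra ℂ g) - D.cartanHom (f z) ∈ D.nplus :=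
    fun z => Classical.choose_spec (D.exists_sub_cartanHom_mem_nplus z)
  AlgHom.ofLinearMap
    { toFun := f
      map_add' := fun x y => D.eq_of_sub_cartanHom_mem_nplus (hf _) (by
        rw [map_add, AddMemClass.coe_add, add_sub_add_comm]
        exact Ideal.add_mem _ (hf x) (hf y))
      map_smul' := fun c x => D.eq_of_sub_cartanHom_mem_nplus (hf _) (by
        rw [map_smul, RingHom.id_apply]
        change c • (x : UniversalEnvelopingAlgebra ℂ g) - _ ∈ _
        rw [← smul_sub]
        exact D.smul_mem_nplus _ (hf x)) }
    (D.eq_of_sub_cartanHom_mem_nplus (hf _) (by simp))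
    (fun x y => D.eq_of_sub_cartanHom_mem_nplus (hf _) (by
      have h1 := Ideal.mul_mem_left _ (x : UniversalEnvelopingAlgebra ℂ g) (hf y)
      have h2 := D.mul_cartanHom_mem_nplus (hf x) (f y)
      have h3 := Ideal.add_mem _ h1 h2
      change (x : UniversalEnvelopingAlgebra ℂ g) * y - D.cartanHom (f x * f y) ∈ _
      rw [map_mul]
      convert h3 using 1
      noncomm_ring))

theorem sub_hc_mem_nplus [Finite I] (z : Subalgebra.center ℂ (UniversalEnvelopingAlgebra ℂ g)) :
    (z : UniversalEnvelopingAlgebra ℂ g) - D.cartanHom (D.hc z) ∈ D.nplus :=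
  Classical.choose_spec (D.exists_sub_cartanHom_mem_nplus z)

theorem hc_injective [Finite I] : Function.Injective D.hc := by
  rw [injective_iff_map_eq_zero]
  intro z hz
  have h := D.sub_hc_mem_nplus z
  rw [hz, map_zero, sub_zero] at h
  apply Subtype.ext
  refine D.eq_zero_of_forall_mul_mem_nplus fun w => ?_
  rw [← Subalgebra.mem_center_iff.mp z.2 w]
  exact Ideal.mul_mem_left _ _ h

/-- The symbol of a central element determines the leading term of its projection. -/
theorem hc_of_mem_symRel [Finite I] {z : Subalgebra.center ℂ (UniversalEnvelopingAlgebra ℂ g)}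
    {n : ℕ} {p : MvPolynomial I ℂ} (hp : ((z : UniversalEnvelopingAlgebra ℂ g), p) ∈ symRel D.b n) :
    (D.hc z).totalDegree ≤ n ∧ MvPolynomial.homogeneousComponent n (D.hc z) =
      MvPolynomial.killCompl (Subtype.val_injective : Function.Injective (Subtype.val : D.Cartan → I)) p := by
  obtain ⟨q, hq⟩ := ordMap_surjective D.b (z : UniversalEnvelopingAlgebra ℂ g)
  have h := z.2
  rw [← hq] at h hp
  obtain ⟨h1, h2⟩ := totalDegree_le_and_homogeneousComponent_eq D.b D.ordMap_injective hp
  have h3 := D.sub_cartanHom_mem_nplus h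
  rw [hq] at h3
  have h4 := D.eq_of_sub_cartanHom_mem_nplus (D.sub_hc_mem_nplus z) h3
  rw [h4, ← h2]
  constructor
  · refine Finset.sup_le fun s hs => ?_
    rw [MvPolynomial.mem_support_iff, MvPolynomial.coeff_killCompl,
      ← MvPolynomial.mem_support_iff] at hs
    have h5 : (Finsupp.mapDomain Subtype.val s).degree ≤ n :=
      (MvPolynomial.le_totalDegree hs).trans h1
    rwa [Finsupp.degree_mapDomain] at h5
  · ext s
    rw [MvPolynomial.coeff_homogeneousComponent, MvPolynomial.coeff_killCompl,
      MvPolynomial.coeff_killCompl, MvPolynomial.coeff_homogeneousComponent, Finsupp.degree_mapDomain]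

end TriangularData

end Triangular

section FiniteOfPowerSums

variable {σ τ k : Type*} [Field k]

variable (σ k) in
/-- Polynomials of degree less than `n`. -/
noncomputable def degLT (n : ℕ) : Submodule k (MvPolynomial σ k) :=
  MvPolynomial.restrictSupport k {s | s.degree < n}

theorem mem_degLT {n : ℕ} {p : MvPolynomial σ k} :
    p ∈ degLT σ k n ↔ ∀ s ∈ p.support, s.degree < n := Iff.rfl

theorem degLT_mono {n m : ℕ} (h : n ≤ m) : degLT σ k n ≤ degLT σ k m :=
  fun _ hp => mem_degLT.mpr fun s hs => (mem_degLT.mp hp s hs).trans_le h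

theorem mul_mem_degLT {n m : ℕ} {p q : MvPolynomial σ k} (hp : p ∈ degLT σ k (n + 1))
    (hq : q ∈ degLT σ k m) : p * q ∈ degLT σ k (n + m) := by
  classical
  have := Submodule.mul_mem_mul hp hq
  rw [degLT, degLT, ← MvPolynomial.restrictSupport_add] at this
  refine MvPolynomial.restrictSupport_mono k ?_ this
  rintro _ ⟨s, hs, t, ht, rfl⟩
  simp only [Set.mem_ofPred_eq, map_add] at *
  omega

theorem one_mem_degLT : (1 : MvPolynomial σ k) ∈ degLT σ k 1 := by
  classical
  rw [mem_degLT]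
  intro s hs
  have : s = 0 := by
    by_contra h
    exact MvPolynomial.mem_support_iff.mp hs (by rw [MvPolynomial.coeff_one, if_neg (Ne.symm h)])
  simp [this]

theorem pow_mem_degLT {p : MvPolynomial σ k} (hp : p ∈ degLT σ k 2) (n : ℕ) :
    p ^ n ∈ degLT σ k (n + 1) := by
  induction n with
  | zero => rw [pow_zero]; exact one_mem_degLT
  | succ n ih =>
    rw [pow_succ', add_comm n 1, add_assoc]
    exact mul_mem_degLT hp ih

theorem aeval_monomial_mem_degLT {L : τ → MvPolynomial σ k} (hL : ∀ j, L j ∈ degLT σ k 2)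
    (s : τ →₀ ℕ) : MvPolynomial.aeval L (MvPolynomial.monomial s (1 : k)) ∈
      degLT σ k (s.degree + 1) := by
  induction s using Finsupp.induction_linear with
  | zero => simpa using one_mem_degLT
  | add f g hf hg =>
    have h : MvPolynomial.monomial (f + g) (1 : k) =
      MvPolynomial.monomial f 1 * MvPolynomial.monomial g 1 := by
      rw [MvPolynomial.monomial_mul, one_mul]
    rw [h, map_mul, map_add, add_assoc]
    exact mul_mem_degLT hf hg
  | single i n =>
    rw [MvPolynomial.aeval_monomial, Finsupp.degree_single]
    simpa using pow_mem_degLT (hL i) n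

theorem aeval_mem_degLT {L : τ → MvPolynomial σ k} (hL : ∀ j, L j ∈ degLT σ k 2)
    {n : ℕ} {p : MvPolynomial τ k} (hp : p ∈ degLT τ k n) :
    MvPolynomial.aeval L p ∈ degLT σ k n := by
  rw [p.as_sum, map_sum]
  refine Submodule.sum_mem _ fun s hs => ?_
  have : MvPolynomial.monomial s (p.coeff s) = p.coeff s • MvPolynomial.monomial s (1 : k) := by
    rw [MvPolynomial.smul_monomial, smul_eq_mul, mul_one]
  rw [this, map_smul]
  exact Submodule.smul_mem _ _ (degLT_mono (mem_degLT.mp hp s hs) (aeval_monomial_mem_degLT hL s))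

theorem sub_mem_degLT_of_homogeneousComponent_eq {n : ℕ} {p q : MvPolynomial σ k}
    (hp : p.IsHomogeneous n) (hq : q.totalDegree ≤ n)
    (h : MvPolynomial.homogeneousComponent n q = p) : p - q ∈ degLT σ k n := by
  classical
  rw [mem_degLT]
  intro s hs
  rw [MvPolynomial.mem_support_iff, MvPolynomial.coeff_sub] at hs
  by_contra hcon
  apply hs
  rcases (not_lt.mp hcon).eq_or_lt with h1 | h1
  · rw [← h, MvPolynomial.coeff_homogeneousComponent, if_pos h1.symm, sub_self]
  · rw [hp.coeff_eq_zero (ne_of_gt h1), zero_sub, neg_eq_zero]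
    by_contra h2
    have h3 : s.degree ≤ _ := MvPolynomial.le_totalDegree (MvPolynomial.mem_support_iff.mpr h2)
    omega

variable {N Z : Type*} [Fintype N] [CommRing Z] [Algebra k Z]

/-- The class of `f` modulo polynomials of degree less than `n` is that of an element of the
subalgebra `γ`. -/
def IsLeading (γ : Z →ₐ[k] MvPolynomial σ k) (n : ℕ) (f : MvPolynomial σ k) : Prop :=
  f ∈ degLT σ k (n + 1) ∧ ∃ z, f - γ z ∈ degLT σ k n

section IsLeading

variable {γ : Z →ₐ[k] MvPolynomial σ k}

theorem IsLeading.mul {n m : ℕ} {f f' : MvPolynomial σ k} (h : IsLeading γ n f)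
    (h' : IsLeading γ m f') : IsLeading γ (n + m) (f * f') := by
  obtain ⟨h1, z, h2⟩ := h
  obtain ⟨h3, z', h4⟩ := h'
  refine ⟨by
    rw [add_assoc]
    exact mul_mem_degLT h1 h3, z * z', ?_⟩
  have h5 : γ z' ∈ degLT σ k (m + 1) := by
    have := Submodule.sub_mem _ h3 (degLT_mono (Nat.le_succ m) h4)
    rwa [sub_sub_cancel] at this
  have h6 : f * (f' - γ z') ∈ degLT σ k (n + m) :=
    mul_mem_degLT (n := n) (m := m) h1 h4
  have h8 : (f - γ z) * γ z' ∈ degLT σ k (n + m) := by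
    rw [mul_comm, add_comm n]
    exact mul_mem_degLT h5 h2
  have h7 : f * (f' - γ z') + (f - γ z) * γ z' = f * f' - γ (z * z') := by
    rw [map_mul]; ring
  rw [← h7]
  exact Submodule.add_mem _ h6 h8

theorem IsLeading.smul {n : ℕ} (c : k) {f : MvPolynomial σ k} (h : IsLeading γ n f) :
    IsLeading γ n (c • f) := by
  obtain ⟨h1, z, h2⟩ := h
  refine ⟨Submodule.smul_mem _ _ h1, c • z, ?_⟩
  rw [map_smul, ← smul_sub]
  exact Submodule.smul_mem _ _ h2

theorem IsLeading.sum {α : Type*} {n : ℕ} (s : Finset α) {f : α → MvPolynomial σ k}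
    (h : ∀ a ∈ s, IsLeading γ n (f a)) : IsLeading γ n (∑ a ∈ s, f a) := by
  choose! h1 z hz using h
  refine ⟨Submodule.sum_mem _ h1, ∑ a ∈ s, z a, ?_⟩
  rw [map_sum, ← Finset.sum_sub_distrib]
  exact Submodule.sum_mem _ hz

theorem IsLeading.aeval_esymm [CharZero k] {t : N → MvPolynomial σ k}
    (hp : ∀ n, IsLeading γ n (∑ ν, t ν ^ n)) (n : ℕ) :
    IsLeading γ n (MvPolynomial.aeval t (MvPolynomial.esymm N k n)) := by
  classical
  induction n using Nat.strong_induction_on with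
  | _ n ih =>
  rcases Nat.eq_zero_or_pos n with rfl | hn
  · simp only [MvPolynomial.esymm_zero, map_one]
    exact ⟨one_mem_degLT, 1, by simp⟩
  · have h1 := congrArg (MvPolynomial.aeval t) (MvPolynomial.mul_esymm_eq_sum N k n)
    have hn0 : (n : k) ≠ 0 := Nat.cast_ne_zero.mpr hn.ne'
    have h2 : MvPolynomial.aeval t (MvPolynomial.esymm N k n) = ((n : k)⁻¹ * (-1) ^ (n + 1)) •
        ∑ a ∈ Finset.HasAntidiagonal.antidiagonal n with a.1 < n, ((-1 : k) ^ a.1) •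
          (MvPolynomial.aeval t (MvPolynomial.esymm N k a.1) * ∑ ν, t ν ^ a.2) := by
      rw [mul_smul, eq_inv_smul_iff₀ hn0]
      simp only [map_mul, map_natCast, map_pow, map_neg, map_one, map_sum] at h1
      simp only [Algebra.smul_def, map_pow, map_neg, map_one, map_natCast]
      rw [h1]
      congr 1
      refine Finset.sum_congr rfl fun a _ => ?_
      simp [MvPolynomial.psum, mul_assoc]
    rw [h2]
    refine (IsLeading.sum _ fun a ha => IsLeading.smul _ ?_).smul _
    obtain ⟨ha1, ha2⟩ := Finset.mem_filter.mp ha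
    rw [← Finset.HasAntidiagonal.mem_antidiagonal.mp ha1]
    exact (ih _ ha2).mul (hp _)

end IsLeading

theorem pow_card_eq_sum_esymm (t : N → MvPolynomial σ k) (μ : N) :
    t μ ^ Fintype.card N = -(-1) ^ Fintype.card N * ∑ j ∈ Finset.range (Fintype.card N),
      MvPolynomial.aeval t (MvPolynomial.esymm N k (j + 1)) *
        (-t μ) ^ (Fintype.card N - (j + 1)) := by
  classical
  have h1 := congrArg (Polynomial.eval (-MvPolynomial.X μ))
    (MvPolynomial.prod_C_add_X_eq_sum_esymm k N)
  rw [Polynomial.eval_prod, Finset.prod_eq_zero (Finset.mem_univ μ) (by simp),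
    Polynomial.eval_finsetSum] at h1
  have h2 := congrArg (MvPolynomial.aeval t) h1
  simp only [map_zero, Polynomial.eval_mul, Polynomial.eval_C, Polynomial.eval_pow,
    Polynomial.eval_X, map_sum, map_mul, map_pow, map_neg, MvPolynomial.aeval_X] at h2
  rw [Finset.sum_range_succ'] at h2
  simp only [MvPolynomial.esymm_zero, map_one, one_mul, Nat.sub_zero] at h2
  have h3 : t μ ^ Fintype.card N = (-1) ^ Fintype.card N * (-t μ) ^ Fintype.card N := by
    rw [← mul_pow, neg_mul_neg, one_mul]
  rw [h3, neg_mul, ← mul_neg]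
  congr 1
  exact eq_neg_of_add_eq_zero_right h2.symm

theorem mem_of_forall_aeval_monomial_mem {t : N → MvPolynomial σ k} {r : σ → N → k}
    (hr : ∀ j, MvPolynomial.X j = ∑ ν, r j ν • t ν) {d : ℕ} {M : Submodule k (MvPolynomial σ k)}
    (hM : ∀ a : N →₀ ℕ, a.degree < d → MvPolynomial.aeval t (MvPolynomial.monomial a (1 : k)) ∈ M) :
    degLT σ k d ≤ M := by
  intro f hf
  let L : σ → MvPolynomial N k := fun j => ∑ ν, r j ν • MvPolynomial.X ν
  have hL : ∀ j, L j ∈ degLT N k 2 := by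
    intro j
    refine Submodule.sum_mem _ fun ν _ => Submodule.smul_mem _ _ ?_
    rw [mem_degLT]
    intro s hs
    rw [Finset.mem_singleton.mp (MvPolynomial.support_monomial_subset hs)]
    simp
  have h1 : MvPolynomial.aeval t (MvPolynomial.aeval L f) = f := by
    have : (MvPolynomial.aeval t).comp (MvPolynomial.aeval L) = AlgHom.id k _ := by
      apply MvPolynomial.algHom_ext
      intro j
      rw [AlgHom.comp_apply, MvPolynomial.aeval_X, AlgHom.id_apply, hr j, map_sum]
      simp only [map_smul, MvPolynomial.aeval_X]
    exact DFunLike.congr_fun this f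
  have h2 := aeval_mem_degLT hL hf
  rw [← h1]
  generalize MvPolynomial.aeval L f = g at h2
  rw [g.as_sum, map_sum]
  refine M.sum_mem fun s hs => ?_
  have : MvPolynomial.monomial s (g.coeff s) = g.coeff s • MvPolynomial.monomial s (1 : k) := by
    rw [MvPolynomial.smul_monomial, smul_eq_mul, mul_one]
  rw [this, map_smul]
  exact M.smul_mem _ (hM s (mem_degLT.mp h2 s hs))

/-- A subalgebra of a polynomial algebra is cofinite if its leading terms include the power sums of
a family of linear forms spanning the space of all linear forms. -/
theorem finite_of_powerSums [CharZero k] (γ : Z →ₐ[k] MvPolynomial σ k)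
    (t : N → MvPolynomial σ k) (ht : ∀ ν, (t ν).IsHomogeneous 1) (r : σ → N → k)
    (hr : ∀ j, MvPolynomial.X j = ∑ ν, r j ν • t ν)
    (hz : ∀ n, ∃ z, (γ z).totalDegree ≤ n ∧
      MvPolynomial.homogeneousComponent n (γ z) = ∑ ν, t ν ^ n) :
    (γ : Z →+* MvPolynomial σ k).Finite := by
  classical
  have ht2 : ∀ ν, t ν ∈ degLT σ k 2 := by
    intro ν
    rw [mem_degLT]
    intro s hs
    have h : s.degree = 1 := by
      by_contra h
      exact MvPolynomial.mem_support_iff.mp hs ((ht ν).coeff_eq_zero h)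
    omega
  have hGp : ∀ n, IsLeading γ n (∑ ν, t ν ^ n) := by
    intro n
    refine ⟨Submodule.sum_mem _ fun ν _ => pow_mem_degLT (ht2 ν) n, ?_⟩
    obtain ⟨z, h1, h2⟩ := hz n
    refine ⟨z, sub_mem_degLT_of_homogeneousComponent_eq ?_ h1 h2⟩
    refine MvPolynomial.IsHomogeneous.sum _ _ _ fun ν _ => ?_
    simpa using (ht ν).pow n
  have hGe := IsLeading.aeval_esymm hGp
  have hchar := pow_card_eq_sum_esymm t
  generalize Fintype.card N = n at hchar
  generalize he : (fun j => MvPolynomial.aeval t (MvPolynomial.esymm N k j)) = e at *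
  replace he : ∀ j, MvPolynomial.aeval t (MvPolynomial.esymm N k j) = e j := congrFun he
  simp only [he] at hGe hchar
  obtain ⟨T, hTdef⟩ : ∃ T : (N →₀ ℕ) → MvPolynomial σ k,
    ∀ a, T a = MvPolynomial.aeval t (MvPolynomial.monomial a (1 : k)) := ⟨_, fun _ => rfl⟩
  have hT : ∀ a, T a ∈ degLT σ k (a.degree + 1) := fun a => by
    rw [hTdef]; exact aeval_monomial_mem_degLT ht2 a
  have hTadd : ∀ a b, T (a + b) = T a * T b := by
    intro a b
    rw [hTdef, hTdef, hTdef, ← map_mul, MvPolynomial.monomial_mul, one_mul]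
  let algZ := (γ : Z →+* MvPolynomial σ k).toAlgebra
  let B : Set (MvPolynomial σ k) := T '' {a | ∀ ν, a ν < n}
  have hB : B.Finite := by
    refine Set.Finite.image _ ?_
    refine (Set.Finite.pi' (fun _ : N => Set.finite_lt_nat n)).preimage
      (f := fun a : N →₀ ℕ => (a : N → ℕ)) DFunLike.coe_injective.injOn
  let M := Submodule.span Z B
  have hγ : ∀ z f, f ∈ M → γ z * f ∈ M := fun z f hf => M.smul_mem z hf
  have hk : ∀ (c : k) f, f ∈ M → c • f ∈ M := by
    intro c f hf
    have := hγ (algebraMap k Z c) f hf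
    rwa [AlgHom.commutes, ← Algebra.smul_def] at this
  let M' : Submodule k (MvPolynomial σ k) :=
    { M.toAddSubmonoid with smul_mem' := fun c f hf => hk c f hf }
  have key : ∀ d, ∀ f ∈ degLT σ k d, f ∈ M := by
    intro d
    induction d with
    | zero =>
      intro f hf
      have : f = 0 := by
        rw [← MvPolynomial.support_eq_empty, Finset.eq_empty_iff_forall_notMem]
        intro s hs
        exact Nat.not_lt_zero _ (mem_degLT.mp hf s hs)
      rw [this]; exact M.zero_mem
    | succ d ih =>
      have hTM : ∀ a : N →₀ ℕ, a.degree ≤ d → T a ∈ M := by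
        intro a ha
        by_cases hlt : ∀ ν, a ν < n
        · exact Submodule.subset_span ⟨a, hlt, rfl⟩
        push Not at hlt
        obtain ⟨μ, hμ⟩ := hlt
        obtain ⟨a', rfl⟩ := exists_add_of_le (Finsupp.single_le_iff.mpr hμ)
        rw [map_add, Finsupp.degree_single] at ha
        have h1 : T (Finsupp.single μ n) = t μ ^ n := by
          rw [hTdef, MvPolynomial.aeval_monomial]; simp
        rw [hTadd, h1, hchar, mul_assoc, Finset.sum_mul]
        have hsgn : ∀ f ∈ M, -(-1) ^ n * f ∈ M := by
          intro f hf
          have := hk (-(-1) ^ n) f hf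
          rwa [Algebra.smul_def, map_neg, map_pow, map_neg, map_one] at this
        refine hsgn _ (M.sum_mem fun j hj => ?_)
        have hj' := Finset.mem_range.mp hj
        obtain ⟨-, z, hz⟩ := hGe (j + 1)
        have h2 : (-t μ) ^ (n - (j + 1)) * T a' ∈ degLT σ k (n - (j + 1) + (a'.degree + 1)) :=
          mul_mem_degLT (pow_mem_degLT (Submodule.neg_mem _ (ht2 μ)) _) (hT a')
        have h3 : e (j + 1) * (-t μ) ^ (n - (j + 1)) * T a' =
            γ z * ((-t μ) ^ (n - (j + 1)) * T a') +
              ((-t μ) ^ (n - (j + 1)) * T a') * (e (j + 1) - γ z) := by ring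
        have h4 : n - (j + 1) + (a'.degree + 1) ≤ d := by omega
        have h5 : (-t μ) ^ (n - (j + 1)) * T a' * (e (j + 1) - γ z) ∈
            degLT σ k (n - (j + 1) + a'.degree + (j + 1)) :=
          mul_mem_degLT (n := n - (j + 1) + a'.degree) h2 hz
        have h6 : n - (j + 1) + a'.degree + (j + 1) ≤ d := by omega
        rw [h3]
        exact M.add_mem (hγ _ _ (ih _ (degLT_mono h4 h2))) (ih _ (degLT_mono h6 h5))
      intro f hf
      refine mem_of_forall_aeval_monomial_mem (M := M') hr (fun a ha => ?_) hf
      rw [← hTdef]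
      exact hTM a (Nat.lt_succ_iff.mp ha)
  have htop : M = ⊤ := by
    rw [eq_top_iff]
    intro f _
    refine key (f.totalDegree + 1) f (mem_degLT.mpr fun s hs => ?_)
    exact Nat.lt_succ_iff.mpr (MvPolynomial.le_totalDegree hs)
  change Module.Finite Z (MvPolynomial σ k)
  exact ⟨htop ▸ Submodule.fg_span hB⟩

end FiniteOfPowerSums

section Triangular

attribute [local instance] LieRing.ofAssociativeRing

theorem mem_center_of_forall_adU_eq_zero {g : Type*} [LieRing g] [LieAlgebra ℂ g]
    {z : UniversalEnvelopingAlgebra ℂ g} (hz : ∀ y, adU y z = 0) :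
    z ∈ Subalgebra.center ℂ (UniversalEnvelopingAlgebra ℂ g) := by
  rw [Subalgebra.mem_center_iff]
  have h : ∀ y : g, UniversalEnvelopingAlgebra.ι ℂ y * z = z * UniversalEnvelopingAlgebra.ι ℂ y :=
    fun y => sub_eq_zero.mp (hz y)
  intro u
  have hu : u ∈ Submodule.span ℂ (Set.range (word (g := g))) := by rw [span_range_word]; trivial
  induction hu using Submodule.span_induction with
  | mem x hx =>
    obtain ⟨l, rfl⟩ := hx
    induction l with
    | nil => simp [word]
    | cons x l ih => rw [word_cons, mul_assoc, ih, ← mul_assoc, h, mul_assoc]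
  | zero => simp
  | add x y _ _ hx hy => rw [add_mul, mul_add, hx, hy]
  | smul c x _ hx => rw [smul_mul_assoc, mul_smul_comm, hx]

namespace TriangularData

variable {g : Type*} [LieRing g] [LieAlgebra ℂ g] {I N : Type*} [LinearOrder I] [Fintype N]
  (D : TriangularData g I N)

theorem sum_mem_symRel {α : Type*} (s : Finset α) {n : ℕ} {u : α → UniversalEnvelopingAlgebra ℂ g}
    {p : α → MvPolynomial I ℂ} (h : ∀ a ∈ s, (u a, p a) ∈ symRel D.b n) :
    (∑ a ∈ s, u a, ∑ a ∈ s, p a) ∈ symRel D.b n := by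
  rw [← Prod.fst_sum (f := fun a => (u a, p a)), ← Prod.snd_sum (f := fun a => (u a, p a))]
  exact Submodule.sum_mem _ h

section Casimir

variable [Fintype I]

theorem sum_traceForm_smul_dual (x : g) : ∑ i, D.traceForm x (D.b i) • D.dual i = x := by
  refine eq_of_sub_eq_zero (D.nondeg _ fun y => ?_)
  change D.traceForm _ y = 0
  have : D.traceForm (∑ i, D.traceForm x (D.b i) • D.dual i - x) = 0 := by
    apply D.b.ext
    intro j
    simp [traceForm_dual]
  rw [this, LinearMap.zero_apply]

theorem sum_traceForm_dual_smul (x : g) : ∑ i, D.traceForm (D.dual i) x • D.b i = x := by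
  refine eq_of_sub_eq_zero (D.nondeg _ fun y => ?_)
  change D.traceForm _ y = 0
  rw [traceForm_symm]
  have : D.traceForm.flip (∑ i, D.traceForm (D.dual i) x • D.b i - x) = 0 := by
    apply D.dual.ext
    intro j
    simp [traceForm_dual]
  exact DFunLike.congr_fun this y

theorem sum_lie_dual {M : Type*} [AddCommGroup M] [Module ℂ M] (B : g →ₗ[ℂ] g →ₗ[ℂ] M) (y : g) :
    ∑ i, B (D.b i) ⁅y, D.dual i⁆ = -∑ i, B ⁅y, D.b i⁆ (D.dual i) := by
  have h1 : ∀ i, B (D.b i) ⁅y, D.dual i⁆ =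
      ∑ j, D.traceForm ⁅y, D.dual i⁆ (D.b j) • B (D.b i) (D.dual j) := by
    intro i
    conv_lhs => rw [← D.sum_traceForm_smul_dual ⁅y, D.dual i⁆]
    simp only [map_sum, map_smul]
  have h2 : ∀ j, B ⁅y, D.b j⁆ (D.dual j) =
      ∑ i, D.traceForm (D.dual i) ⁅y, D.b j⁆ • B (D.b i) (D.dual j) := by
    intro j
    conv_lhs => rw [← D.sum_traceForm_dual_smul ⁅y, D.b j⁆]
    simp only [map_sum, map_smul, LinearMap.sum_apply, LinearMap.smul_apply]
  rw [Finset.sum_congr rfl fun i _ => h1 i, Finset.sum_congr rfl fun i _ => h2 i,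
    Finset.sum_comm, ← Finset.sum_neg_distrib]
  refine Finset.sum_congr rfl fun j _ => ?_
  rw [← Finset.sum_neg_distrib]
  refine Finset.sum_congr rfl fun i _ => ?_
  rw [← lie_skew, map_neg, LinearMap.neg_apply, traceForm_lie, neg_smul]

/-- The matrix of the linear map dual to `D.ρ`, with values in a `ℂ`-module. -/
noncomputable def casimirMatrix {M : Type*} [AddCommGroup M] [Module ℂ M] (f : g →ₗ[ℂ] M) :
    Matrix N N M :=
  Matrix.of fun ν ν' => ∑ i, D.ρ (D.b i) ν ν' • f (D.dual i)

theorem casimirMatrix_apply {M : Type*} [AddCommGroup M] [Module ℂ M] (f : g →ₗ[ℂ] M) (ν ν' : N) :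
    D.casimirMatrix f ν ν' = ∑ i, D.ρ (D.b i) ν ν' • f (D.dual i) := rfl

/-- The canonical map of a Lie algebra to its enveloping algebra as a linear map. -/
noncomputable abbrev _root_.ιLin : g →ₗ[ℂ] UniversalEnvelopingAlgebra ℂ g :=
  ((UniversalEnvelopingAlgebra.ι ℂ : g →ₗ⁅ℂ⁆ UniversalEnvelopingAlgebra ℂ g) :
    g →ₗ[ℂ] UniversalEnvelopingAlgebra ℂ g)

theorem casimirMatrix_map_adU (y : g) :
    (D.casimirMatrix ιLin).map (adU y) =
      D.casimirMatrix ιLin * (D.ρ y).map (algebraMap ℂ (UniversalEnvelopingAlgebra ℂ g)) -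
      (D.ρ y).map (algebraMap ℂ (UniversalEnvelopingAlgebra ℂ g)) * D.casimirMatrix ιLin := by
  ext ν ν'
  let B : g →ₗ[ℂ] g →ₗ[ℂ] UniversalEnvelopingAlgebra ℂ g :=
    LinearMap.mk₂ ℂ (fun x x' => D.ρ x ν ν' • UniversalEnvelopingAlgebra.ι ℂ x')
      (by intros; simp [add_smul]) (by intros; simp [mul_smul])
      (by intros; simp) (fun c x x' => by rw [map_smul, smul_comm])
  have h := D.sum_lie_dual B y
  simp only [B, LinearMap.mk₂_apply, D.ρ_lie, Matrix.sub_apply, Matrix.mul_apply, sub_smul,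
    Finset.sum_smul, Finset.sum_sub_distrib, neg_sub] at h
  rw [Matrix.map_apply, Matrix.sub_apply, casimirMatrix_apply, map_sum]
  simp only [map_smul, LieHom.coe_toLinearMap, adU_ι, h, Matrix.mul_apply, casimirMatrix_apply,
    Matrix.map_apply]
  congr 1
  · rw [Finset.sum_comm]
    refine Finset.sum_congr rfl fun μ _ => ?_
    rw [← Algebra.commutes, ← Algebra.smul_def, Finset.smul_sum]
    exact Finset.sum_congr rfl fun i _ => by rw [smul_smul, mul_comm]
  · rw [Finset.sum_comm]
    refine Finset.sum_congr rfl fun μ _ => ?_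
    rw [← Algebra.smul_def, Finset.smul_sum]
    exact Finset.sum_congr rfl fun i _ => by rw [smul_smul]

variable [DecidableEq N]

theorem casimirMatrix_pow_map_adU (y : g) (n : ℕ) :
    (D.casimirMatrix ιLin ^ n).map (adU y) =
      D.casimirMatrix ιLin ^ n * (D.ρ y).map (algebraMap ℂ (UniversalEnvelopingAlgebra ℂ g)) -
      (D.ρ y).map (algebraMap ℂ (UniversalEnvelopingAlgebra ℂ g)) *
        D.casimirMatrix ιLin ^ n := by
  induction n with
  | zero =>
    ext ν ν'
    by_cases h : ν = ν' <;> simp [adU_apply, h]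
  | succ n ih =>
    have hmul : ∀ X Y : Matrix N N (UniversalEnvelopingAlgebra ℂ g),
        (X * Y).map (adU y) = X.map (adU y) * Y + X * Y.map (adU y) := by
      intro X Y
      ext ν ν'
      simp only [Matrix.map_apply, Matrix.mul_apply, Matrix.add_apply, map_sum, adU_mul,
        Finset.sum_add_distrib]
    rw [pow_succ, hmul, ih, casimirMatrix_map_adU]
    noncomm_ring

theorem trace_casimirMatrix_pow_mem_center (n : ℕ) :
    (D.casimirMatrix ιLin ^ n).trace ∈
      Subalgebra.center ℂ (UniversalEnvelopingAlgebra ℂ g) := by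
  refine mem_center_of_forall_adU_eq_zero fun y => ?_
  have h1 : adU y (D.casimirMatrix ιLin ^ n).trace =
      ((D.casimirMatrix ιLin ^ n).map (adU y)).trace := by
    simp [Matrix.trace, map_sum]
  rw [h1, casimirMatrix_pow_map_adU, Matrix.trace_sub, sub_eq_zero]
  simp only [Matrix.trace, Matrix.diag_apply, Matrix.mul_apply, Matrix.map_apply]
  rw [Finset.sum_comm]
  refine Finset.sum_congr rfl fun ν _ => Finset.sum_congr rfl fun ν' _ => ?_
  rw [Algebra.commutes]

theorem casimirMatrix_pow_mem_symRel (n : ℕ) (ν ν' : N) :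
    ((D.casimirMatrix ιLin ^ n) ν ν', (D.casimirMatrix (linPoly D.b) ^ n) ν ν') ∈
      symRel D.b n := by
  induction n generalizing ν ν' with
  | zero =>
    by_cases h : ν = ν'
    · rw [pow_zero, pow_zero, h, Matrix.one_apply_eq, Matrix.one_apply_eq]
      exact one_mem_symRel D.b
    · rw [pow_zero, pow_zero, Matrix.one_apply_ne h, Matrix.one_apply_ne h]
      exact Submodule.zero_mem _
  | succ n ih =>
    rw [pow_succ', pow_succ', Matrix.mul_apply, Matrix.mul_apply, add_comm n]
    refine D.sum_mem_symRel _ fun μ _ => symRel_mul D.b (n := 1)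
      (p := (D.casimirMatrix ιLin ν μ, D.casimirMatrix (linPoly D.b) ν μ)) ?_ (ih μ ν')
    rw [casimirMatrix_apply, casimirMatrix_apply]
    exact D.sum_mem_symRel _ fun i _ => Submodule.smul_mem _ _ (ι_mem_symRel D.b (D.dual i))

theorem trace_casimirMatrix_pow_mem_symRel (n : ℕ) :
    ((D.casimirMatrix ιLin ^ n).trace, (D.casimirMatrix (linPoly D.b) ^ n).trace) ∈
      symRel D.b n := by
  simp only [Matrix.trace, Matrix.diag_apply]
  exact D.sum_mem_symRel _ fun ν _ => D.casimirMatrix_pow_mem_symRel n ν ν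

end Casimir

/-- The projection of the symmetric algebra onto that of the Cartan subalgebra. -/
noncomputable abbrev toCartan : MvPolynomial I ℂ →ₐ[ℂ] MvPolynomial D.Cartan ℂ :=
  MvPolynomial.killCompl (Subtype.val_injective : Function.Injective (Subtype.val : D.Cartan → I))

theorem toCartan_X (i : D.Cartan) : D.toCartan (MvPolynomial.X i) = MvPolynomial.X i := by
  have := MvPolynomial.killCompl_rename_app (R := ℂ)
    (Subtype.val_injective : Function.Injective (Subtype.val : D.Cartan → I)) (MvPolynomial.X i)
  rwa [MvPolynomial.rename_X] at this

theorem toCartan_X_of_ne {i : I} (hi : D.c i ≠ 0) : D.toCartan (MvPolynomial.X i) = 0 := by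
  rw [toCartan, MvPolynomial.killCompl, MvPolynomial.aeval_X, dif_neg]
  rintro ⟨j, rfl⟩
  exact hi j.2

theorem toCartan_linPoly_isHomogeneous (x : g) : (D.toCartan (linPoly D.b x)).IsHomogeneous 1 := by
  suffices H : (⊤ : Submodule ℂ g) ≤ (MvPolynomial.homogeneousSubmodule D.Cartan ℂ 1).comap
      (D.toCartan.toLinearMap ∘ₗ linPoly D.b) from H (Submodule.mem_top (x := x))
  rw [← D.b.span_eq, Submodule.span_le]
  rintro _ ⟨i, rfl⟩
  change (D.toCartan (linPoly D.b (D.b i))).IsHomogeneous 1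
  rw [linPoly_basis]
  by_cases hi : D.c i = 0
  · rw [D.toCartan_X ⟨i, hi⟩]
    exact MvPolynomial.isHomogeneous_X _ _
  · rw [D.toCartan_X_of_ne hi]
    exact MvPolynomial.isHomogeneous_zero _ _ _

section Finite

variable [Fintype I]

theorem lie_h_dual (i : I) : ⁅D.h, D.dual i⁆ = -D.c i • D.dual i := by
  refine eq_of_sub_eq_zero (D.nondeg _ fun y => ?_)
  change D.traceForm _ y = 0
  have : D.traceForm (⁅D.h, D.dual i⁆ - -D.c i • D.dual i) = 0 := by
    apply D.b.ext
    intro j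
    rw [map_sub, LinearMap.sub_apply, ← lie_skew, map_neg, LinearMap.neg_apply, traceForm_lie,
      D.lie_h, map_smul, map_smul, LinearMap.smul_apply, traceForm_dual]
    by_cases h : j = i <;> simp [h]
  rw [this, LinearMap.zero_apply]

theorem toCartan_linPoly_dual {i : I} (hi : D.c i ≠ 0) : D.toCartan (linPoly D.b (D.dual i)) = 0 := by
  have h1 := D.b.sum_repr (D.dual i)
  rw [← h1, map_sum, map_sum]
  refine Finset.sum_eq_zero fun j _ => ?_
  rw [map_smul, map_smul, linPoly_basis]
  by_cases hj : D.c j = 0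
  · have h2 := D.repr_lie_h (D.dual i) j
    rw [hj, zero_mul, lie_h_dual, map_smul, Finsupp.smul_apply, smul_eq_mul, mul_eq_zero,
      neg_eq_zero] at h2
    rw [h2.resolve_left hi, zero_smul]
  · rw [D.toCartan_X_of_ne hj, smul_zero]

theorem toCartan_casimirMatrix [DecidableEq N] :
    (D.casimirMatrix (linPoly D.b)).map D.toCartan =
      Matrix.diagonal fun ν => D.toCartan (D.casimirMatrix (linPoly D.b) ν ν) := by
  ext1 ν ν'
  by_cases h : ν = ν'
  · subst h; simp
  · rw [Matrix.diagonal_apply_ne _ h, Matrix.map_apply, casimirMatrix_apply, map_sum]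
    refine Finset.sum_eq_zero fun i _ => ?_
    rw [map_smul]
    by_cases hi : D.c i = 0
    · rw [D.ρ_diag i hi h, zero_smul]
    · rw [D.toCartan_linPoly_dual hi, smul_zero]

theorem X_eq_sum_toCartan (j : D.Cartan) : (MvPolynomial.X j : MvPolynomial D.Cartan ℂ) =
    ∑ ν, D.ρ (D.b j) ν ν • D.toCartan (D.casimirMatrix (linPoly D.b) ν ν) := by
  have h := congrArg (linPoly D.b) (D.sum_traceForm_smul_dual (D.b j))
  rw [linPoly_basis] at h
  have h1 : ∀ i, D.traceForm (D.b j) (D.b i) = ∑ ν, D.ρ (D.b j) ν ν * D.ρ (D.b i) ν ν := by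
    intro i
    simp only [traceForm_apply, Matrix.trace, Matrix.diag_apply, Matrix.mul_apply]
    refine Finset.sum_congr rfl fun ν _ => Finset.sum_eq_single ν (fun ν' _ hν' => ?_) (by simp)
    rw [D.ρ_diag _ j.2 hν'.symm, zero_mul]
  rw [← D.toCartan_X, ← h]
  simp only [h1, casimirMatrix_apply, map_sum, map_smul, Finset.sum_smul, Finset.smul_sum, smul_smul]
  exact Finset.sum_comm

theorem hc_finite : (D.hc : Subalgebra.center ℂ (UniversalEnvelopingAlgebra ℂ g) →+*
    MvPolynomial D.Cartan ℂ).Finite := by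
  classical
  refine finite_of_powerSums D.hc (fun ν => D.toCartan (D.casimirMatrix (linPoly D.b) ν ν)) ?_
    (fun j ν => D.ρ (D.b j) ν ν) D.X_eq_sum_toCartan fun n =>
      ⟨⟨_, D.trace_casimirMatrix_pow_mem_center n⟩, ?_⟩
  · intro ν
    rw [casimirMatrix_apply, map_sum]
    refine MvPolynomial.IsHomogeneous.sum _ _ _ fun i _ => ?_
    rw [map_smul, MvPolynomial.smul_eq_C_mul]
    exact (D.toCartan_linPoly_isHomogeneous _).C_mul _
  · have h := D.hc_of_mem_symRel (z := ⟨_, D.trace_casimirMatrix_pow_mem_center n⟩)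
      (D.trace_casimirMatrix_pow_mem_symRel n)
    refine ⟨h.1, h.2.trans ?_⟩
    change D.toCartan _ = _
    have h2 : D.toCartan (D.casimirMatrix (linPoly D.b) ^ n).trace =
        (((D.casimirMatrix (linPoly D.b)).map D.toCartan) ^ n).trace := by
      have := map_pow (D.toCartan : MvPolynomial I ℂ →+* MvPolynomial D.Cartan ℂ).mapMatrix
        (D.casimirMatrix (linPoly D.b)) n
      rw [RingHom.mapMatrix_apply, RingHom.mapMatrix_apply] at this
      refine Eq.trans ?_ (congrArg Matrix.trace this)
      simp [Matrix.trace, map_sum]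
    rw [h2, toCartan_casimirMatrix, Matrix.diagonal_pow, Matrix.trace_diagonal]
    rfl

end Finite

end TriangularData

end Triangular

section Triangular

attribute [local instance] LieRing.ofAssociativeRing

open scoped TensorProduct

section Coproduct

variable {g : Type*} [LieRing g] [LieAlgebra ℂ g] {J : Type*} [Fintype J] [DecidableEq J]

/-- The action of the enveloping algebra on the tensor product of a matrix representation with
the enveloping algebra itself. -/
noncomputable def coprodHom (τ : g →ₗ[ℂ] Matrix J J ℂ)
    (hτ : ∀ x y, τ ⁅x, y⁆ = τ x * τ y - τ y * τ x) :
    UniversalEnvelopingAlgebra ℂ g →ₐ[ℂ] Matrix J J (UniversalEnvelopingAlgebra ℂ g) :=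
  UniversalEnvelopingAlgebra.lift ℂ
    { toFun := fun x => (τ x).map (algebraMap ℂ (UniversalEnvelopingAlgebra ℂ g)) +
        Matrix.scalar J (UniversalEnvelopingAlgebra.ι ℂ x)
      map_add' := fun x y => by
        simp only [map_add]
        rw [Matrix.map_add _ (map_add _)]
        abel
      map_smul' := fun c x => by
        have h1 : Matrix.scalar J (c • UniversalEnvelopingAlgebra.ι ℂ x) =
            c • Matrix.scalar J (UniversalEnvelopingAlgebra.ι ℂ x) :=
          map_smul (Matrix.scalarAlgHom J ℂ) c _
        have h2 : (c • τ x).map (algebraMap ℂ (UniversalEnvelopingAlgebra ℂ g)) =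
            c • (τ x).map (algebraMap ℂ (UniversalEnvelopingAlgebra ℂ g)) := by
          ext i j
          rw [Matrix.map_apply, Matrix.smul_apply, Matrix.smul_apply, Matrix.map_apply, smul_eq_mul,
            map_mul, Algebra.smul_def]
        rw [map_smul, map_smul, h1, h2, RingHom.id_apply, smul_add]
      map_lie' := fun {x y} => by
        simp only [LieRing.of_associative_ring_bracket, LieHom.map_lie, hτ]
        rw [Matrix.map_sub _ (map_sub _), Matrix.map_mul, Matrix.map_mul]
        have h : ∀ (x : g) (u : UniversalEnvelopingAlgebra ℂ g),
            Matrix.scalar J u * (τ x).map (algebraMap ℂ (UniversalEnvelopingAlgebra ℂ g)) =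
            (τ x).map (algebraMap ℂ (UniversalEnvelopingAlgebra ℂ g)) * Matrix.scalar J u := by
          intro x u
          ext i j
          simp [Matrix.scalar_apply, Algebra.commutes]
        simp only [map_sub, map_mul, add_mul, mul_add, h]
        abel }

variable (τ : g →ₗ[ℂ] Matrix J J ℂ) (hτ : ∀ x y, τ ⁅x, y⁆ = τ x * τ y - τ y * τ x)

theorem coprodHom_ι (x : g) : coprodHom τ hτ (UniversalEnvelopingAlgebra.ι ℂ x) =
    (τ x).map (algebraMap ℂ (UniversalEnvelopingAlgebra ℂ g)) +
      Matrix.scalar J (UniversalEnvelopingAlgebra.ι ℂ x) := by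
  rw [coprodHom, UniversalEnvelopingAlgebra.lift_ι_apply]
  rfl

theorem coprodHom_ι_mulVec_single (x : g) (j : J) (y : UniversalEnvelopingAlgebra ℂ g) :
    (coprodHom τ hτ (UniversalEnvelopingAlgebra.ι ℂ x)).mulVec (Pi.single j y) =
      ∑ k, τ x k j • Pi.single k y + Pi.single j (UniversalEnvelopingAlgebra.ι ℂ x * y) := by
  rw [coprodHom_ι, Matrix.add_mulVec]
  congr 1
  · ext k
    simp [Matrix.mulVec_single, Pi.single_apply, Algebra.smul_def]
  · ext k
    by_cases h : k = j
    · subst h; simp [Matrix.mulVec_single]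
    · simp [Matrix.mulVec_single, h]

theorem scalar_commute_of_mem_center {z : UniversalEnvelopingAlgebra ℂ g}
    (hz : z ∈ Subalgebra.center ℂ (UniversalEnvelopingAlgebra ℂ g))
    (M : Matrix J J (UniversalEnvelopingAlgebra ℂ g)) : Commute M (Matrix.scalar J z) := by
  ext i j
  rw [Subalgebra.mem_center_iff] at hz
  simp [Matrix.scalar_apply, hz]

/-- The action of the tensor square of the center on the tensor product of a matrix representation
with the enveloping algebra. -/
noncomputable def centerCoprod :
    Subalgebra.center ℂ (UniversalEnvelopingAlgebra ℂ g) ⊗[ℂ]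
      Subalgebra.center ℂ (UniversalEnvelopingAlgebra ℂ g) →ₐ[ℂ]
      Matrix J J (UniversalEnvelopingAlgebra ℂ g) :=
  Algebra.TensorProduct.lift ((coprodHom τ hτ).comp (Subalgebra.val _))
    ((Matrix.scalarAlgHom J ℂ).comp (Subalgebra.val _))
    fun _ y => scalar_commute_of_mem_center y.2 _

theorem centerCoprod_tmul (z z' : Subalgebra.center ℂ (UniversalEnvelopingAlgebra ℂ g)) :
    centerCoprod τ hτ (z ⊗ₜ z') = coprodHom τ hτ z * Matrix.scalar J (z' : UniversalEnvelopingAlgebra ℂ g) := by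
  exact Algebra.TensorProduct.lift_tmul _ _ _ _ _

theorem centerCoprod_commute (w : Subalgebra.center ℂ (UniversalEnvelopingAlgebra ℂ g) ⊗[ℂ]
    Subalgebra.center ℂ (UniversalEnvelopingAlgebra ℂ g)) (u : UniversalEnvelopingAlgebra ℂ g) :
    Commute (centerCoprod τ hτ w) (coprodHom τ hτ u) := by
  induction w using TensorProduct.induction_on with
  | zero => simp
  | tmul z z' =>
    rw [centerCoprod_tmul]
    refine Commute.mul_left ?_ (scalar_commute_of_mem_center z'.2 _).symm
    have := Subalgebra.mem_center_iff.mp z.2 u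
    rw [Commute, SemiconjBy, ← map_mul, ← map_mul, this]
  | add x y hx hy => rw [map_add]; exact hx.add_left hy

end Coproduct

end Triangular

section Triangular

attribute [local instance] LieRing.ofAssociativeRing

open scoped TensorProduct

namespace TriangularData

variable {g : Type*} [LieRing g] [LieAlgebra ℂ g] {I N : Type*} [LinearOrder I] [Fintype N]
  (D : TriangularData g I N) {J : Type*} [Fintype J]

theorem mulVec_mem_nplus (M : Matrix J J (UniversalEnvelopingAlgebra ℂ g))
    {v : J → UniversalEnvelopingAlgebra ℂ g} (hv : ∀ j, v j ∈ D.nplus) (j : J) :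
    M.mulVec v j ∈ D.nplus :=
  sum_mem fun k _ => Ideal.mul_mem_left _ _ (hv k)

variable [DecidableEq J] (τ : g →ₗ[ℂ] Matrix J J ℂ) (hτ : ∀ x y, τ ⁅x, y⁆ = τ x * τ y - τ y * τ x)

/-- The columns killed by `w` modulo the left ideal `nplus`. -/
noncomputable def killed (w : Subalgebra.center ℂ (UniversalEnvelopingAlgebra ℂ g) ⊗[ℂ]
    Subalgebra.center ℂ (UniversalEnvelopingAlgebra ℂ g)) :
    Submodule ℂ (J → UniversalEnvelopingAlgebra ℂ g) where
  carrier := {v | ∀ j, (centerCoprod τ hτ w).mulVec v j ∈ D.nplus}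
  add_mem' := fun {v v'} h h' j => by
    rw [Matrix.mulVec_add]
    exact add_mem (h j) (h' j)
  zero_mem' := fun j => by
    rw [Matrix.mulVec_zero]
    exact zero_mem _
  smul_mem' := fun c v h j => by
    rw [Matrix.mulVec_smul]
    exact D.smul_mem_nplus c (h j)

theorem mem_killed {w : Subalgebra.center ℂ (UniversalEnvelopingAlgebra ℂ g) ⊗[ℂ]
    Subalgebra.center ℂ (UniversalEnvelopingAlgebra ℂ g)} {v : J → UniversalEnvelopingAlgebra ℂ g} :
    v ∈ D.killed τ hτ w ↔ ∀ j, (centerCoprod τ hτ w).mulVec v j ∈ D.nplus := Iff.rfl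

theorem mem_killed_of_forall_mem_nplus {w : Subalgebra.center ℂ (UniversalEnvelopingAlgebra ℂ g) ⊗[ℂ]
    Subalgebra.center ℂ (UniversalEnvelopingAlgebra ℂ g)} {v : J → UniversalEnvelopingAlgebra ℂ g}
    (hv : ∀ j, v j ∈ D.nplus) : v ∈ D.killed τ hτ w :=
  D.mulVec_mem_nplus _ hv

theorem single_mem_killed {w : Subalgebra.center ℂ (UniversalEnvelopingAlgebra ℂ g) ⊗[ℂ]
    Subalgebra.center ℂ (UniversalEnvelopingAlgebra ℂ g)} (j : J) {y : UniversalEnvelopingAlgebra ℂ g}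
    (hy : y ∈ D.nplus) : Pi.single j y ∈ D.killed τ hτ w := by
  refine D.mem_killed_of_forall_mem_nplus τ hτ fun k => ?_
  by_cases h : k = j
  · subst h; simpa using hy
  · simp [h]

theorem coprodHom_mulVec_mem_killed {w : Subalgebra.center ℂ (UniversalEnvelopingAlgebra ℂ g) ⊗[ℂ]
    Subalgebra.center ℂ (UniversalEnvelopingAlgebra ℂ g)} {v : J → UniversalEnvelopingAlgebra ℂ g}
    (hv : v ∈ D.killed τ hτ w) (u : UniversalEnvelopingAlgebra ℂ g) :
    (coprodHom τ hτ u).mulVec v ∈ D.killed τ hτ w := by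
  rw [mem_killed, Matrix.mulVec_mulVec, (centerCoprod_commute τ hτ w u).eq, ← Matrix.mulVec_mulVec]
  exact D.mulVec_mem_nplus _ hv

/-- The real part of the value of a weight at the regular element. -/
noncomputable def height [Fintype I] (μ : D.Cartan → ℂ) : ℝ :=
  (∑ i : D.Cartan, D.b.repr D.h i * μ i).re

theorem h_eq [Fintype I] : D.h = ∑ i : D.Cartan, D.b.repr D.h i • D.b i := by
  have h1 := D.b.sum_repr D.h
  have h2 : ∀ i, D.c i ≠ 0 → D.b.repr D.h i = 0 := by
    intro i hi
    have := (D.b.mem_span_image).mp D.h_mem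
    by_contra hne
    exact hi (this (Finsupp.mem_support_iff.mpr hne))
  conv_lhs => rw [← h1]
  rw [← Finset.sum_subtype (Finset.univ.filter fun i => D.c i = 0) (by simp)
    (fun i => D.b.repr D.h i • D.b i)]
  refine (Finset.sum_filter_of_ne fun i _ hne => ?_).symm
  by_contra hi
  exact hne (by rw [h2 i hi, zero_smul])

theorem coprodHom_cartanHom_mulVec {wt : J → D.Cartan → ℂ}
    (hwt : ∀ i : D.Cartan, τ (D.b i) = Matrix.diagonal fun j => wt j i) (s t : MvPolynomial D.Cartan ℂ) (j : J) :
    (coprodHom τ hτ (D.cartanHom s)).mulVec (Pi.single j (D.cartanHom t)) =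
      Pi.single j (D.cartanHom (t * shift (wt j) s)) := by
  induction s using MvPolynomial.induction_on generalizing t with
  | C c =>
    have h1 : (MvPolynomial.C c : MvPolynomial D.Cartan ℂ) = algebraMap ℂ _ c := rfl
    rw [h1, AlgHom.commutes, AlgHom.commutes, AlgHom.commutes, map_mul, AlgHom.commutes,
      ← Algebra.commutes]
    ext k
    rw [Algebra.algebraMap_eq_smul_one, Matrix.smul_mulVec, Matrix.one_mulVec, Pi.smul_apply]
    by_cases h : k = j
    · subst h; simp [Algebra.smul_def]
    · simp [h]
  | add p q hp hq =>
    rw [map_add, map_add, Matrix.add_mulVec, hp, hq, map_add, mul_add, map_add, Pi.single_add]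
  | mul_X p i hp =>
    have h2 : D.cartanHom t * D.cartanHom (MvPolynomial.X i) =
        D.cartanHom (MvPolynomial.X i) * D.cartanHom t := by
      rw [← map_mul, ← map_mul, mul_comm]
    have h1 : (coprodHom τ hτ (D.cartanHom (MvPolynomial.X i))).mulVec
        (Pi.single j (D.cartanHom t)) = Pi.single j (D.cartanHom (t * shift (wt j) (MvPolynomial.X i))) := by
      rw [cartanHom_X, coprodHom_ι_mulVec_single, hwt, Finset.sum_eq_single j]
      · rw [Matrix.diagonal_apply_eq, ← Pi.single_smul, ← Pi.single_add]
        congr 1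
        simp only [shift, MvPolynomial.aeval_X, mul_add, map_add, map_mul]
        have h3 : D.cartanHom (MvPolynomial.C (wt j i)) = algebraMap ℂ _ (wt j i) :=
          D.cartanHom.commutes _
        rw [h2, h3, ← Algebra.commutes, ← Algebra.smul_def, cartanHom_X, add_comm]
      · intro k _ hk
        rw [Matrix.diagonal_apply_ne _ hk, zero_smul]
      · simp
    rw [map_mul, map_mul, ← Matrix.mulVec_mulVec, h1, hp, map_mul (shift (wt j)), mul_assoc,
      mul_comm (shift (wt j) (MvPolynomial.X i))]

section Fintype

variable [Fintype I] {τ} {wt : J → D.Cartan → ℂ}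

theorem height_lt_of_ne_zero (hτ : ∀ x y, τ ⁅x, y⁆ = τ x * τ y - τ y * τ x)
    (hwt : ∀ i : D.Cartan, τ (D.b i) = Matrix.diagonal fun j => wt j i)
    {i : I} (hi : i ∈ D.plus) {k j : J} (hne : τ (D.b i) k j ≠ 0) :
    D.height (wt j) < D.height (wt k) := by
  have h1 : τ D.h = Matrix.diagonal fun j => ∑ i : D.Cartan, D.b.repr D.h i * wt j i := by
    rw [D.h_eq, map_sum]
    ext k j
    rw [Matrix.sum_apply]
    by_cases h : k = j
    · subst h; simp [hwt, ← D.h_eq]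
    · simp [hwt, h]
  have h2 := congrFun (congrFun (hτ D.h (D.b i)) k) j
  rw [D.lie_h, h1, map_smul, Matrix.sub_apply, Matrix.diagonal_mul, Matrix.mul_diagonal,
    Matrix.smul_apply, smul_eq_mul, mul_comm (τ (D.b i) k j), ← sub_mul] at h2
  have h3 := congrArg Complex.re (mul_right_cancel₀ hne h2)
  rw [Complex.sub_re] at h3
  have h4 : 0 < (D.c i).re := hi
  rw [height, height]
  linarith

theorem nplus_mulVec_mem_killed (hτ : ∀ x y, τ ⁅x, y⁆ = τ x * τ y - τ y * τ x)
    (hwt : ∀ i : D.Cartan, τ (D.b i) = Matrix.diagonal fun j => wt j i)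
    {w : Subalgebra.center ℂ (UniversalEnvelopingAlgebra ℂ g) ⊗[ℂ]
      Subalgebra.center ℂ (UniversalEnvelopingAlgebra ℂ g)} {j : J}
    (hw : ∀ k, D.height (wt j) < D.height (wt k) → ∀ t,
      Pi.single k (D.cartanHom t) ∈ D.killed τ hτ w)
    {n : UniversalEnvelopingAlgebra ℂ g} (hn : n ∈ D.nplus) (t : MvPolynomial D.Cartan ℂ) :
    (coprodHom τ hτ n).mulVec (Pi.single j (D.cartanHom t)) ∈ D.killed τ hτ w := by
  induction hn using Submodule.span_induction with
  | mem n hn =>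
    obtain ⟨i, hi, rfl⟩ := hn
    rw [coprodHom_ι_mulVec_single]
    refine add_mem (sum_mem fun k _ => ?_) ?_
    · by_cases hne : τ (D.b i) k j = 0
      · rw [hne, zero_smul]; exact zero_mem _
      · exact Submodule.smul_mem _ _ (hw k (D.height_lt_of_ne_zero hτ hwt hi hne) t)
    · exact D.single_mem_killed τ hτ j (D.mul_cartanHom_mem_nplus (D.ι_mem_nplus hi) t)
  | zero => rw [map_zero, Matrix.zero_mulVec]; exact zero_mem _
  | add x y _ _ hx hy => rw [map_add, Matrix.add_mulVec]; exact add_mem hx hy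
  | smul u x _ hx =>
    rw [smul_eq_mul, map_mul, ← Matrix.mulVec_mulVec]
    exact D.coprodHom_mulVec_mem_killed τ hτ hx u

theorem centerCoprod_mulVec_sub_mem_killed (hτ : ∀ x y, τ ⁅x, y⁆ = τ x * τ y - τ y * τ x)
    (hwt : ∀ i : D.Cartan, τ (D.b i) = Matrix.diagonal fun j => wt j i)
    {w : Subalgebra.center ℂ (UniversalEnvelopingAlgebra ℂ g) ⊗[ℂ]
      Subalgebra.center ℂ (UniversalEnvelopingAlgebra ℂ g)} {j : J}
    (hw : ∀ k, D.height (wt j) < D.height (wt k) → ∀ t,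
      Pi.single k (D.cartanHom t) ∈ D.killed τ hτ w)
    (w' : Subalgebra.center ℂ (UniversalEnvelopingAlgebra ℂ g) ⊗[ℂ]
      Subalgebra.center ℂ (UniversalEnvelopingAlgebra ℂ g)) (t : MvPolynomial D.Cartan ℂ) :
    (centerCoprod τ hτ w').mulVec (Pi.single j (D.cartanHom t)) -
      Pi.single j (D.cartanHom (t *
        Algebra.TensorProduct.productMap ((shift (wt j)).comp D.hc) D.hc w')) ∈
      D.killed τ hτ w := by
  induction w' using TensorProduct.induction_on with
  | zero =>
    rw [map_zero, map_zero, mul_zero, map_zero, Matrix.zero_mulVec, Pi.single_zero, sub_zero]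
    exact zero_mem _
  | add x y hx hy =>
    rw [map_add, map_add, mul_add, map_add, Matrix.add_mulVec, Pi.single_add, add_sub_add_comm]
    exact add_mem hx hy
  | tmul z z' =>
    have h1 : (Matrix.scalar J (z' : UniversalEnvelopingAlgebra ℂ g)).mulVec
        (Pi.single j (D.cartanHom t)) = Pi.single j (D.cartanHom t *
          ((z' : UniversalEnvelopingAlgebra ℂ g) - D.cartanHom (D.hc z'))) +
          Pi.single j (D.cartanHom (t * D.hc z')) := by
      rw [← Pi.single_add, mul_sub, map_mul, sub_add_cancel,
        Subalgebra.mem_center_iff.mp z'.2]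
      ext k
      by_cases h : k = j
      · subst h; simp
      · simp [h]
    have h2 : (coprodHom τ hτ (z : UniversalEnvelopingAlgebra ℂ g)) =
        coprodHom τ hτ ((z : UniversalEnvelopingAlgebra ℂ g) - D.cartanHom (D.hc z)) +
          coprodHom τ hτ (D.cartanHom (D.hc z)) := by
      rw [← map_add, sub_add_cancel]
    rw [centerCoprod_tmul, ← Matrix.mulVec_mulVec, h1, Matrix.mulVec_add]
    nth_rewrite 2 [h2]
    rw [Matrix.add_mulVec, D.coprodHom_cartanHom_mulVec τ hτ hwt,
      Algebra.TensorProduct.productMap_apply_tmul, AlgHom.comp_apply, mul_assoc t,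
      mul_comm (D.hc z'), ← add_assoc, add_sub_cancel_right]
    refine add_mem (D.coprodHom_mulVec_mem_killed τ hτ (D.single_mem_killed τ hτ j
      (Ideal.mul_mem_left _ _ (D.sub_hc_mem_nplus z'))) _) ?_
    exact D.nplus_mulVec_mem_killed hτ hwt hw (D.sub_hc_mem_nplus z) _

open Classical in
theorem single_cartanHom_mem_killed (hτ : ∀ x y, τ ⁅x, y⁆ = τ x * τ y - τ y * τ x)
    (hwt : ∀ i : D.Cartan, τ (D.b i) = Matrix.diagonal fun j => wt j i) (j : J)
    {w : Subalgebra.center ℂ (UniversalEnvelopingAlgebra ℂ g) ⊗[ℂ]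
      Subalgebra.center ℂ (UniversalEnvelopingAlgebra ℂ g)}
    (hw : w ∈ ∏ μ ∈ (Finset.univ.image wt).filter (fun μ => D.height (wt j) ≤ D.height μ),
      shiftGraph D.hc μ) (t : MvPolynomial D.Cartan ℂ) :
    Pi.single j (D.cartanHom t) ∈ D.killed τ hτ w := by
  generalize hn : ((Finset.univ.image wt).filter
    (fun μ => D.height (wt j) ≤ D.height μ)).card = n
  induction n using Nat.strong_induction_on generalizing j w t with
  | _ n ih =>
  set S := (Finset.univ.image wt).filter (fun μ => D.height (wt j) ≤ D.height μ) with hS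
  have hj : wt j ∈ S := Finset.mem_filter.mpr ⟨Finset.mem_image_of_mem _ (Finset.mem_univ _), le_rfl⟩
  rw [← Finset.prod_erase_mul _ _ hj] at hw
  induction hw using Submodule.mul_induction_on' with
  | add x _ y _ hx hy =>
    rw [mem_killed] at *
    intro k
    rw [map_add, Matrix.add_mulVec]
    exact add_mem (hx k) (hy k)
  | mem_mul_mem x hx y hy =>
    have hw' : ∀ k, D.height (wt j) < D.height (wt k) → ∀ t,
        Pi.single k (D.cartanHom t) ∈ D.killed τ hτ x := by
      intro k hk t
      have hsub : (Finset.univ.image wt).filter (fun μ => D.height (wt k) ≤ D.height μ) ⊆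
          S.erase (wt j) := by
        intro μ hμ
        obtain ⟨h1, h2⟩ := Finset.mem_filter.mp hμ
        refine Finset.mem_erase.mpr ⟨?_, Finset.mem_filter.mpr ⟨h1, (hk.trans_le h2).le⟩⟩
        rintro rfl
        exact absurd hk (not_lt.mpr h2)
      refine ih _ ?_ k (Ideal.le_of_dvd (Finset.prod_dvd_prod_of_subset _ _ _ hsub) hx) t rfl
      rw [← hn]
      exact (Finset.card_le_card hsub).trans_lt (Finset.card_erase_lt_of_mem hj)
    have h1 := D.centerCoprod_mulVec_sub_mem_killed hτ hwt hw' y t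
    rw [show Algebra.TensorProduct.productMap ((shift (wt j)).comp D.hc) D.hc y = 0 from hy,
      mul_zero, map_zero, Pi.single_zero, sub_zero, mem_killed] at h1
    rw [mem_killed, map_mul, ← Matrix.mulVec_mulVec]
    exact h1

open Classical in
theorem centerCoprod_eq_zero (hτ : ∀ x y, τ ⁅x, y⁆ = τ x * τ y - τ y * τ x)
    (hwt : ∀ i : D.Cartan, τ (D.b i) = Matrix.diagonal fun j => wt j i)
    {w : Subalgebra.center ℂ (UniversalEnvelopingAlgebra ℂ g) ⊗[ℂ]
      Subalgebra.center ℂ (UniversalEnvelopingAlgebra ℂ g)}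
    (hw : w ∈ ∏ μ ∈ Finset.univ.image wt, shiftGraph D.hc μ) : centerCoprod τ hτ w = 0 := by
  have h1 : ∀ j, Pi.single j 1 ∈ D.killed τ hτ w := by
    intro j
    rw [← map_one D.cartanHom]
    exact D.single_cartanHom_mem_killed hτ hwt j
      (Ideal.le_of_dvd (Finset.prod_dvd_prod_of_subset _ _ _ (Finset.filter_subset _ _)) hw) 1
  have h2 : ∀ (y : UniversalEnvelopingAlgebra ℂ g) (j : J), Pi.single j y ∈ D.killed τ hτ w := by
    intro y
    have hy : y ∈ Submodule.span ℂ (Set.range (word (g := g))) := by rw [span_range_word]; trivial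
    induction hy using Submodule.span_induction with
    | mem x hx =>
      obtain ⟨l, rfl⟩ := hx
      induction l with
      | nil => exact h1
      | cons x l ih =>
        intro j
        have h3 := coprodHom_ι_mulVec_single τ hτ x j (word l)
        rw [word_cons, eq_sub_of_add_eq' h3.symm]
        exact sub_mem (D.coprodHom_mulVec_mem_killed τ hτ (ih j) _)
          (sum_mem fun k _ => Submodule.smul_mem _ _ (ih k))
    | zero => intro j; rw [Pi.single_zero]; exact zero_mem _
    | add x y _ _ hx hy => intro j; rw [Pi.single_add]; exact add_mem (hx j) (hy j)
    | smul c x _ hx => intro j; rw [Pi.single_smul]; exact Submodule.smul_mem _ _ (hx j)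
  ext k j
  refine D.eq_zero_of_forall_mul_mem_nplus fun y => ?_
  have h3 := h2 y j k
  rwa [Matrix.mulVec_single] at h3

end Fintype

end TriangularData

end Triangular

section Triangular

attribute [local instance] LieRing.ofAssociativeRing

open scoped TensorProduct

theorem exists_forall_apply_eq_smul {K F I : Type*} [Field K] [IsAlgClosed K] [AddCommGroup F]
    [Module K F] [FiniteDimensional K F] (T : I → Module.End K F) (hT : ∀ i j, Commute (T i) (T j))
    {S : Submodule K F} (hS : S ≠ ⊥) (hinv : ∀ i, ∀ v ∈ S, T i v ∈ S) :
    ∃ v ∈ S, v ≠ 0 ∧ ∃ χ : I → K, ∀ i, T i v = χ i • v := by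
  obtain ⟨N, ⟨hN, hNS, hNinv⟩, hmin⟩ := wellFounded_lt.has_min
    {N : Submodule K F | N ≠ ⊥ ∧ N ≤ S ∧ ∀ i, ∀ v ∈ N, T i v ∈ N} ⟨S, hS, le_rfl, hinv⟩
  obtain ⟨v, hv, hv0⟩ := N.ne_bot_iff.mp hN
  refine ⟨v, hNS hv, hv0, ?_⟩
  suffices h : ∀ i, ∃ c : K, T i v = c • v by
    choose χ hχ using h
    exact ⟨χ, hχ⟩
  intro i
  have : Nontrivial N := N.nontrivial_iff_ne_bot.mpr hN
  obtain ⟨c, hc⟩ := Module.End.exists_eigenvalue ((T i).restrict (hNinv i))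
  obtain ⟨w, hw⟩ := hc.exists_hasEigenvector
  have h2 := hw.apply_eq_smul
  have h3 : T i (w : F) = c • (w : F) := congrArg Subtype.val h2
  have h4 : N ⊓ (T i).eigenspace c = N := by
    by_contra hne
    refine hmin (N ⊓ (T i).eigenspace c) ⟨?_, inf_le_left.trans hNS, ?_⟩
      (lt_of_le_of_ne inf_le_left hne)
    · rw [Submodule.ne_bot_iff]
      exact ⟨w, ⟨w.2, Module.End.mem_eigenspace_iff.mpr h3⟩, fun h => hw.2 (Subtype.ext h)⟩
    · rintro j u ⟨hu, hu'⟩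
      refine ⟨hNinv j u hu, Module.End.mem_eigenspace_iff.mpr ?_⟩
      have h5 : T i (T j u) = T j (T i u) := congrArg (fun f => f u) (hT i j).eq
      rw [h5, Module.End.mem_eigenspace_iff.mp hu', map_smul]
  exact ⟨c, Module.End.mem_eigenspace_iff.mp (h4.ge hv).2⟩

namespace TriangularData

variable {g : Type*} [LieRing g] [LieAlgebra ℂ g] {I N : Type*} [LinearOrder I] [Fintype N]
  (D : TriangularData g I N)

/-- A completely reducible finite-dimensional representation has a basis of weight vectors. -/
theorem exists_weightBasis {F : Type*} [AddCommGroup F] [Module ℂ F] [FiniteDimensional ℂ F]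
    (T : g →ₗ[ℂ] Module.End ℂ F) (hT : ∀ x y, T ⁅x, y⁆ = T x * T y - T y * T x)
    (hcompl : ∀ S : Submodule ℂ F, (∀ x, ∀ v ∈ S, T x v ∈ S) →
      ∃ S' : Submodule ℂ F, (∀ x, ∀ v ∈ S', T x v ∈ S') ∧ IsCompl S S') :
    ∃ (m : ℕ) (e : Module.Basis (Fin m) ℂ F) (wt : Fin m → D.Cartan → ℂ),
      ∀ j (i : D.Cartan), T (D.b i) (e j) = wt j i • e j := by
  let s : Set F := {v | ∃ χ : D.Cartan → ℂ, ∀ i : D.Cartan, T (D.b i) v = χ i • v}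
  have hs : Submodule.span ℂ s = ⊤ := by
    obtain ⟨S', hS', hc⟩ := hcompl (Submodule.span ℂ s) (by
      intro x v hv
      induction hv using Submodule.span_induction with
      | zero => rw [map_zero]; exact zero_mem _
      | add u v _ _ hu hv => rw [map_add]; exact add_mem hu hv
      | smul c v _ hv => rw [map_smul]; exact Submodule.smul_mem _ _ hv
      | mem v hv =>
        obtain ⟨χ, hχ⟩ := hv
        have hx : x ∈ Submodule.span ℂ (Set.range D.b) := by rw [D.b.span_eq]; trivial
        induction hx using Submodule.span_induction with
        | zero => rw [map_zero]; exact zero_mem _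
        | add u v _ _ hu hv => rw [map_add]; exact add_mem hu hv
        | smul c v _ hv => rw [map_smul]; exact Submodule.smul_mem _ _ hv
        | mem x hx =>
          obtain ⟨j, rfl⟩ := hx
          refine Submodule.subset_span ⟨fun i => χ i + D.a i j, fun i => ?_⟩
          have h1 := congrArg (fun f => f v) (hT (D.b i) (D.b j))
          simp only [D.lie_eq _ _ i.2, map_smul, LinearMap.smul_apply, LinearMap.sub_apply,
            Module.End.mul_apply, hχ] at h1
          rw [add_smul, h1]
          abel)
    by_cases hb : S' = ⊥
    · rw [hb] at hc
      exact codisjoint_bot.mp hc.codisjoint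
    · obtain ⟨v, hv, hv0, hχ⟩ := exists_forall_apply_eq_smul (fun i : D.Cartan => T (D.b i))
        (fun i j => by
          have h := hT (D.b i) (D.b j)
          rw [D.lie_eq _ _ i.2, D.a_zero _ _ i.2 j.2, zero_smul, map_zero] at h
          exact (sub_eq_zero.mp h.symm)) hb (fun i => hS' _)
      exact absurd (Submodule.disjoint_def.mp hc.disjoint v (Submodule.subset_span hχ) hv) hv0
  let e := Module.Basis.ofSpan hs.ge
  have hfin := Module.Finite.finite_basis e
  let e' := e.reindex (Finite.equivFin _)
  have he : ∀ j, e' j ∈ s := fun j => by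
    rw [Module.Basis.reindex_apply]
    exact Module.Basis.ofSpan_subset hs.ge (Set.mem_range_self _)
  choose wt hwt using he
  exact ⟨_, e', wt, hwt⟩

section Link

variable {A : Type*} [Ring A] [Algebra ℂ A] (π : UniversalEnvelopingAlgebra ℂ g →ₐ[ℂ] A)
  {V : Type*} [AddCommGroup V] [Module A V]
  [Module (Subalgebra.center ℂ (UniversalEnvelopingAlgebra ℂ g)) V]

/-- The cyclic submodule generated by `x` over the enveloping algebra, as a module over its
center. -/
def cyclic (hV : ∀ (z : Subalgebra.center ℂ (UniversalEnvelopingAlgebra ℂ g)) (v : V),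
      z • v = π z • v) (x : V) :
    Submodule (Subalgebra.center ℂ (UniversalEnvelopingAlgebra ℂ g)) V where
  carrier := Set.range fun u => π u • x
  zero_mem' := ⟨0, by simp⟩
  add_mem' := by
    rintro _ _ ⟨u, rfl⟩ ⟨v, rfl⟩
    exact ⟨u + v, by simp [add_smul]⟩
  smul_mem' := by
    rintro z _ ⟨u, rfl⟩
    exact ⟨z * u, by simp [hV, mul_smul]⟩

variable (hV : ∀ (z : Subalgebra.center ℂ (UniversalEnvelopingAlgebra ℂ g)) (v : V),
  z • v = π z • v)

/-- The action of the enveloping algebra on a cyclic submodule. -/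
def cyclicAct (x : V) : UniversalEnvelopingAlgebra ℂ g →+*
    Module.End (Subalgebra.center ℂ (UniversalEnvelopingAlgebra ℂ g)) (cyclic π hV x) where
  toFun u :=
    { toFun := fun y => ⟨π u • (y : V), by
        obtain ⟨_, u', rfl⟩ := y
        exact ⟨u * u', by simp [mul_smul]⟩⟩
      map_add' := fun y y' => Subtype.ext (smul_add _ _ _)
      map_smul' := fun z y => Subtype.ext (by
        have h := congrArg π (Subalgebra.mem_center_iff.mp z.2 u)
        rw [map_mul, map_mul] at h
        simp only [Submodule.coe_smul, hV, RingHom.id_apply]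
        rw [← mul_smul, ← mul_smul, h]) }
  map_one' := by ext; simp
  map_mul' u u' := by ext; simp [mul_smul]
  map_zero' := by ext; simp
  map_add' u u' := by ext; simp [add_smul]

/-- Matrices over the enveloping algebra act on tuples of elements of a cyclic submodule. -/
noncomputable def matrixAct {J : Type*} [Fintype J] [DecidableEq J] (x : V) :
    Matrix J J (UniversalEnvelopingAlgebra ℂ g) →+*
      Module.End (Subalgebra.center ℂ (UniversalEnvelopingAlgebra ℂ g)) (J → cyclic π hV x) :=
  (endVecRingEquivMatrixEnd J _ _).symm.toRingHom.comp (cyclicAct π hV x).mapMatrix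

theorem coe_matrixAct {J : Type*} [Fintype J] [DecidableEq J] (x : V)
    (B : Matrix J J (UniversalEnvelopingAlgebra ℂ g)) (y : J → cyclic π hV x) (k : J) :
    (matrixAct π hV x B y k : V) = ∑ j, π (B k j) • (y j : V) := by
  have : matrixAct π hV x B y k = ∑ j, cyclicAct π hV x (B k j) (y j) := rfl
  rw [this, Submodule.coe_sum]
  rfl

theorem sum_smul_matrixAct_coprodHom [Module ℂ V] [IsScalarTower ℂ A V] {m : ℕ} (f : Fin m → A)
    {τ : g →ₗ[ℂ] Matrix (Fin m) (Fin m) ℂ} (hτ : ∀ x y, τ ⁅x, y⁆ = τ x * τ y - τ y * τ x)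
    (hf : ∀ (y : g) j, π (UniversalEnvelopingAlgebra.ι ℂ y) * f j -
      f j * π (UniversalEnvelopingAlgebra.ι ℂ y) = ∑ k, τ y k j • f k) (x : V)
    (u : UniversalEnvelopingAlgebra ℂ g) (y : Fin m → cyclic π hV x) :
    ∑ k, f k • (matrixAct π hV x (coprodHom τ hτ u) y k : V) = π u • ∑ k, f k • (y k : V) := by
  have hu : u ∈ Submodule.span ℂ (Set.range (word (g := g))) := by rw [span_range_word]; trivial
  induction hu using Submodule.span_induction generalizing y with
  | zero => simp
  | add u v _ _ hu hv =>
    simp only [map_add, LinearMap.add_apply, Pi.add_apply, Submodule.coe_add, smul_add,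
      Finset.sum_add_distrib, hu, hv, add_smul]
  | smul c v _ hv =>
    have h1 : ∀ k, (matrixAct π hV x (coprodHom τ hτ (c • v)) y k : V) =
        c • (matrixAct π hV x (coprodHom τ hτ v) y k : V) := by
      intro k
      simp only [coe_matrixAct, map_smul, Matrix.smul_apply, smul_assoc, Finset.smul_sum]
    have h2 : ∀ (k) (v : V), f k • c • v = c • f k • v := by
      intro k v
      rw [← algebraMap_smul A c v, ← algebraMap_smul A c, ← mul_smul, ← mul_smul,
        Algebra.commutes]
    simp only [h1, h2, ← Finset.smul_sum, hv]
    rw [map_smul, smul_assoc]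
  | mem u hu =>
    obtain ⟨l, rfl⟩ := hu
    induction l generalizing y with
    | nil => simp [word]
    | cons z l ih =>
      rw [word_cons, map_mul, map_mul, map_mul, mul_smul, ← ih]
      simp only [Module.End.mul_apply]
      generalize matrixAct π hV x (coprodHom τ hτ (word l)) y = y
      have h1 : ∀ k, (matrixAct π hV x (coprodHom τ hτ (UniversalEnvelopingAlgebra.ι ℂ z)) y k : V)
          = ∑ j, τ z k j • (y j : V) + π (UniversalEnvelopingAlgebra.ι ℂ z) • (y k : V) := by
        intro k
        rw [coe_matrixAct, coprodHom_ι]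
        simp only [Matrix.add_apply, map_add, add_smul, Finset.sum_add_distrib]
        congr 1
        · refine Finset.sum_congr rfl fun j _ => ?_
          rw [Matrix.map_apply, AlgHom.commutes, algebraMap_smul]
        · rw [Finset.sum_eq_single k]
          · simp
          · intro j _ hj; simp [hj.symm]
          · simp
      simp only [h1, smul_add, Finset.sum_add_distrib, Finset.smul_sum]
      rw [Finset.sum_comm, ← Finset.sum_add_distrib]
      refine Finset.sum_congr rfl fun j _ => ?_
      have h3 := congrArg (· • (y j : V)) (hf z j)
      simp only [sub_smul, mul_smul, Finset.sum_smul, smul_assoc] at h3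
      rw [eq_comm, ← sub_eq_iff_eq_add, h3]
      refine Finset.sum_congr rfl fun k _ => ?_
      rw [← algebraMap_smul A (τ z k j) (y j : V), ← algebraMap_smul A (τ z k j) (_ • _), ← mul_smul,
        ← mul_smul, Algebra.commutes]

open Classical in
theorem isLinked [Fintype I] [Module ℂ V] [IsScalarTower ℂ A V]
    (hV : ∀ (z : Subalgebra.center ℂ (UniversalEnvelopingAlgebra ℂ g)) (v : V), z • v = π z • v) {m : ℕ} (f : Fin m → A)
    {τ : g →ₗ[ℂ] Matrix (Fin m) (Fin m) ℂ} (hτ : ∀ x y, τ ⁅x, y⁆ = τ x * τ y - τ y * τ x)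
    (hf : ∀ (y : g) j, π (UniversalEnvelopingAlgebra.ι ℂ y) * f j -
      f j * π (UniversalEnvelopingAlgebra.ι ℂ y) = ∑ k, τ y k j • f k)
    {wt : Fin m → D.Cartan → ℂ}
    (hwt : ∀ i : D.Cartan, τ (D.b i) = Matrix.diagonal fun j => wt j i) (x : V) {a : A}
    (ha : a ∈ Submodule.span ℂ (Set.range f)) :
    IsLinked (Algebra.TensorProduct.includeLeft (R := ℂ) (S := ℂ)).toRingHom
      (Algebra.TensorProduct.includeRight (R := ℂ)).toRingHom (shiftGraph D.hc) x (a • x) := by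
  refine ⟨m, cyclic π hV x, (matrixAct π hV x).comp (centerCoprod τ hτ).toRingHom,
    Finset.univ.image wt,
    { toFun := fun y => ∑ k, f k • (y k : V)
      map_zero' := by simp
      map_add' := fun y y' => by simp [smul_add, Finset.sum_add_distrib] }, ?_, ?_, ?_, ?_, ?_⟩
  · intro w hw
    have := D.centerCoprod_eq_zero hτ hwt hw
    simp [this]
  · intro z y
    funext k
    apply Subtype.ext
    have h1 : centerCoprod τ hτ (1 ⊗ₜ z) = Matrix.scalar _ (z : UniversalEnvelopingAlgebra ℂ g) := by
      rw [centerCoprod_tmul]; simp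
    change (matrixAct π hV x (centerCoprod τ hτ (1 ⊗ₜ z)) y k : V) = z • (y k : V)
    rw [h1, coe_matrixAct, Finset.sum_eq_single k]
    · simp [hV]
    · intro j _ hj; simp [hj.symm]
    · simp
  · intro z y
    have h1 : centerCoprod τ hτ (z ⊗ₜ 1) = coprodHom τ hτ (z : UniversalEnvelopingAlgebra ℂ g) := by
      rw [centerCoprod_tmul]; simp
    change ∑ k, f k • (matrixAct π hV x (centerCoprod τ hτ (z ⊗ₜ 1)) y k : V) = _
    rw [h1, sum_smul_matrixAct_coprodHom π hV f hτ hf, hV]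
    rfl
  · obtain ⟨c, rfl⟩ := (Submodule.mem_span_range_iff_exists_fun ℂ).mp ha
    refine ⟨fun k => ⟨π (algebraMap ℂ _ (c k)) • x, _, rfl⟩, ?_⟩
    change ∑ k, f k • (π (algebraMap ℂ _ (c k)) • x) = _
    rw [Finset.sum_smul]
    refine Finset.sum_congr rfl fun k _ => ?_
    rw [AlgHom.commutes, ← mul_smul, ← Algebra.commutes, mul_smul, algebraMap_smul, smul_assoc]
  · rintro z hz _ ⟨u, rfl⟩
    have h := congrArg π (Subalgebra.mem_center_iff.mp z.2 u)
    rw [map_mul, map_mul] at h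
    simp only [hV] at hz ⊢
    rw [← mul_smul, ← h, mul_smul, hz, smul_zero]

/-- Consequence of complete reducibility of the adjoint action on `A`: any two vectors of a simple
module are linked. -/
theorem isLinked_of_irreducible [Fintype I] [Module ℂ V] [IsScalarTower ℂ A V]
    (hV : ∀ (z : Subalgebra.center ℂ (UniversalEnvelopingAlgebra ℂ g)) (v : V), z • v = π z • v)
    (hadj : ∀ a : A, ∃ F : Submodule ℂ A, FiniteDimensional ℂ F ∧ a ∈ F ∧
      (∀ y : g, ∀ b ∈ F, π (UniversalEnvelopingAlgebra.ι ℂ y) * b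
        - b * π (UniversalEnvelopingAlgebra.ι ℂ y) ∈ F) ∧
      (∀ S : Submodule ℂ A, S ≤ F →
        (∀ y : g, ∀ b ∈ S, π (UniversalEnvelopingAlgebra.ι ℂ y) * b
          - b * π (UniversalEnvelopingAlgebra.ι ℂ y) ∈ S) →
        ∃ S' : Submodule ℂ A, S' ≤ F ∧
          (∀ y : g, ∀ b ∈ S', π (UniversalEnvelopingAlgebra.ι ℂ y) * b
            - b * π (UniversalEnvelopingAlgebra.ι ℂ y) ∈ S') ∧
          S ⊓ S' = ⊥ ∧ S ⊔ S' = F))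
    (hirr : ∀ N : Submodule A V, N = ⊥ ∨ N = ⊤) {x : V} (hx : x ≠ 0) (x' : V) :
    IsLinked (Algebra.TensorProduct.includeLeft (R := ℂ) (S := ℂ)).toRingHom
      (Algebra.TensorProduct.includeRight (R := ℂ)).toRingHom (shiftGraph D.hc) x x' := by
  have h1 : Submodule.span A {x} = ⊤ :=
    (hirr _).resolve_left (by rwa [Submodule.span_singleton_eq_bot])
  obtain ⟨a, rfl⟩ := Submodule.mem_span_singleton.mp (h1.ge (Submodule.mem_top (x := x')))
  obtain ⟨F, _, ha, hF, hcompl⟩ := hadj a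
  let T₀ : g →ₗ[ℂ] Module.End ℂ A :=
    (LinearMap.mul ℂ A - (LinearMap.mul ℂ A).flip) ∘ₗ π.toLinearMap ∘ₗ
      (UniversalEnvelopingAlgebra.ι ℂ : g →ₗ⁅ℂ⁆ UniversalEnvelopingAlgebra ℂ g).toLinearMap
  have hT₀ : ∀ y b, T₀ y b = π (UniversalEnvelopingAlgebra.ι ℂ y) * b
        - b * π (UniversalEnvelopingAlgebra.ι ℂ y) := fun y b => rfl
  let T : g →ₗ[ℂ] Module.End ℂ F :=
    { toFun := fun y => (T₀ y).restrict (hF y)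
      map_add' := fun y z => by ext; simp; rfl
      map_smul' := fun c y => by ext; simp; rfl }
  have hT' : ∀ y b, (T y b : A) = T₀ y b := fun y b => rfl
  have hT : ∀ y z, T ⁅y, z⁆ = T y * T z - T z * T y := by
    intro y z
    ext b
    simp only [LinearMap.sub_apply, Module.End.mul_apply, Submodule.coe_sub, hT', hT₀,
      LieHom.map_lie, LieRing.of_associative_ring_bracket, map_sub, map_mul]
    noncomm_ring
  obtain ⟨m, e, wt, hwt⟩ := D.exists_weightBasis T hT (by
    intro S hS
    obtain ⟨S', hS'F, hS', hinf, hsup⟩ := hcompl (S.map F.subtype) (Submodule.map_subtype_le _ _) (by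
      rintro y _ ⟨b, hb, rfl⟩
      exact ⟨_, hS y b hb, rfl⟩)
    refine ⟨S'.comap F.subtype, fun y b hb => hS' y _ hb, ?_, ?_⟩
    · rw [Submodule.disjoint_def]
      intro b hb hb'
      have : (b : A) ∈ S.map F.subtype ⊓ S' := ⟨⟨b, hb, rfl⟩, hb'⟩
      rw [hinf] at this
      exact Subtype.ext this
    · rw [codisjoint_iff, eq_top_iff]
      rintro b -
      have hb : (b : A) ∈ S.map F.subtype ⊔ S' := hsup.ge b.2
      obtain ⟨_, ⟨s, hs, rfl⟩, t, ht, hst⟩ := Submodule.mem_sup.mp hb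
      exact Submodule.mem_sup.mpr ⟨s, hs, ⟨t, hS'F ht⟩, ht, Subtype.ext hst⟩)
  let τ : g →ₗ[ℂ] Matrix (Fin m) (Fin m) ℂ := (LinearMap.toMatrix e e).toLinearMap ∘ₗ T
  have hτ : ∀ y, τ y = LinearMap.toMatrix e e (T y) := fun _ => rfl
  refine D.isLinked π hV (τ := τ) (wt := wt) (fun j => (e j : A)) ?_ ?_ ?_ x ?_
  · intro y z
    rw [hτ, hτ, hτ, hT, map_sub, LinearMap.toMatrix_mul, LinearMap.toMatrix_mul]
  · intro y j
    rw [← hT₀, ← hT', ← e.sum_repr (T y (e j)), Submodule.coe_sum]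
    refine Finset.sum_congr rfl fun k _ => ?_
    rw [hτ, LinearMap.toMatrix_apply]
    rfl
  · intro i
    ext k j
    rw [hτ, LinearMap.toMatrix_apply, hwt, map_smul, Matrix.diagonal_apply]
    by_cases hkj : k = j
    · subst hkj; simp
    · simp [hkj]
  · have : Set.range (fun j => (e j : A)) = F.subtype '' Set.range e := by
      rw [← Set.range_comp]; rfl
    rw [this, Submodule.span_image, e.span_eq]
    exact ⟨⟨a, ha⟩, trivial, rfl⟩

end Link

end TriangularData

end Triangular

/-- A semisimple complex Lie algebra has a basis of root vectors, together with a regular element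
whose eigenvalues have nonzero real part on root spaces. -/
theorem LieAlgebra.IsKilling.exists_rootBasis (s : Type*) [LieRing s] [LieAlgebra ℂ s]
    [FiniteDimensional ℂ s] [LieAlgebra.IsKilling ℂ s] :
    ∃ (n : ℕ) (b : Module.Basis (Fin n) ℂ s) (c : Fin n → ℂ) (a : Fin n → Fin n → ℂ) (h : s),
      (∀ i, c i ≠ 0 → (c i).re ≠ 0) ∧ (∀ i j, c i = 0 → ⁅b i, b j⁆ = a i j • b j) ∧
      (∀ i j, c i = 0 → c j = 0 → a i j = 0) ∧ ∀ j, ⁅h, b j⁆ = c j • b j := by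
  classical
  obtain ⟨x, hx⟩ := LieAlgebra.exists_isCartanSubalgebra_engel ℂ s
  set H := LieSubalgebra.engel ℂ x
  let re : (LieModule.Weight ℂ H s) → Module.Dual ℝ H := fun α =>
    Complex.reLm.comp ((LieModule.Weight.toLinear ℂ H s α).restrictScalars ℝ)
  have hre : ∀ α y, re α y = (α y).re := fun _ _ => rfl
  obtain ⟨h, hh⟩ := Module.Dual.exists_forall_ne_zero_of_forall_exists
    (fun α : {α : LieModule.Weight ℂ H s // (α : H → ℂ) ≠ 0} => re α) (by
      rintro ⟨α, hα⟩
      obtain ⟨y, hy⟩ := Function.ne_iff.mp hα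
      by_cases h0 : (α y).re = 0
      · refine ⟨Complex.I • y, ?_⟩
        have h1 : α (Complex.I • y) = Complex.I • α y :=
          (LieModule.Weight.toLinear ℂ H s α).map_smul _ _
        rw [hre, h1]
        intro h2
        refine hy (Complex.ext h0 ?_)
        simpa using h2
      · exact ⟨y, h0⟩)
  let t : Set s := {v | ∃ α : LieModule.Weight ℂ H s, v ∈ LieAlgebra.rootSpace H α}
  have ht : Submodule.span ℂ t = ⊤ := by
    rw [eq_top_iff, ← LieSubmodule.top_toSubmodule (R := ℂ) (L := H) (M := s),
      ← LieModule.iSup_genWeightSpace_eq_top' ℂ H s, LieSubmodule.iSup_toSubmodule]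
    exact iSup_le fun α v hv => Submodule.subset_span ⟨α, hv⟩
  let e := Module.Basis.ofSpan ht.ge
  have hfin := Module.Finite.finite_basis e
  let b := e.reindex (Finite.equivFin _)
  have hb : ∀ j, b j ∈ t := fun j => by
    rw [Module.Basis.reindex_apply]
    exact Module.Basis.ofSpan_subset ht.ge (Set.mem_range_self _)
  choose α hα using hb
  have hH : ∀ j, (α j h).re = 0 → (α j : H → ℂ) = 0 := by
    intro j h1
    by_contra h2
    exact hh ⟨α j, h2⟩ h1
  have hbH : ∀ j, α j h = 0 → b j ∈ H := by
    intro j h1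
    have h2 := hα j
    rw [hH j (by rw [h1]; rfl), LieAlgebra.rootSpace_zero_eq] at h2
    exact h2
  refine ⟨_, b, fun j => α j h,
    fun i j => if hi : α i h = 0 then α j ⟨b i, hbH i hi⟩ else 0, h, ?_, ?_, ?_, ?_⟩
  · intro i hi h0
    exact hi (congrFun (hH i h0) h)
  · intro i j hi
    simp only [dif_pos hi]
    exact LieAlgebra.IsKilling.lie_eq_smul_of_mem_rootSpace (hα j) ⟨b i, hbH i hi⟩
  · intro i j hi hj
    simp only [dif_pos hi]
    exact congrFun (hH j (congrArg Complex.re hj)) _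
  · intro j
    exact LieAlgebra.IsKilling.lie_eq_smul_of_mem_rootSpace (hα j) h

/-- The product of an abelian and a semisimple Lie algebra has triangular data. -/
theorem exists_triangularData (r s : Type*) [LieRing r] [LieAlgebra ℂ r] [FiniteDimensional ℂ r]
    [IsLieAbelian r] [LieRing s] [LieAlgebra ℂ s] [FiniteDimensional ℂ s]
    [LieAlgebra.IsKilling ℂ s] :
    ∃ m n k : ℕ, Nonempty (TriangularData (r × s) (Fin m) (Fin n ⊕ Fin k)) := by
  classical
  obtain ⟨k, b, c, a, h, hre, hlie, ha, hh⟩ := LieAlgebra.IsKilling.exists_rootBasis s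
  let br := Module.finBasis ℂ r
  set n := Module.finrank ℂ r
  let B := br.prod b
  let C : Fin n ⊕ Fin k → ℂ := Sum.elim 0 c
  have hlie' : ∀ i j, C i = 0 → ∃ t : ℂ, ⁅B i, B j⁆ = t • B j ∧ (C j = 0 → t = 0) := by
    rintro (i | i) (j | j) hi
    · exact ⟨0, by simp [B, trivial_lie_zero], fun _ => rfl⟩
    · exact ⟨0, by simp [B], fun _ => rfl⟩
    · exact ⟨0, by simp [B], fun _ => rfl⟩
    · exact ⟨a i j, by simp [B, hlie i j hi], ha i j hi⟩
  have hh' : ∀ j, ⁅((0, h) : r × s), B j⁆ = C j • B j := by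
    rintro (j | j)
    · simp [B, C]
    · simp [B, C, hh]
  choose a' ha' hz' using hlie'
  let ρ : r × s →ₗ[ℂ] Matrix (Fin n ⊕ Fin k) (Fin n ⊕ Fin k) ℂ :=
    { toFun := fun x => Matrix.fromBlocks (Matrix.diagonal (br.repr x.1)) 0 0
        (LinearMap.toMatrix b b (LieAlgebra.ad ℂ s x.2))
      map_add' := fun x y => by
        rw [Matrix.fromBlocks_add]
        simp
      map_smul' := fun t x => by
        rw [RingHom.id_apply, Matrix.fromBlocks_smul]
        simp }
  have hρ : ∀ x, ρ x = Matrix.fromBlocks (Matrix.diagonal (br.repr x.1)) 0 0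
        (LinearMap.toMatrix b b (LieAlgebra.ad ℂ s x.2)) := fun _ => rfl
  let σ : Fin (n + k) ≃ Fin n ⊕ Fin k :=
    (Tuple.sort fun i => (C (finSumFinEquiv.symm i)).re).trans finSumFinEquiv.symm
  have hσ : Monotone fun i => (C (σ i)).re := Tuple.monotone_sort
    fun i => (C (finSumFinEquiv.symm i)).re
  refine ⟨n + k, n, k, ⟨{
    b := B.reindex σ.symm
    c := C ∘ σ
    re_ne := ?_
    mono := fun i j hij => hσ hij
    a := fun i j => if hi : C (σ i) = 0 then a' (σ i) (σ j) hi else 0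
    lie_eq := ?_
    a_zero := ?_
    h := (0, h)
    h_mem := ?_
    lie_h := ?_
    ρ := ρ
    ρ_lie := ?_
    ρ_diag := ?_
    nondeg := ?_ }⟩⟩
  · intro i
    rw [Function.comp_apply]
    generalize σ i = i
    rcases i with i | i
    · simp [C]
    · exact hre i
  · intro i j hi
    rw [Function.comp_apply] at hi
    simp only [dif_pos hi, Module.Basis.reindex_apply, Equiv.symm_symm]
    exact ha' _ _ hi
  · intro i j hi hj
    rw [Function.comp_apply] at hi hj
    simp only [dif_pos hi]
    exact hz' _ _ _ hj
  · have h1 : ((0, h) : r × s) ∈ Submodule.span ℂ (B '' {i | C i = 0}) := by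
      rw [Module.Basis.mem_span_image]
      intro j hj
      have h2 : ∑ i, B.repr (0, h) i • C i • B i = 0 := by
        have : ⁅((0, h) : r × s), ((0, h) : r × s)⁆ = 0 := lie_self _
        nth_rewrite 2 [← B.sum_repr (0, h)] at this
        rw [lie_sum] at this
        simpa only [lie_smul, hh'] using this
      simp only [smul_smul] at h2
      have h3 := Fintype.linearIndependent_iff.mp B.linearIndependent _ h2 j
      exact (mul_eq_zero.mp h3).resolve_left (Finsupp.mem_support_iff.mp hj)
    refine Submodule.span_mono ?_ h1
    rintro _ ⟨i, hi, rfl⟩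
    exact ⟨σ.symm i, by simpa using hi, by simp⟩
  · intro j
    simp [hh']
  · intro x y
    simp only [hρ, Matrix.fromBlocks_multiply, LieAlgebra.Prod.bracket_apply, trivial_lie_zero,
      LieHom.map_lie, LieRing.of_associative_ring_bracket, map_sub, LinearMap.toMatrix_mul]
    ext (i | i) (j | j) <;> simp [mul_comm]
  · intro i
    rw [Function.comp_apply, Module.Basis.reindex_apply, Equiv.symm_symm]
    generalize σ i = i
    intro hi
    rw [hρ]
    refine Matrix.IsDiag.fromBlocks (Matrix.isDiag_diagonal _) ?_
    rcases i with i | i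
    · simp [B, Matrix.IsDiag, Pairwise]
    · intro p q hpq
      simp [B, LinearMap.toMatrix_apply, hlie i q hi, Ne.symm hpq]
  · intro x hx
    refine Prod.ext ?_ ?_
    · change x.1 = 0
      rw [← br.repr.map_eq_zero_iff]
      ext i
      simpa [hρ, Matrix.fromBlocks_multiply, Matrix.trace, Finsupp.single_apply] using hx (br i, 0)
    · have h1 : x.2 ∈ LinearMap.ker (killingForm ℂ s) := by
        refine LinearMap.ext fun y => ?_
        have h2 := hx (0, y)
        simp only [hρ, Matrix.fromBlocks_multiply, Matrix.trace, Fintype.sum_sum_type,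
          ← LinearMap.toMatrix_mul, Matrix.diag_apply, Matrix.fromBlocks_apply₁₁,
          Matrix.fromBlocks_apply₂₂] at h2
        rw [LieModule.traceForm_apply_apply, LinearMap.trace_eq_matrix_trace ℂ b]
        simp at h2
        exact h2
      rwa [LieAlgebra.IsKilling.ker_killingForm_eq_bot] at h1

section Reductive

variable {g : Type*} [LieRing g] [LieAlgebra ℂ g]

theorem lie_eq_zero_of_disjoint {I J : LieIdeal ℂ g} (h : Disjoint I J) {x y : g} (hx : x ∈ I)
    (hy : y ∈ J) : ⁅x, y⁆ = 0 := by
  have h1 : ⁅x, y⁆ ∈ I ⊓ J := ⟨lie_mem_left ℂ g I x y hx, lie_mem_right ℂ g J x y hy⟩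
  rwa [h.eq_bot] at h1

theorem isLieAbelian_radical [FiniteDimensional ℂ g] [ComplementedLattice (LieIdeal ℂ g)] :
    IsLieAbelian (LieAlgebra.radical ℂ g) := by
  set r := LieAlgebra.radical ℂ g
  obtain ⟨J, hJ⟩ := exists_isCompl ⁅r, r⁆
  have hr : ⁅r, r⁆ ≤ r := LieSubmodule.lie_le_right r r
  have h1 : r ≤ ⁅r, r⁆ ⊔ J ⊓ r := by
    rw [← sup_inf_assoc_of_le J hr, hJ.sup_eq_top, top_inf_eq]
  have h2 : ⁅r, J ⊓ r⁆ = ⊥ := by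
    rw [eq_bot_iff, ← hJ.inf_eq_bot]
    exact le_inf (LieSubmodule.mono_lie le_rfl inf_le_right)
      ((LieSubmodule.lie_le_right _ _).trans inf_le_left)
  have h3 : ⁅⁅r, r⁆, ⁅r, r⁆⁆ = ⁅r, r⁆ := by
    refine le_antisymm (LieSubmodule.mono_lie hr hr) ?_
    have h4 : ⁅r, r⁆ ≤ ⁅r, ⁅r, r⁆⁆ := by
      calc ⁅r, r⁆ ≤ ⁅r, ⁅r, r⁆ ⊔ J ⊓ r⁆ := LieSubmodule.mono_lie le_rfl h1
        _ = ⁅r, ⁅r, r⁆⁆ := by rw [LieSubmodule.lie_sup, h2, sup_bot_eq]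
    calc ⁅r, r⁆ ≤ ⁅r, ⁅r, r⁆⁆ := h4
      _ ≤ ⁅⁅r, r⁆ ⊔ J ⊓ r, ⁅r, r⁆⁆ := LieSubmodule.mono_lie h1 le_rfl
      _ = ⁅⁅r, r⁆, ⁅r, r⁆⁆ ⊔ ⁅J ⊓ r, ⁅r, r⁆⁆ := LieSubmodule.sup_lie _ _ _
      _ ≤ ⁅⁅r, r⁆, ⁅r, r⁆⁆ ⊔ ⊥ := by
        refine sup_le_sup le_rfl ?_
        rw [← h2, LieSubmodule.lie_comm]
        exact LieSubmodule.mono_lie hr le_rfl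
      _ = _ := sup_bot_eq _
  have h4 : ∀ k, LieAlgebra.derivedSeriesOfIdeal ℂ g (k + 1) r = ⁅r, r⁆ := by
    intro k
    induction k with
    | zero => simp
    | succ k ih => rw [LieAlgebra.derivedSeriesOfIdeal_succ, ih, h3]
  have h5 : LieAlgebra.IsSolvable r := LieAlgebra.radicalIsSolvable ℂ g
  obtain ⟨k, hk⟩ := (LieAlgebra.isSolvable_iff ℂ r).mp h5
  rw [LieIdeal.derivedSeries_eq_bot_iff] at hk
  rw [LieSubmodule.lie_abelian_iff_lie_self_eq_bot, ← h4 k, eq_bot_iff, ← hk]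
  exact LieAlgebra.derivedSeriesOfIdeal_antitone r (Nat.le_succ k)

theorem isKilling_of_isCompl_radical [FiniteDimensional ℂ g] {s : LieIdeal ℂ g}
    (h : IsCompl (LieAlgebra.radical ℂ g) s) : LieAlgebra.IsKilling ℂ s := by
  have h1 : LieAlgebra.HasTrivialRadical ℂ s := by
    rw [LieAlgebra.hasTrivialRadical_iff_no_abelian_ideals]
    intro I hI
    let K : LieIdeal ℂ g :=
      { (I.toSubmodule.map s.toSubmodule.subtype) with
        lie_mem := by
          rintro z _ ⟨y, hy, rfl⟩
          have hz : z ∈ LieAlgebra.radical ℂ g ⊔ s := by rw [h.sup_eq_top]; trivial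
          obtain ⟨x', hx', y', hy', rfl⟩ := (LieSubmodule.mem_sup _ _ _).mp hz
          refine ⟨⁅(⟨y', hy'⟩ : s), y⁆, lie_mem_right ℂ s I _ _ hy, ?_⟩
          change ⁅y', (y : g)⁆ = ⁅x' + y', (y : g)⁆
          rw [add_lie, lie_eq_zero_of_disjoint h.disjoint hx' y.2, zero_add] }
    have hK : IsLieAbelian K := by
      refine ⟨?_⟩
      rintro ⟨_, ⟨y, hy, rfl⟩⟩ ⟨_, ⟨z, hz, rfl⟩⟩
      have h2 : ⁅(⟨y, hy⟩ : I), (⟨z, hz⟩ : I)⁆ = 0 := trivial_lie_zero _ _ _ _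
      have h3 := congrArg (fun t : I => ((t : s) : g)) h2
      exact Subtype.ext h3
    have hKr : K ≤ LieAlgebra.radical ℂ g :=
      (LieAlgebra.LieIdeal.solvable_iff_le_radical ℂ g K).mp inferInstance
    rw [eq_bot_iff]
    intro y hy
    have h2 : (y : g) ∈ LieAlgebra.radical ℂ g ⊓ s := ⟨hKr ⟨y, hy, rfl⟩, y.2⟩
    rw [h.inf_eq_bot] at h2
    exact Subtype.ext h2
  infer_instance

/-- The sum map from the product of complementary ideals. -/
def addLieHom {r s : LieIdeal ℂ g} (h : Disjoint r s) : (r × s) →ₗ⁅ℂ⁆ g :=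
  { r.toSubmodule.subtype.coprod s.toSubmodule.subtype with
    map_lie' := by
      rintro ⟨x, y⟩ ⟨x', y'⟩
      change ⁅(x : g), (x' : g)⁆ + ⁅(y : g), (y' : g)⁆ = ⁅(x : g) + y, (x' : g) + y'⁆
      rw [add_lie, lie_add, lie_add, lie_eq_zero_of_disjoint h x.2 y'.2,
        lie_eq_zero_of_disjoint h.symm y.2 x'.2, add_zero, zero_add] }

theorem addLieHom_bijective {r s : LieIdeal ℂ g} (h : IsCompl r s) :
    Function.Bijective (addLieHom h.disjoint) := by
  have h1 : ∀ x : r × s, addLieHom h.disjoint x = x.1 + x.2 := fun _ => rfl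
  constructor
  · rw [injective_iff_map_eq_zero]
    rintro ⟨x, y⟩ hxy
    rw [h1] at hxy
    have h2 : (x : g) ∈ r ⊓ s := ⟨x.2, by
      rw [eq_neg_of_add_eq_zero_left hxy]; exact neg_mem y.2⟩
    rw [h.inf_eq_bot] at h2
    have h3 : (x : g) = 0 := h2
    rw [h3, zero_add] at hxy
    exact Prod.ext (Subtype.ext h3) (Subtype.ext hxy)
  · intro z
    have hz : z ∈ r ⊔ s := by rw [h.sup_eq_top]; trivial
    obtain ⟨x, hx, y, hy, rfl⟩ := (LieSubmodule.mem_sup _ _ _).mp hz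
    exact ⟨(⟨x, hx⟩, ⟨y, hy⟩), rfl⟩

end Reductive

section LocallyFinite

/-- A space that is a union of completely reducible pieces is completely reducible. -/
theorem exists_isCompl_of_locally_complemented {K W X : Type*} [Field K] [AddCommGroup W]
    [Module K W] (T : X → Module.End K W)
    (h : ∀ a : W, ∃ F : Submodule K W, a ∈ F ∧ (∀ x, ∀ b ∈ F, T x b ∈ F) ∧
      ∀ S ≤ F, (∀ x, ∀ b ∈ S, T x b ∈ S) →
        ∃ S' ≤ F, (∀ x, ∀ b ∈ S', T x b ∈ S') ∧ S ⊓ S' = ⊥ ∧ S ⊔ S' = F)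
    (S : Submodule K W) (hS : ∀ x, ∀ b ∈ S, T x b ∈ S) :
    ∃ S' : Submodule K W, (∀ x, ∀ b ∈ S', T x b ∈ S') ∧ IsCompl S S' := by
  let R := Algebra.adjoin K (Set.range T)
  have hR : ∀ (S : Submodule K W), (∀ x, ∀ b ∈ S, T x b ∈ S) → ∀ (r : R), ∀ b ∈ S, r • b ∈ S := by
    rintro S hS ⟨r, hr⟩ b hb
    change r b ∈ S
    induction hr using Algebra.adjoin_induction generalizing b with
    | mem r hr => obtain ⟨x, rfl⟩ := hr; exact hS x b hb
    | algebraMap c => exact S.smul_mem c hb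
    | add r r' _ _ h h' => exact add_mem (h b hb) (h' b hb)
    | mul r r' _ _ h h' => exact h _ (h' b hb)
  let up (S : Submodule K W) (hS : ∀ x, ∀ b ∈ S, T x b ∈ S) : Submodule R W :=
    { S with smul_mem' := fun r b hb => hR S hS r b hb }
  have hT : ∀ (N : Submodule R W) x, ∀ b ∈ N, T x b ∈ N := fun N x b hb =>
    N.smul_mem (⟨T x, Algebra.subset_adjoin ⟨x, rfl⟩⟩ : R) hb
  choose F haF hF hFc using h
  have h1 : ComplementedLattice (Submodule R W) := by
    refine complementedLattice_of_complementedLattice_Iic (s := Set.univ)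
      (f := fun a => up (F a) (hF a)) (fun a _ => ⟨?_⟩) ?_
    · rintro ⟨N, hN⟩
      obtain ⟨S', hS'F, hS', hi, hs⟩ := hFc a (N.restrictScalars K) hN (hT N)
      refine ⟨⟨up S' hS', hS'F⟩, ?_⟩
      rw [isCompl_iff, disjoint_iff, codisjoint_iff]
      constructor
      · refine Subtype.ext (eq_bot_iff.mpr fun b hb => ?_)
        exact hi.le hb
      · refine Subtype.ext (le_antisymm (sup_le hN hS'F) fun b hb => ?_)
        obtain ⟨y, hy, z, hz, rfl⟩ := Submodule.mem_sup.mp (hs.ge hb)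
        exact Submodule.add_mem_sup (S := N) (T := up S' hS') hy hz
    · rw [eq_top_iff]
      intro a _
      exact le_iSup₂ (f := fun a (_ : a ∈ Set.univ) => up (F a) (hF a)) a trivial (haF a)
  obtain ⟨N, hN⟩ := exists_isCompl (up S hS)
  refine ⟨N.restrictScalars K, hT N, ?_⟩
  rw [isCompl_iff, disjoint_iff, codisjoint_iff]
  constructor
  · exact eq_bot_iff.mpr fun b hb => hN.inf_eq_bot.le hb
  · refine eq_top_iff.mpr fun b _ => ?_
    obtain ⟨y, hy, z, hz, rfl⟩ := Submodule.mem_sup.mp (hN.sup_eq_top.ge (Submodule.mem_top (x := b)))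
    exact Submodule.add_mem_sup (T := N.restrictScalars K) hy hz

attribute [local instance] LieRing.ofAssociativeRing

/-- A Lie subalgebra of an associative algebra whose adjoint action on the algebra is locally
completely reducible has complemented ideals. -/
theorem complementedLattice_lieIdeal {A : Type*} [Ring A] [Algebra ℂ A] (g : LieSubalgebra ℂ A)
    (h : ∀ S : Submodule ℂ A, (∀ x ∈ g, ∀ b ∈ S, x * b - b * x ∈ S) →
      ∃ S' : Submodule ℂ A, (∀ x ∈ g, ∀ b ∈ S', x * b - b * x ∈ S') ∧ IsCompl S S') :
    ComplementedLattice (LieIdeal ℂ g) := by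
  refine ⟨fun J => ?_⟩
  obtain ⟨S', hS', hc⟩ := h (J.toSubmodule.map g.toSubmodule.subtype) (by
    rintro x hx _ ⟨y, hy, rfl⟩
    exact ⟨⁅(⟨x, hx⟩ : g), y⁆, lie_mem_right ℂ g J _ _ hy, rfl⟩)
  let J' : LieIdeal ℂ g :=
    { S'.comap g.toSubmodule.subtype with
      lie_mem := fun {x y} hy => hS' x x.2 y hy }
  refine ⟨J', ?_⟩
  rw [isCompl_iff, disjoint_iff, codisjoint_iff]
  constructor
  · rw [eq_bot_iff]
    rintro y ⟨hy, hy'⟩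
    have h1 : (y : A) ∈ J.toSubmodule.map g.toSubmodule.subtype ⊓ S' := ⟨⟨y, hy, rfl⟩, hy'⟩
    rw [hc.inf_eq_bot] at h1
    exact Subtype.ext h1
  · rw [eq_top_iff]
    intro z _
    obtain ⟨_, ⟨y, hy, rfl⟩, w, hw, hyw⟩ :=
      Submodule.mem_sup.mp (hc.sup_eq_top.ge (Submodule.mem_top (x := (z : A))))
    refine (LieSubmodule.mem_sup _ _ _).mpr ⟨y, hy, z - y, ?_, by abel⟩
    change ((z : A) - y) ∈ S'
    rwa [← hyw, Submodule.subtype_apply, add_sub_cancel_left]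

end LocallyFinite

section Assembly

/-- If a localized module equals its multiple by the maximal ideal, then every element of the
module lies in the multiple by the prime up to a denominator. -/
theorem exists_smul_mem_of_localized_smul_top_eq_top {R V : Type*} [CommRing R] [AddCommGroup V]
    [Module R V] (P : Ideal R) [P.IsPrime]
    (h : (P.map (algebraMap R (Localization P.primeCompl))) •
      (⊤ : Submodule (Localization P.primeCompl) (LocalizedModule P.primeCompl V)) = ⊤) (x : V) :
    ∃ s ∉ P, s • x ∈ P • (⊤ : Submodule R V) := by
  have key : ∀ w ∈ (P.map (algebraMap R (Localization P.primeCompl))) •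
      (⊤ : Submodule (Localization P.primeCompl) (LocalizedModule P.primeCompl V)),
      ∃ y ∈ P • (⊤ : Submodule R V), ∃ t, w = LocalizedModule.mk y t := by
    intro w hw
    induction hw using Submodule.smul_induction_on' with
    | smul r hr w _ =>
      induction w using LocalizedModule.induction_on with
      | h y t =>
        obtain ⟨⟨⟨a, ha⟩, s⟩, hs⟩ := (IsLocalization.mem_map_algebraMap_iff P.primeCompl _).mp hr
        have hr' : r = Localization.mk a s := by
          rw [Localization.mk_eq_mk', IsLocalization.eq_mk'_iff_mul_eq]
          exact hs
        exact ⟨a • y, Submodule.smul_mem_smul ha trivial, s * t, by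
          rw [hr', LocalizedModule.mk_smul_mk]⟩
    | add w _ w' _ ih ih' =>
      obtain ⟨y, hy, t, rfl⟩ := ih
      obtain ⟨y', hy', t', rfl⟩ := ih'
      exact ⟨t' • y + t • y', add_mem (Submodule.smul_mem _ (t' : R) hy)
        (Submodule.smul_mem _ (t : R) hy'), t * t', LocalizedModule.mk_add_mk⟩
  obtain ⟨y, hy, t, hxy⟩ := key (LocalizedModule.mk x 1) (h.ge trivial)
  obtain ⟨u, hu⟩ := LocalizedModule.mk_eq.mp hxy
  refine ⟨(u * t : P.primeCompl), (u * t).2, ?_⟩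
  have h1 : ((u * t : P.primeCompl) : R) • x = (u : R) • y := by
    rw [one_smul] at hu
    rw [Submonoid.coe_mul, mul_smul]
    exact hu
  rw [h1]
  exact Submodule.smul_mem _ _ hy

theorem smul_mem_map_smul_top {R Z V : Type*} [CommRing R] [CommRing Z] [AddCommGroup V]
    [Module R V] [Module Z V] (ρ : R →+* Z) (hρ : ∀ (r : R) (v : V), ρ r • v = r • v)
    (P : Ideal R) {x : V} (hx : x ∈ P • (⊤ : Submodule R V)) :
    x ∈ (P.map ρ) • (⊤ : Submodule Z V) := by
  induction hx using Submodule.smul_induction_on' with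
  | smul r hr w _ =>
    rw [← hρ]
    exact Submodule.smul_mem_smul (Ideal.mem_map_of_mem ρ hr) trivial
  | add w _ w' _ ih ih' => exact add_mem ih ih'

/-- The map on centres induced by a surjective ring homomorphism. -/
def centerMap {S T : Type*} [Ring S] [Ring T] [Algebra ℂ T] (F : S →+* T)
    (hF : Function.Surjective F) : Subring.center S →+* Subalgebra.center ℂ T where
  toFun z := ⟨F z, by
    rw [Subalgebra.mem_center_iff]
    intro t
    obtain ⟨s, rfl⟩ := hF t
    rw [← map_mul, ← map_mul, Subring.mem_center_iff.mp z.2 s]⟩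
  map_one' := Subtype.ext (map_one F)
  map_mul' x y := Subtype.ext (map_mul F (x : S) y)
  map_zero' := Subtype.ext (map_zero F)
  map_add' x y := Subtype.ext (map_add F (x : S) y)

attribute [local instance] LieRing.ofAssociativeRing

/-- The algebra map induced by a map of Lie algebras. -/
noncomputable def mapEnveloping {g g' : Type*} [LieRing g] [LieAlgebra ℂ g] [LieRing g']
    [LieAlgebra ℂ g'] (f : g →ₗ⁅ℂ⁆ g') :
    UniversalEnvelopingAlgebra ℂ g →ₐ[ℂ] UniversalEnvelopingAlgebra ℂ g' :=
  UniversalEnvelopingAlgebra.lift ℂ ((UniversalEnvelopingAlgebra.ι ℂ).comp f)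

theorem mapEnveloping_ι {g g' : Type*} [LieRing g] [LieAlgebra ℂ g] [LieRing g']
    [LieAlgebra ℂ g'] (f : g →ₗ⁅ℂ⁆ g') (x : g) :
    mapEnveloping f (UniversalEnvelopingAlgebra.ι ℂ x) = UniversalEnvelopingAlgebra.ι ℂ (f x) :=
  UniversalEnvelopingAlgebra.lift_ι_apply _ _ _

theorem mapEnveloping_surjective {g g' : Type*} [LieRing g] [LieAlgebra ℂ g] [LieRing g']
    [LieAlgebra ℂ g'] {f : g →ₗ⁅ℂ⁆ g'} (hf : Function.Surjective f) :
    Function.Surjective (mapEnveloping f) := by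
  have h1 : (⊤ : Submodule ℂ (UniversalEnvelopingAlgebra ℂ g')) ≤
      LinearMap.range (mapEnveloping f).toLinearMap := by
    rw [← span_range_word, Submodule.span_le]
    rintro _ ⟨l, rfl⟩
    induction l with
    | nil => exact ⟨1, by simp [word]⟩
    | cons y l ih =>
      obtain ⟨u, hu⟩ := ih
      obtain ⟨x, rfl⟩ := hf y
      refine ⟨UniversalEnvelopingAlgebra.ι ℂ x * u, ?_⟩
      rw [word_cons, ← hu, ← mapEnveloping_ι]
      exact map_mul (mapEnveloping f) _ _
  intro u
  exact h1 trivial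

theorem comp_mapEnveloping_eq {g g' A : Type*} [LieRing g] [LieAlgebra ℂ g] [LieRing g']
    [LieAlgebra ℂ g'] [Ring A] [Algebra ℂ A] (f : g →ₗ⁅ℂ⁆ g')
    {π : UniversalEnvelopingAlgebra ℂ g' →ₐ[ℂ] A} {ι : UniversalEnvelopingAlgebra ℂ g →ₐ[ℂ] A}
    (h : ∀ x, π (UniversalEnvelopingAlgebra.ι ℂ (f x)) = ι (UniversalEnvelopingAlgebra.ι ℂ x)) :
    π.comp (mapEnveloping f) = ι := by
  refine UniversalEnvelopingAlgebra.hom_ext _ (LieHom.ext fun x => ?_)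
  change π (mapEnveloping f (UniversalEnvelopingAlgebra.ι ℂ x)) = _
  rw [mapEnveloping_ι, h]
  rfl

/-- The restriction of a map out of the enveloping algebra to the Lie algebra. -/
def restrictLieHom {L A : Type*} [LieRing L] [LieAlgebra ℂ L] [Ring A] [Algebra ℂ A]
    (ι : UniversalEnvelopingAlgebra ℂ L →ₐ[ℂ] A) : L →ₗ⁅ℂ⁆ A :=
  ι.toLieHom.comp (UniversalEnvelopingAlgebra.ι ℂ)

/-- The image of a Lie algebra acting locally completely reducibly is reductive, and so has a
triangular decomposition. -/
theorem exists_triangularData_of_locally_complemented {L : Type*} [LieRing L] [LieAlgebra ℂ L]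
    [FiniteDimensional ℂ L] {A : Type*} [Ring A] [Algebra ℂ A] (φ : L →ₗ⁅ℂ⁆ A)
    (h : ∀ S : Submodule ℂ A, (∀ X, ∀ b ∈ S, φ X * b - b * φ X ∈ S) →
      ∃ S' : Submodule ℂ A, (∀ X, ∀ b ∈ S', φ X * b - b * φ X ∈ S') ∧ IsCompl S S') :
    ∃ (r s : LieIdeal ℂ φ.range) (f : L →ₗ⁅ℂ⁆ r × s) (j : (r × s) →ₗ⁅ℂ⁆ A) (m n k : ℕ),
      Function.Surjective f ∧ (∀ X, j (f X) = φ X) ∧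
        Nonempty (TriangularData (r × s) (Fin m) (Fin n ⊕ Fin k)) := by
  have : FiniteDimensional ℂ φ.range := inferInstanceAs
    (FiniteDimensional ℂ (LinearMap.range (φ : L →ₗ[ℂ] A)))
  have hl : ComplementedLattice (LieIdeal ℂ φ.range) := by
    refine complementedLattice_lieIdeal _ fun S hS => ?_
    obtain ⟨S', hS', hc⟩ := h S fun X => hS _ ⟨X, rfl⟩
    refine ⟨S', ?_, hc⟩
    rintro _ ⟨X, rfl⟩
    exact hS' X
  obtain ⟨s, hs⟩ := exists_isCompl (LieAlgebra.radical ℂ φ.range)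
  have h1 := isLieAbelian_radical (g := φ.range)
  have h2 := isKilling_of_isCompl_radical hs
  let e := LieEquiv.ofBijective (addLieHom hs.disjoint) (addLieHom_bijective hs)
  obtain ⟨m, n, k, hD⟩ := exists_triangularData (LieAlgebra.radical ℂ φ.range) s
  refine ⟨_, s, e.symm.toLieHom.comp φ.rangeRestrict, φ.range.incl.comp e.toLieHom, m, n, k,
    e.symm.surjective.comp φ.surjective_rangeRestrict, fun X => ?_, hD⟩
  exact congrArg Subtype.val (e.apply_symm_apply (φ.rangeRestrict X))

end Assembly

/-- Lemma `IrrExistenceQuot`.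
Let `(A, G)` be a generalized pair with `G` connected reductive and `A` of countable
dimension, `V` an irreducible `A`-module, and `P ∈ Ass_{Z(g)}(V)` an associated prime.
Then the localization satisfies `V_P / P·V_P ≠ 0`. -/
theorem localization_at_associated_prime_nonzero
    (L : Type*) [LieRing L] [LieAlgebra ℂ L] [FiniteDimensional ℂ L]
    (A : Type*) [Ring A] [Algebra ℂ A]
    (ι : UniversalEnvelopingAlgebra ℂ L →ₐ[ℂ] A)
    (hadj : ∀ a : A, ∃ Fm : Submodule ℂ A, FiniteDimensional ℂ Fm ∧ a ∈ Fm ∧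
      (∀ X : L, ∀ b ∈ Fm, ι (UniversalEnvelopingAlgebra.ι ℂ X) * b
        - b * ι (UniversalEnvelopingAlgebra.ι ℂ X) ∈ Fm) ∧
      (∀ S : Submodule ℂ A, S ≤ Fm →
        (∀ X : L, ∀ b ∈ S, ι (UniversalEnvelopingAlgebra.ι ℂ X) * b
          - b * ι (UniversalEnvelopingAlgebra.ι ℂ X) ∈ S) →
        ∃ S' : Submodule ℂ A, S' ≤ Fm ∧
          (∀ X : L, ∀ b ∈ S', ι (UniversalEnvelopingAlgebra.ι ℂ X) * b
            - b * ι (UniversalEnvelopingAlgebra.ι ℂ X) ∈ S') ∧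
          S ⊓ S' = ⊥ ∧ S ⊔ S' = Fm))
    (hA_countable : ∃ s : Set A, s.Countable ∧ Submodule.span ℂ s = ⊤)
    (V : Type*) [AddCommGroup V] [Module ℂ V] [Module A V] [IsScalarTower ℂ A V]
    [Module (UniversalEnvelopingAlgebra ℂ L) V]
    (hUV : ∀ (u : UniversalEnvelopingAlgebra ℂ L) (v : V), u • v = ι u • v)
    [Nontrivial V] (hirr : ∀ N : Submodule A V, N = ⊥ ∨ N = ⊤)
    (P : Ideal (Subring.center (UniversalEnvelopingAlgebra ℂ L))) [P.IsPrime]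
    (hP : P ∈ associatedPrimes (Subring.center (UniversalEnvelopingAlgebra ℂ L)) V) :
    (P.map (algebraMap (Subring.center (UniversalEnvelopingAlgebra ℂ L))
          (Localization P.primeCompl))) •
        (⊤ : Submodule (Localization P.primeCompl)
          (LocalizedModule P.primeCompl V)) ≠ ⊤ := by
  intro htop
  let _ : LieRing A := LieRing.ofAssociativeRing
  let φ : L →ₗ⁅ℂ⁆ A := restrictLieHom ι
  have hφ : ∀ X, φ X = ι (UniversalEnvelopingAlgebra.ι ℂ X) := fun _ => rfl
  obtain ⟨r, s, f, j, m, n, k, hf, hj, ⟨D⟩⟩ := exists_triangularData_of_locally_complemented φ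
    (exists_isCompl_of_locally_complemented
      (fun X => LinearMap.mulLeft ℂ (φ X) - LinearMap.mulRight ℂ (φ X)) fun a => by
        obtain ⟨F, _, haF, hF, hFc⟩ := hadj a
        exact ⟨F, haF, hF, hFc⟩)
  let π := UniversalEnvelopingAlgebra.lift ℂ j
  have hπ : ∀ X, π (UniversalEnvelopingAlgebra.ι ℂ (f X)) = ι (UniversalEnvelopingAlgebra.ι ℂ X) := by
    intro X
    rw [UniversalEnvelopingAlgebra.lift_ι_apply, hj, hφ]
  have hFs := mapEnveloping_surjective hf
  have hπF := comp_mapEnveloping_eq f hπ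
  let _ : Module (Subalgebra.center ℂ (UniversalEnvelopingAlgebra ℂ (r × s))) V :=
    Module.compHom V ((π : _ →+* A).comp (Subalgebra.center ℂ _).val.toRingHom)
  let ρ := centerMap (mapEnveloping f).toRingHom hFs
  have hρ : ∀ (z : Subring.center (UniversalEnvelopingAlgebra ℂ L)) (v : V), ρ z • v = z • v := by
    intro z v
    change (π.comp (mapEnveloping f)) (z : UniversalEnvelopingAlgebra ℂ L) • v = _
    rw [hπF, ← hUV]
    rfl
  obtain ⟨_, v, hPv⟩ := hP
  have hv : ∀ a, a ∈ P ↔ ∃ k : ℕ, ρ a ^ k • v = 0 := by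
    intro a
    rw [hPv, Ideal.mem_radical_iff]
    simp only [Submodule.mem_colon_singleton, Submodule.mem_bot, ← map_pow, hρ]
  obtain ⟨d, B, hfam⟩ := exists_isCorrespondenceFamily D.hc D.hc_injective D.hc_finite
  obtain ⟨h1, h2⟩ := isNoetherianRing_tensor D.hc D.hc_injective D.hc_finite
  refine hfam.not_forall_exists_smul_mem (fun x x' hx => ?_) ρ P v hv fun x => ?_
  · refine D.isLinked_of_irreducible π (fun _ _ => rfl) (fun a => ?_) hirr hx x'
    obtain ⟨E, hE, haE, hEX, hEc⟩ := hadj a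
    simp only [← hπ] at hEX hEc
    simp only [hf.forall]
    exact ⟨E, hE, haE, hEX, hEc⟩
  · obtain ⟨t, ht, htx⟩ := exists_smul_mem_of_localized_smul_top_eq_top P htop x
    exact ⟨t, ht, by rw [hρ]; exact smul_mem_map_smul_top ρ hρ P htx⟩
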